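/- Let T be a triangulation over a set S of N ≥ 6 points in the plane in general position, where N is even and S has a triangular convex hull (exactly 3 convex-hull vertices), and suppose v3(T) = tN for some real t with 0 ≤ t < 1. Then the sum, over all spanning cycles C of S contained in T, of 1/supp(C) is strictly less than 8 · ( (3/2^t) · ( (2−t)(2−t/2)/(1−t)² )^{1−t} )^{N/4}. -/

import Mathlib

open scoped Classical

noncomputable section

/-- Points of the plane. -/
abbrev Pt : Type := ℝ × ℝ

/-- A finite point set is in general position if no three of its points are collinear. -/
def GenPos (S : Finset Pt) : Prop :=
  ∀ p ∈ S, ∀ q ∈ S, ∀ r ∈ S, p ≠ q → p ≠ r → q ≠ r →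
    ¬ Collinear ℝ ({p, q, r} : Set Pt)

/-- The closed straight segment spanned by an unordered pair of points. -/
def seg2 (e : Sym2 Pt) : Set Pt :=
  Sym2.lift ⟨fun p q => segment ℝ p q, fun p q => segment_symm ℝ p q⟩ e

/-- A crossing-free straight-edge graph (plane graph) on the point set `S`:
its edges are straight segments between points of `S`, any two of which
meet only at shared endpoints. -/
structure PlaneGraph (S : Finset Pt) where
  edges : Finset (Sym2 Pt)
  endpoint_mem : ∀ e ∈ edges, ∀ p, p ∈ e → p ∈ S
  not_isDiag : ∀ e ∈ edges, ¬ e.IsDiag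
  noncrossing : ∀ e₁ ∈ edges, ∀ e₂ ∈ edges, e₁ ≠ e₂ →
    ∀ x ∈ seg2 e₁ ∩ seg2 e₂, x ∈ e₁ ∧ x ∈ e₂

/-- A triangulation of `S` is a maximal plane graph on `S`. -/
def IsTriangulation {S : Finset Pt} (T : PlaneGraph S) : Prop :=
  ∀ G : PlaneGraph S, T.edges ⊆ G.edges → G.edges = T.edges

/-- `tr S`: the number of triangulations of `S`. -/
def triCount (S : Finset Pt) : ℕ :=
  Nat.card {T : PlaneGraph S // IsTriangulation T}

/-- A plane graph is a spanning cycle of `S` if its edges form a Hamiltonian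
cycle on `S`. -/
def IsSpanningCycle {S : Finset Pt} (G : PlaneGraph S) : Prop :=
  3 ≤ S.card ∧ ∃ f : Fin S.card ≃ {p : Pt // p ∈ S},
    G.edges =
      Finset.image (fun i : Fin S.card => s(((f i : Pt)), ((f (finRotate S.card i) : Pt)))) Finset.univ

/-- `sc S`: the number of crossing-free straight-edge spanning cycles of `S`. -/
def scCount (S : Finset Pt) : ℕ :=
  Nat.card {G : PlaneGraph S // IsSpanningCycle G}

/-- A plane graph is a perfect matching of `S` if every point of `S` is incident
to exactly one edge. -/
def IsPerfectMatching {S : Finset Pt} (G : PlaneGraph S) : Prop :=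
  ∀ p ∈ S, ∃! e, e ∈ G.edges ∧ p ∈ e

/-- `pm S`: the number of crossing-free straight-edge perfect matchings of `S`. -/
def pmCount (S : Finset Pt) : ℕ :=
  Nat.card {G : PlaneGraph S // IsPerfectMatching G}

/-- The support of a plane graph `G` on `S`: the number of triangulations of `S`
containing all edges of `G`. -/
def supp {S : Finset Pt} (G : PlaneGraph S) : ℕ :=
  Nat.card {T : PlaneGraph S // IsTriangulation T ∧ G.edges ⊆ T.edges}

/-- A finite set of points is in (strictly) convex position. -/
def InConvexPosition (Q : Finset Pt) : Prop :=
  ∀ p ∈ Q, p ∉ convexHull ℝ (↑(Q.erase p) : Set Pt)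

/-- `p q` is an edge of the convex hull boundary of `Q`. -/
def IsHullEdgeOf (Q : Finset Pt) (p q : Pt) : Prop :=
  p ∈ Q ∧ q ∈ Q ∧ p ≠ q ∧
    segment ℝ p q ⊆ frontier (convexHull ℝ (Q : Set Pt))

/-- `e` is a diagonal of the convex polygon with vertex set `Q`. -/
def IsDiagonalOf (Q : Finset Pt) (e : Sym2 Pt) : Prop :=
  ∃ p ∈ Q, ∃ q ∈ Q, e = s(p, q) ∧
    openSegment ℝ p q ⊆ interior (convexHull ℝ (Q : Set Pt))

/-- `F` is a set of ps-flippable (pseudo-simultaneously flippable) edges of the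
triangulation `T`: the edges of `F` are diagonals of pairwise interior-disjoint
(empty) convex polygons whose boundary edges all belong to `T`. -/
def IsPsFlippable {S : Finset Pt} (T : PlaneGraph S) (F : Finset (Sym2 Pt)) : Prop :=
  F ⊆ T.edges ∧
  ∃ 𝒬 : Finset (Finset Pt),
    (∀ Q ∈ 𝒬, ↑Q ⊆ (S : Set Pt) ∧ 3 ≤ Q.card ∧ InConvexPosition Q ∧
      (∀ p q, IsHullEdgeOf Q p q → s(p, q) ∈ T.edges) ∧
      (∀ p ∈ S, p ∉ interior (convexHull ℝ (Q : Set Pt)))) ∧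
    (∀ Q ∈ 𝒬, ∀ Q' ∈ 𝒬, Q ≠ Q' →
      interior (convexHull ℝ (Q : Set Pt)) ∩ interior (convexHull ℝ (Q' : Set Pt)) = ∅) ∧
    (∀ e ∈ F, ∃ Q ∈ 𝒬, IsDiagonalOf Q e)

/-- The drawing of a plane graph: the union of its (closed) edge segments and
its vertex set. -/
def drawing {S : Finset Pt} (G : PlaneGraph S) : Set Pt :=
  (⋃ e ∈ G.edges, seg2 e) ∪ (S : Set Pt)

/-- A convex decomposition of `S`: a plane graph containing all convex hull
boundary edges, whose bounded faces are all convex, and with no isolated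
vertices. -/
def IsConvexDecomposition {S : Finset Pt} (D : PlaneGraph S) : Prop :=
  (∀ p q, IsHullEdgeOf S p q → s(p, q) ∈ D.edges) ∧
  (∀ x ∉ drawing D, Bornology.IsBounded (connectedComponentIn (drawing D)ᶜ x) →
    Convex ℝ (connectedComponentIn (drawing D)ᶜ x)) ∧
  (∀ p ∈ S, ∃ e ∈ D.edges, p ∈ e)

/-- `p` is an interior vertex of `S` (not on the convex hull boundary). -/
def InteriorVtx (S : Finset Pt) (p : Pt) : Prop :=
  p ∈ S ∧ p ∉ frontier (convexHull ℝ (S : Set Pt))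

/-- `p` has a valid triple of edges in `G`. -/
def IsValidAt {S : Finset Pt} (G : PlaneGraph S) (p : Pt) : Prop :=
  ∃ a ∈ S, ∃ b ∈ S, ∃ c ∈ S,
    p ∈ convexHull ℝ ({a, b, c} : Set Pt) ∧
    s(p, a) ∈ G.edges ∧ s(p, b) ∈ G.edges ∧ s(p, c) ∈ G.edges

/-- The degree of a point in a plane graph. -/
def degree {S : Finset Pt} (G : PlaneGraph S) (p : Pt) : ℕ :=
  (G.edges.filter (fun e => p ∈ e)).card

/-- `a b c` span a triangular face of the triangulation `T`. -/
def IsTriFace {S : Finset Pt} (T : PlaneGraph S) (a b c : Pt) : Prop :=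
  a ∈ S ∧ b ∈ S ∧ c ∈ S ∧
  s(a, b) ∈ T.edges ∧ s(b, c) ∈ T.edges ∧ s(a, c) ∈ T.edges ∧
  ∀ p ∈ S, p ∉ interior (convexHull ℝ ({a, b, c} : Set Pt))

/-- An edge of a triangulation is flippable if its two incident triangles form
a convex quadrilateral. -/
def IsFlippable {S : Finset Pt} (T : PlaneGraph S) (e : Sym2 Pt) : Prop :=
  e ∈ T.edges ∧ ∃ a b c d : Pt, e = s(a, b) ∧ c ≠ d ∧
    IsTriFace T a b c ∧ IsTriFace T a b d ∧
    (openSegment ℝ a b ∩ openSegment ℝ c d).Nonempty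

/-- `flip T`: the number of flippable edges of `T`. -/
def flipCount {S : Finset Pt} (T : PlaneGraph S) : ℕ :=
  (T.edges.filter (fun e => IsFlippable T e)).card

/-- `v3 T`: the number of interior vertices of degree 3 in `T`. -/
def v3 {S : Finset Pt} (T : PlaneGraph S) : ℕ :=
  (S.filter (fun p => p ∉ frontier (convexHull ℝ (S : Set Pt)) ∧ degree T p = 3)).card

/-- The number of vertices of `S` on its convex hull boundary. -/
def hullVtxCount (S : Finset Pt) : ℕ :=
  (S.filter (fun p => p ∈ frontier (convexHull ℝ (S : Set Pt)))).card

/-- Signed area (orientation) of three points. -/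
def cr (a b c : Pt) : ℝ := (b.1 - a.1) * (c.2 - a.2) - (b.2 - a.2) * (c.1 - a.1)

/-- The point at parameter `s` on the line through `a` and `b`. -/
def lpt (a b : Pt) (s : ℝ) : Pt := (a.1 + s * (b.1 - a.1), a.2 + s * (b.2 - a.2))

lemma lpt_one (a b : Pt) : lpt a b 1 = b := by
  apply Prod.ext <;> simp [lpt]

lemma lpt_zero (a b : Pt) : lpt a b 0 = a := by
  apply Prod.ext <;> simp [lpt]

lemma lpt_swap (a b : Pt) (s : ℝ) : lpt a b s = lpt b a (1 - s) := by
  apply Prod.ext <;> simp only [lpt] <;> ring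

lemma mem_seg_iff (a b z : Pt) : z ∈ segment ℝ a b ↔ ∃ s : ℝ, 0 ≤ s ∧ s ≤ 1 ∧ z = lpt a b s := by
  rw [segment_eq_image']
  constructor
  · rintro ⟨s, ⟨h0, h1⟩, rfl⟩
    exact ⟨s, h0, h1, by apply Prod.ext <;> simp [lpt]⟩
  · rintro ⟨s, h0, h1, rfl⟩
    exact ⟨s, ⟨h0, h1⟩, by apply Prod.ext <;> simp [lpt]⟩

lemma lpt_mem_seg (a b : Pt) {s : ℝ} (h0 : 0 ≤ s) (h1 : s ≤ 1) : lpt a b s ∈ segment ℝ a b :=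
  (mem_seg_iff a b _).2 ⟨s, h0, h1, rfl⟩

lemma cr_lpt (a b u v : Pt) (s : ℝ) :
    cr a b (lpt u v s) = (1 - s) * cr a b u + s * cr a b v := by
  simp only [cr, lpt]; ring

lemma cr_lpt2 (a b u v : Pt) (s : ℝ) :
    cr a (lpt u v s) b = (1 - s) * cr a u b + s * cr a v b := by
  simp only [cr, lpt]; ring

lemma cr_rot (a b c : Pt) : cr b c a = cr a b c := by simp only [cr]; ring
lemma cr_rot' (a b c : Pt) : cr c a b = cr a b c := by simp only [cr]; ring
lemma cr_swap (a b c : Pt) : cr a c b = - cr a b c := by simp only [cr]; ring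
lemma cr_swap' (a b c : Pt) : cr b a c = - cr a b c := by simp only [cr]; ring
lemma cr_swap13 (a b c : Pt) : cr c b a = - cr a b c := by simp only [cr]; ring
lemma cr_self1 (a c : Pt) : cr a a c = 0 := by simp only [cr]; ring
lemma cr_self2 (a c : Pt) : cr a c a = 0 := by simp only [cr]; ring
lemma cr_self3 (a c : Pt) : cr a c c = 0 := by simp only [cr]; ring

lemma lpt_inj {a b : Pt} (hab : a ≠ b) {s s' : ℝ} (h : lpt a b s = lpt a b s') : s = s' := by
  have h1 := congrArg Prod.fst h
  have h2 := congrArg Prod.snd h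
  simp only [lpt] at h1 h2
  by_contra hne
  apply hab
  have e1 : (s - s') * (b.1 - a.1) = 0 := by linarith
  have e2 : (s - s') * (b.2 - a.2) = 0 := by linarith
  have hs : s - s' ≠ 0 := sub_ne_zero.2 hne
  have f1 := (mul_eq_zero.1 e1).resolve_left hs
  have f2 := (mul_eq_zero.1 e2).resolve_left hs
  apply Prod.ext <;> linarith

lemma lpt_eq_left {a b : Pt} (hab : a ≠ b) {s : ℝ} (h : lpt a b s = a) : s = 0 :=
  lpt_inj hab (h.trans (lpt_zero a b).symm)

lemma lpt_eq_right {a b : Pt} (hab : a ≠ b) {s : ℝ} (h : lpt a b s = b) : s = 1 :=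
  lpt_inj hab (h.trans (lpt_one a b).symm)

/-- Expand `y` in the frame at `p` given by `q` and `r`. -/
lemma frame_on_line {p q r y : Pt} (hD : cr p q r ≠ 0) (h : cr p q y = 0) :
    y = lpt p q (cr p y r / cr p q r) := by
  have e1 : (y.1 - p.1) * cr p q r = cr p y r * (q.1 - p.1) + cr p q y * (r.1 - p.1) := by
    simp only [cr]; ring
  have e2 : (y.2 - p.2) * cr p q r = cr p y r * (q.2 - p.2) + cr p q y * (r.2 - p.2) := by
    simp only [cr]; ring
  rw [h] at e1 e2
  apply Prod.ext
  · simp only [lpt]; field_simp; linarith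
  · simp only [lpt]; field_simp; linarith

lemma gp_ne {S : Finset Pt} (hS : GenPos S) {p q r : Pt} (hp : p ∈ S) (hq : q ∈ S) (hr : r ∈ S)
    (hpq : p ≠ q) (hpr : p ≠ r) (hqr : q ≠ r) : cr p q r ≠ 0 := by
  intro h
  apply hS p hp q hq r hr hpq hpr hqr
  rw [collinear_iff_of_mem (p₀ := p) (by simp)]
  refine ⟨(q.1 - p.1, q.2 - p.2), ?_⟩
  intro x hx
  simp only [Set.mem_insert_iff, Set.mem_singleton_iff] at hx
  rcases hx with rfl | rfl | rfl
  · exact ⟨0, by simp⟩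
  · exact ⟨1, by apply Prod.ext <;> simp⟩
  · by_cases h1 : q.1 - p.1 = 0
    · have h2 : q.2 - p.2 ≠ 0 := by
        intro h2; apply hpq; apply Prod.ext <;> linarith
      have h3 : x.1 - p.1 = 0 := by
        simp only [cr, h1] at h
        have : (q.2 - p.2) * (x.1 - p.1) = 0 := by linarith
        exact (mul_eq_zero.1 this).resolve_left h2
      refine ⟨(x.2 - p.2) / (q.2 - p.2), ?_⟩
      apply Prod.ext
      · simp [h1]; linarith
      · simp; field_simp; ring
    · refine ⟨(x.1 - p.1) / (q.1 - p.1), ?_⟩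
      simp only [cr] at h
      apply Prod.ext
      · simp; field_simp; ring
      · simp; field_simp; linarith

/-- First exit lemma for two affine functions. -/
lemma first_exit {a0 a1 b0 b1 : ℝ} (ha : 0 < a0) (hb : 0 < b0) (h : a1 ≤ 0 ∨ b1 ≤ 0) :
    ∃ s : ℝ, 0 < s ∧ s ≤ 1 ∧
      (((1 - s) * a0 + s * a1 = 0 ∧ 0 ≤ (1 - s) * b0 + s * b1) ∨
       ((1 - s) * b0 + s * b1 = 0 ∧ 0 ≤ (1 - s) * a0 + s * a1)) := by
  have key : ∀ x0 x1 y0 y1 : ℝ, 0 < x0 → 0 < y0 → x1 ≤ 0 → x0 * y1 - x1 * y0 ≥ 0 →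
      ∃ s : ℝ, 0 < s ∧ s ≤ 1 ∧ (1 - s) * x0 + s * x1 = 0 ∧ 0 ≤ (1 - s) * y0 + s * y1 := by
    intro x0 x1 y0 y1 hx hy hx1 hh
    have hd : 0 < x0 - x1 := by linarith
    refine ⟨x0 / (x0 - x1), by positivity, ?_, ?_, ?_⟩
    · rw [div_le_one hd]; linarith
    · field_simp; ring
    · have : (1 - x0 / (x0 - x1)) * y0 + x0 / (x0 - x1) * y1 = (x0 * y1 - x1 * y0) / (x0 - x1) := by
        field_simp; ring
      rw [this]; exact div_nonneg hh hd.le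
  by_cases hh : a0 * b1 - a1 * b0 ≥ 0
  · by_cases h1 : a1 ≤ 0
    · obtain ⟨s, h0, h1, h2, h3⟩ := key a0 a1 b0 b1 ha hb h1 hh
      exact ⟨s, h0, h1, Or.inl ⟨h2, h3⟩⟩
    · exfalso
      have hb1 := h.resolve_left h1
      push Not at h1
      have := mul_pos h1 hb
      have := mul_nonneg ha.le (neg_nonneg.2 hb1)
      linarith
  · push Not at hh
    by_cases h1 : b1 ≤ 0
    · obtain ⟨s, h0, h1, h2, h3⟩ := key b0 b1 a0 a1 hb ha h1 (by linarith)
      exact ⟨s, h0, h1, Or.inr ⟨h2, h3⟩⟩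
    · exfalso
      have ha1 := h.resolve_right h1
      push Not at h1
      have := mul_pos ha h1
      have := mul_nonneg hb.le (neg_nonneg.2 ha1)
      linarith

/-- Adjacency in a plane graph. -/
def padj {S : Finset Pt} (T : PlaneGraph S) (p q : Pt) : Prop := s(p, q) ∈ T.edges

section basic
variable {S : Finset Pt} {T : PlaneGraph S}

lemma padj_symm {p q : Pt} (h : padj T p q) : padj T q p := by
  unfold padj at *; rwa [Sym2.eq_swap]

lemma padj_left {p q : Pt} (h : padj T p q) : p ∈ S := T.endpoint_mem _ h p (by simp)
lemma padj_right {p q : Pt} (h : padj T p q) : q ∈ S := T.endpoint_mem _ h q (by simp)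
lemma padj_ne {p q : Pt} (h : padj T p q) : p ≠ q := by
  have := T.not_isDiag _ h
  simpa using this

lemma seg2_mk (p q : Pt) : seg2 s(p, q) = segment ℝ p q := rfl

/-- Two edges sharing a point that is not an endpoint of the first one coincide. -/
lemma plane_same {u v u' v' z : Pt} (h : padj T u v) (h' : padj T u' v')
    (hz : z ∈ segment ℝ u v) (hz' : z ∈ segment ℝ u' v') (hzu : z ≠ u) (hzv : z ≠ v) :
    s(u, v) = s(u', v') := by
  by_contra hne
  have := T.noncrossing _ h _ h' hne z ⟨hz, hz'⟩
  have h1 := this.1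
  simp only [Sym2.mem_iff] at h1
  rcases h1 with h1 | h1
  · exact hzu h1
  · exact hzv h1

/-- on the same edge, orientation with respect to an equal edge vanishes -/
lemma cr_zero_of_same {u v u' v' : Pt} (h : s(u, v) = s(u', v')) {z : Pt}
    (hz : z ∈ segment ℝ u v) : cr u' v' z = 0 := by
  obtain ⟨s, h0, h1, rfl⟩ := (mem_seg_iff u v z).1 hz
  rw [Sym2.eq_iff] at h
  rcases h with ⟨rfl, rfl⟩ | ⟨rfl, rfl⟩ <;> simp only [cr, lpt] <;> ring

/-- A point of `S` on a segment between points of `S` is an endpoint. -/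
lemma mem_seg_S (hS : GenPos S) {u v z : Pt} (hu : u ∈ S) (hv : v ∈ S) (hz : z ∈ S) (huv : u ≠ v)
    (h : z ∈ segment ℝ u v) : z = u ∨ z = v := by
  by_contra hne
  push Not at hne
  apply gp_ne hS hu hv hz huv hne.1.symm hne.2.symm
  exact cr_zero_of_same rfl h

/-- Two segments with endpoints in `S` that meet in a point which is not a common endpoint
cross properly. -/
lemma proper_cross (hS : GenPos S) {x y u v z : Pt} (hx : x ∈ S) (hy : y ∈ S) (hu : u ∈ S)
    (hv : v ∈ S) (hxy : x ≠ y) (huv : u ≠ v) (hne : s(u, v) ≠ s(x, y))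
    (hz1 : z ∈ segment ℝ u v) (hz2 : z ∈ segment ℝ x y)
    (hnot : ¬ (z ∈ s(u, v) ∧ z ∈ s(x, y))) :
    (u ≠ x ∧ u ≠ y ∧ v ≠ x ∧ v ≠ y) ∧ z ≠ x ∧ z ≠ y ∧ z ≠ u ∧ z ≠ v ∧
      cr x y u * cr x y v < 0 := by
  -- sharing an endpoint
  have share : ∀ a b c : Pt, a ∈ S → b ∈ S → c ∈ S → a ≠ b → a ≠ c → b ≠ c →
      z ∈ segment ℝ a b → z ∈ segment ℝ a c → z = a := by
    intro a b c ha hb hc hab hac hbc h1 h2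
    have hc1 := gp_ne hS ha hb hc hab hac hbc
    obtain ⟨s, hs0, hs1, rfl⟩ := (mem_seg_iff _ _ _).1 h1
    have := cr_zero_of_same (u' := a) (v' := c) rfl h2
    rw [cr_lpt, cr_self2] at this
    have h3 : cr a c b ≠ 0 := by rw [cr_swap]; simpa using hc1
    have : s = 0 := by
      have h4 : s * cr a c b = 0 := by linarith
      exact (mul_eq_zero.1 h4).resolve_right h3
    rw [this, lpt_zero]
  have hux : u ≠ x := by
    rintro rfl
    have hvy : v ≠ y := by rintro rfl; exact hne rfl
    have := share u v y hu hv hy huv hxy hvy hz1 hz2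
    exact hnot ⟨by simp [this], by simp [this]⟩
  have huy : u ≠ y := by
    rintro rfl
    have hvy : v ≠ x := by rintro rfl; exact hne Sym2.eq_swap
    have := share u v x hu hv hx huv hxy.symm hvy hz1 (by rwa [segment_symm])
    exact hnot ⟨by simp [this], by simp [this]⟩
  have hvx : v ≠ x := by
    rintro rfl
    have := share v u y hv hu hy huv.symm hxy huy (by rwa [segment_symm]) hz2
    exact hnot ⟨by simp [this], by simp [this]⟩
  have hvy : v ≠ y := by
    rintro rfl
    have := share v u x hv hu hx huv.symm hxy.symm hux (by rwa [segment_symm]) (by rwa [segment_symm])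
    exact hnot ⟨by simp [this], by simp [this]⟩
  have hzx : z ≠ x := by
    rintro rfl
    rcases mem_seg_S hS hu hv hx huv hz1 with h | h
    · exact hux h.symm
    · exact hvx h.symm
  have hzy : z ≠ y := by
    rintro rfl
    rcases mem_seg_S hS hu hv hy huv hz1 with h | h
    · exact huy h.symm
    · exact hvy h.symm
  have hzu : z ≠ u := by
    rintro rfl
    rcases mem_seg_S hS hx hy hu hxy hz2 with h | h
    · exact hux h
    · exact huy h
  have hzv : z ≠ v := by
    rintro rfl
    rcases mem_seg_S hS hx hy hv hxy hz2 with h | h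
    · exact hvx h
    · exact hvy h
  refine ⟨⟨hux, huy, hvx, hvy⟩, hzx, hzy, hzu, hzv, ?_⟩
  have cu := gp_ne hS hx hy hu hxy hux.symm huy.symm
  have cv := gp_ne hS hx hy hv hxy hvx.symm hvy.symm
  have hz0 := cr_zero_of_same (u' := x) (v' := y) rfl hz2
  obtain ⟨s, h0, h1, rfl⟩ := (mem_seg_iff _ _ _).1 hz1
  rw [cr_lpt] at hz0
  have hs0 : s ≠ 0 := by rintro rfl; exact hzu (lpt_zero _ _)
  have hs1 : s ≠ 1 := by rintro rfl; exact hzv (lpt_one _ _)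
  have hs0' : 0 < s := lt_of_le_of_ne h0 (Ne.symm hs0)
  have hs1' : 0 < 1 - s := by
    have := lt_of_le_of_ne h1 hs1; linarith
  by_contra hcon
  push Not at hcon
  have hpos : 0 < cr x y u * cr x y v := lt_of_le_of_ne hcon (Ne.symm (mul_ne_zero cu cv))
  have e : (1 - s) * (cr x y u * cr x y u) + s * (cr x y u * cr x y v) = 0 := by
    linear_combination (cr x y u) * hz0
  have e1 : 0 < cr x y u * cr x y u := mul_self_pos.2 cu
  nlinarith [mul_pos hs1' e1, mul_pos hs0' hpos]

/-- Insert an edge. -/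
def insEdge (G : PlaneGraph S) (x y : Pt) (hx : x ∈ S) (hy : y ∈ S) (hxy : x ≠ y)
    (h : ∀ u v, padj G u v → s(u, v) ≠ s(x, y) → ∀ z, z ∈ segment ℝ u v → z ∈ segment ℝ x y →
      z ∈ s(u, v) ∧ z ∈ s(x, y)) : PlaneGraph S where
  edges := insert s(x, y) G.edges
  endpoint_mem := by
    intro e he p hp
    rw [Finset.mem_insert] at he
    rcases he with rfl | he
    · simp only [Sym2.mem_iff] at hp
      rcases hp with rfl | rfl <;> assumption
    · exact G.endpoint_mem e he p hp
  not_isDiag := by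
    intro e he
    rw [Finset.mem_insert] at he
    rcases he with rfl | he
    · simpa using hxy
    · exact G.not_isDiag e he
  noncrossing := by
    intro e1 h1 e2 h2 hne z hz
    rw [Finset.mem_insert] at h1 h2
    rcases h1 with rfl | h1
    · rcases h2 with rfl | h2
      · exact absurd rfl hne
      · induction e2 using Sym2.ind with
        | _ u v => exact (h u v h2 hne.symm z hz.2 hz.1).symm
    · rcases h2 with rfl | h2
      · induction e1 using Sym2.ind with
        | _ u v => exact h u v h1 hne z hz.1 hz.2
      · exact G.noncrossing e1 h1 e2 h2 hne z hz

/-- Sub-plane-graph. -/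
def subGraph (G : PlaneGraph S) (E : Finset (Sym2 Pt)) (h : E ⊆ G.edges) : PlaneGraph S where
  edges := E
  endpoint_mem := fun e he => G.endpoint_mem e (h he)
  not_isDiag := fun e he => G.not_isDiag e (h he)
  noncrossing := fun e1 h1 e2 h2 => G.noncrossing e1 (h h1) e2 (h h2)

lemma pg_ext {G H : PlaneGraph S} (h : G.edges = H.edges) : G = H := by
  cases G; cases H; cases h; rfl

/-- Maximality: a missing segment is properly crossed by an edge. -/
lemma max_cross (hS : GenPos S) (hT : IsTriangulation T) {x y : Pt} (hx : x ∈ S) (hy : y ∈ S)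
    (hxy : x ≠ y) (hn : ¬ padj T x y) :
    ∃ u v : Pt, ∃ a b : ℝ, padj T u v ∧ 0 < a ∧ a < 1 ∧ 0 < b ∧ b < 1 ∧
      lpt x y a = lpt u v b ∧ 0 < cr x y u ∧ cr x y v < 0 := by
  by_contra hcon
  have hins : ∀ u v, padj T u v → s(u, v) ≠ s(x, y) → ∀ z, z ∈ segment ℝ u v →
      z ∈ segment ℝ x y → z ∈ s(u, v) ∧ z ∈ s(x, y) := by
    intro u v huv hne z hz1 hz2
    by_contra hnot
    obtain ⟨-, hzx, hzy, hzu, hzv, hs⟩ := proper_cross hS hx hy (padj_left huv) (padj_right huv)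
      hxy (padj_ne huv) hne hz1 hz2 hnot
    obtain ⟨b, hb0, hb1, hzb⟩ := (mem_seg_iff _ _ _).1 hz1
    obtain ⟨a, ha0, ha1, hza⟩ := (mem_seg_iff _ _ _).1 hz2
    have ha0' : 0 < a := lt_of_le_of_ne ha0 (by rintro rfl; exact hzx (hza.trans (lpt_zero _ _)))
    have hb0' : 0 < b := lt_of_le_of_ne hb0 (by rintro rfl; exact hzu (hzb.trans (lpt_zero _ _)))
    have ha1' : a < 1 := lt_of_le_of_ne ha1 (by rintro rfl; exact hzy (hza.trans (lpt_one _ _)))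
    have hb1' : b < 1 := lt_of_le_of_ne hb1 (by rintro rfl; exact hzv (hzb.trans (lpt_one _ _)))
    apply hcon
    rcases mul_neg_iff.1 hs with ⟨h1, h2⟩ | ⟨h1, h2⟩
    · exact ⟨u, v, a, b, huv, ha0', ha1', hb0', hb1', hza.symm.trans hzb, h1, h2⟩
    · exact ⟨v, u, a, 1 - b, padj_symm huv, ha0', ha1', by linarith, by linarith,
        by rw [← lpt_swap]; exact hza.symm.trans hzb, h2, h1⟩
  have := hT (insEdge T x y hx hy hxy hins) (Finset.subset_insert _ _)
  apply hn
  unfold padj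
  rw [← this]
  exact Finset.mem_insert_self _ _

end basic

section wedge
variable {S : Finset Pt} {T : PlaneGraph S}

/-- Nothing enters an empty wedge below the level `L`. -/
lemma wedge_clear {p q r : Pt} (hpq : padj T p q) (hpr : padj T p r)
    (hD : 0 < cr p q r) (hno : ∀ s, padj T p s → ¬ (0 < cr p q s ∧ 0 < cr p s r))
    {L : ℝ} (hL : L ≤ cr p q r)
    (hempty : ∀ s ∈ S, ¬ (0 < cr p q s ∧ 0 < cr p s r ∧ cr p q s + cr p s r < L))
    {u v : Pt} (huv : padj T u v) {z : Pt} (hz : z ∈ segment ℝ u v)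
    (h1 : 0 < cr p q z) (h2 : 0 < cr p z r) (h3 : cr p q z + cr p z r < L) : False := by
  -- reduce to the case where the level does not increase towards `u`
  wlog hdir : cr p q u + cr p u r ≤ cr p q z + cr p z r generalizing u v
  · refine this (padj_symm huv) (by rwa [segment_symm]) ?_
    obtain ⟨m, hm0, hm1, rfl⟩ := (mem_seg_iff _ _ _).1 hz
    rw [cr_lpt, cr_lpt2] at *
    push Not at hdir
    have : m * ((cr p q u + cr p u r) - (cr p q v + cr p v r)) > 0 := by nlinarith
    have h5 : 0 < (cr p q u + cr p u r) - (cr p q v + cr p v r) := by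
      by_contra hc
      push Not at hc
      nlinarith
    nlinarith
  -- the exit
  have huS := padj_left huv
  have hex : cr p q u ≤ 0 ∨ cr p u r ≤ 0 := by
    by_contra hc
    push Not at hc
    exact hempty u huS ⟨hc.1, hc.2, by linarith⟩
  -- endpoints of uv at p
  have hp_end : ∀ w, padj T p w → z ∈ segment ℝ p w → False := by
    intro w hw hzw
    obtain ⟨m, hm0, hm1, rfl⟩ := (mem_seg_iff _ _ _).1 hzw
    rw [cr_lpt, cr_self2] at h1
    rw [cr_lpt2, cr_self1] at h2
    refine hno w hw ⟨?_, ?_⟩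
    · by_contra hc
      push Not at hc
      nlinarith
    · by_contra hc
      push Not at hc
      nlinarith
  have hpe : ∀ y, y ∈ segment ℝ u v → y = p → y ∈ s(u, v) → False := by
    intro y _ hyp hys
    rw [hyp, Sym2.mem_iff] at hys
    rcases hys with rfl | rfl
    · exact hp_end v huv hz
    · exact hp_end u (padj_symm huv) (by rwa [segment_symm])
  obtain ⟨s, hs0, hs1, hcase⟩ := first_exit h1 h2 hex
  set y := lpt z u s with hy
  have hyuv : y ∈ segment ℝ u v := by
    apply (convex_segment u v).segment_subset hz (left_mem_segment ℝ u v)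
    exact lpt_mem_seg z u hs0.le hs1
  have e1 : cr p q y = (1 - s) * cr p q z + s * cr p q u := cr_lpt _ _ _ _ _
  have e2 : cr p y r = (1 - s) * cr p z r + s * cr p u r := cr_lpt2 _ _ _ _ _
  have hlev : cr p q y + cr p y r < L := by rw [e1, e2]; nlinarith
  rcases hcase with ⟨c1, c2⟩ | ⟨c1, c2⟩
  · rw [← e1] at c1
    rw [← e2] at c2
    have hyl := frame_on_line hD.ne' c1
    have hseg : y ∈ segment ℝ p q := by
      rw [hyl]
      exact lpt_mem_seg _ _ (div_nonneg c2 hD.le) ((div_le_one hD).2 (by linarith))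
    by_cases hsame : s(u, v) = s(p, q)
    · have := cr_zero_of_same hsame hz
      linarith
    · have := T.noncrossing _ huv _ hpq hsame y ⟨hyuv, hseg⟩
      have h6 := this.2
      rw [Sym2.mem_iff] at h6
      rcases h6 with h6 | h6
      · exact hpe y hyuv h6 this.1
      · rw [h6] at hlev
        rw [cr_self3] at hlev
        linarith
  · rw [← e2] at c1
    rw [← e1] at c2
    have c1' : cr p r y = 0 := by rw [cr_swap]; linarith
    have hD' : cr p r q ≠ 0 := by rw [cr_swap]; linarith
    have hyl := frame_on_line hD' c1'
    have hseg : y ∈ segment ℝ p r := by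
      rw [hyl, cr_swap p q y, cr_swap p q r, neg_div_neg_eq]
      exact lpt_mem_seg _ _ (div_nonneg c2 hD.le) ((div_le_one hD).2 (by linarith))
    by_cases hsame : s(u, v) = s(p, r)
    · have := cr_zero_of_same hsame hz
      rw [cr_swap] at this
      linarith
    · have := T.noncrossing _ huv _ hpr hsame y ⟨hyuv, hseg⟩
      have h6 := this.2
      rw [Sym2.mem_iff] at h6
      rcases h6 with h6 | h6
      · exact hpe y hyuv h6 this.1
      · rw [h6] at hlev
        rw [cr_self3] at hlev
        linarith

/-- Wedge lemma, first part: a wedge without neighbours is empty up to the opposite side. -/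
lemma wedge_empty (hS : GenPos S) (hT : IsTriangulation T) {p q r : Pt}
    (hpq : padj T p q) (hpr : padj T p r)
    (hD : 0 < cr p q r) (hno : ∀ s, padj T p s → ¬ (0 < cr p q s ∧ 0 < cr p s r)) :
    ∀ s ∈ S, ¬ (0 < cr p q s ∧ 0 < cr p s r ∧ cr p q s + cr p s r < cr p q r) := by
  intro s0 hs0 hbad
  let Y := S.filter (fun s => 0 < cr p q s ∧ 0 < cr p s r ∧ cr p q s + cr p s r < cr p q r)
  have hY : Y.Nonempty := ⟨s0, by simp [Y, hs0, hbad]⟩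
  obtain ⟨x, hxY, hxmin⟩ := Y.exists_min_image (fun s => cr p q s + cr p s r) hY
  simp only [Y, Finset.mem_filter] at hxY hxmin
  obtain ⟨hxS, hx1, hx2, hx3⟩ := hxY
  have hpx : p ≠ x := by
    rintro rfl
    rw [cr_self2] at hx1
    exact lt_irrefl _ hx1
  have hnadj : ¬ padj T p x := fun h => hno x h ⟨hx1, hx2⟩
  obtain ⟨u, v, a, b, huv, ha0, ha1, hb0, hb1, hab, -, -⟩ :=
    max_cross hS hT (padj_left hpq) hxS hpx hnadj
  have e1 : cr p q (lpt p x a) = a * cr p q x := by rw [cr_lpt, cr_self2]; ring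
  have e2 : cr p (lpt p x a) r = a * cr p x r := by rw [cr_lpt2, cr_self1]; ring
  refine wedge_clear hpq hpr hD hno (L := cr p q x + cr p x r) hx3.le ?_ huv
    (z := lpt p x a) ?_ ?_ ?_ ?_
  · intro s hs ⟨h1, h2, h3⟩
    have := hxmin s ⟨hs, h1, h2, by linarith⟩
    linarith
  · rw [hab]; exact lpt_mem_seg _ _ hb0.le hb1.le
  · rw [e1]; positivity
  · rw [e2]; positivity
  · rw [e1, e2]; nlinarith

/-- Wedge lemma, second part: the third side is an edge. -/
lemma wedge_edge (hS : GenPos S) (hT : IsTriangulation T) {p q r : Pt}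
    (hpq : padj T p q) (hpr : padj T p r)
    (hD : 0 < cr p q r) (hno : ∀ s, padj T p s → ¬ (0 < cr p q s ∧ 0 < cr p s r)) :
    padj T q r := by
  by_contra hn
  have hqr : q ≠ r := by
    rintro rfl
    rw [cr_self3] at hD
    exact lt_irrefl _ hD
  obtain ⟨u, v, a, b, huv, ha0, ha1, hb0, hb1, hab, h1, h2⟩ :=
    max_cross hS hT (padj_right hpq) (padj_right hpr) hqr hn
  -- `u` lies on the side of `p`
  have hlev : ∀ z, cr p q z + cr p z r = cr p q r - cr q r z := by
    intro z; simp only [cr]; ring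
  set z0 := lpt q r a with hz0
  have ez1 : cr p q z0 = a * cr p q r := by rw [hz0, cr_lpt, cr_self3]; ring
  have ez2 : cr p z0 r = (1 - a) * cr p q r := by rw [hz0, cr_lpt2, cr_self3]; ring
  have z1 : 0 < cr p q z0 := by rw [ez1]; positivity
  have z2 : 0 < cr p z0 r := by rw [ez2]; apply mul_pos; linarith; exact hD
  -- a small step from z0 to u stays inside
  obtain ⟨d, hd0, hd1, hd2, hd3⟩ : ∃ d : ℝ, 0 < d ∧ d < 1 ∧
      0 < (1 - d) * cr p q z0 + d * cr p q u ∧ 0 < (1 - d) * cr p z0 r + d * cr p u r := by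
    have aux : ∀ A B : ℝ, 0 < A → ∀ d, 0 < d → d < A / (A + |B|) → 0 < (1 - d) * A + d * B := by
      intro A B hA d hd hlt
      have hp : 0 < A + |B| := by positivity
      rw [lt_div_iff₀ hp] at hlt
      nlinarith [neg_abs_le B, abs_nonneg B]
    have p1 : 0 < cr p q z0 / (cr p q z0 + |cr p q u|) := by positivity
    have p2 : 0 < cr p z0 r / (cr p z0 r + |cr p u r|) := by positivity
    obtain ⟨d, hd0, hd⟩ := exists_between (lt_min (lt_min p1 p2) one_pos)
    rw [lt_min_iff, lt_min_iff] at hd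
    exact ⟨d, hd0, hd.2, aux _ _ z1 d hd0 hd.1.1, aux _ _ z2 d hd0 hd.1.2⟩
  refine wedge_clear hpq hpr hD hno le_rfl (wedge_empty hS hT hpq hpr hD hno) huv
    (z := lpt z0 u d) ?_ ?_ ?_ ?_
  · apply (convex_segment u v).segment_subset _ (left_mem_segment ℝ u v)
    · exact lpt_mem_seg _ _ hd0.le hd1.le
    · rw [hab]; exact lpt_mem_seg _ _ hb0.le hb1.le
  · rw [cr_lpt]; exact hd2
  · rw [cr_lpt2]; exact hd3
  · rw [hlev, cr_lpt]
    have : cr q r z0 = 0 := by rw [hz0, cr_lpt, cr_self2, cr_self3]; ring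
    rw [this]
    have := mul_pos hd0 h1
    linarith

set_option maxHeartbeats 2000000 in
/-- Gap lemma: if some point of `S` lies in an open half-plane bounded by a line through `p`,
then so does some neighbour of `p`. -/
lemma gap (hS : GenPos S) (hT : IsTriangulation T) {p x : Pt} (hp : p ∈ S) (hx : x ∈ S)
    (α β : ℝ) (hφ : 0 < α * (x.1 - p.1) + β * (x.2 - p.2)) :
    ∃ s, padj T p s ∧ 0 < α * (s.1 - p.1) + β * (s.2 - p.2) := by
  by_contra hcon
  push Not at hcon
  set φ : Pt → ℝ := fun z => α * (z.1 - p.1) + β * (z.2 - p.2) with hφdef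
  have φp : φ p = 0 := by simp [hφdef]
  have φl : ∀ a b s, φ (lpt a b s) = (1 - s) * φ a + s * φ b := by
    intro a b s; simp only [hφdef, lpt]; ring
  have φid : ∀ a b c, φ a * cr p b c - φ b * cr p a c + φ c * cr p a b = 0 := by
    intro a b c; simp only [hφdef, cr]; ring
  have hφx : 0 < φ x := hφ
  have hcon' : ∀ s, padj T p s → φ s ≤ 0 := hcon
  have hpx : p ≠ x := by rintro rfl; rw [φp] at hφx; exact lt_irrefl _ hφx
  have hnx : ¬ padj T p x := fun h => absurd (hcon' x h) (not_le.2 hφx)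
  -- crossings of the segment px
  let Λ : Set ℝ := {l | 0 < l ∧ l < 1 ∧ ∃ u v, padj T u v ∧ lpt p x l ∈ segment ℝ u v}
  have hprop : ∀ l ∈ Λ, ∀ u v, padj T u v → lpt p x l ∈ segment ℝ u v →
      (u ≠ p ∧ u ≠ x ∧ v ≠ p ∧ v ≠ x) ∧ lpt p x l ≠ u ∧ lpt p x l ≠ v ∧
      cr p x u * cr p x v < 0 := by
    intro l hl u v huv hseg
    have hne : s(u, v) ≠ s(p, x) := by
      intro h
      apply hnx
      unfold padj at *
      rwa [← h]
    have hm := lpt_mem_seg p x hl.1.le hl.2.1.le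
    have := proper_cross hS hp hx (padj_left huv) (padj_right huv) hpx (padj_ne huv) hne hseg hm ?_
    · obtain ⟨h1, -, -, h2, h3, h4⟩ := this
      exact ⟨h1, h2, h3, h4⟩
    · rintro ⟨-, h⟩
      rw [Sym2.mem_iff] at h
      rcases h with h | h
      · exact hl.1.ne' (lpt_eq_left hpx h)
      · exact hl.2.1.ne (lpt_eq_right hpx h)
  have hΛfin : Λ.Finite := by
    apply Set.Finite.subset ((S ×ˢ S).image
      (fun uv : Pt × Pt => cr uv.1 uv.2 p / (cr uv.1 uv.2 p - cr uv.1 uv.2 x))).finite_toSet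
    intro l hl
    obtain ⟨u, v, huv, hseg⟩ := hl.2.2
    rw [Finset.mem_coe, Finset.mem_image]
    refine ⟨(u, v), Finset.mem_product.2 ⟨padj_left huv, padj_right huv⟩, ?_⟩
    have h0 := cr_zero_of_same (u' := u) (v' := v) rfl hseg
    rw [cr_lpt] at h0
    obtain ⟨h1, -⟩ := hprop l hl u v huv hseg
    have hne := gp_ne hS (padj_left huv) (padj_right huv) hp (padj_ne huv) h1.1 h1.2.2.1
    have hd : cr u v p - cr u v x ≠ 0 := by
      intro h
      apply hne
      have : cr u v p = cr u v x := by linarith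
      rw [this] at h0 ⊢
      linarith
    simp only
    rw [div_eq_iff hd]
    linarith
  have hΛne : Λ.Nonempty := by
    obtain ⟨u, v, a, b, huv, ha0, ha1, hb0, hb1, hab, -, -⟩ := max_cross hS hT hp hx hpx hnx
    exact ⟨a, ha0, ha1, u, v, huv, by rw [hab]; exact lpt_mem_seg _ _ hb0.le hb1.le⟩
  obtain ⟨l0, hl0, hlmin⟩ := Set.exists_min_image Λ id hΛfin hΛne
  simp only [id] at hlmin
  set z := lpt p x l0 with hz
  have φz : 0 < φ z := by
    rw [hz, φl, φp]
    have := mul_pos hl0.1 hφx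
    linarith
  obtain ⟨u, v, huv, hseg, hvφ⟩ : ∃ u v, padj T u v ∧ z ∈ segment ℝ u v ∧ φ z ≤ φ v := by
    obtain ⟨u, v, huv, hseg⟩ := hl0.2.2
    by_cases h : φ z ≤ φ v
    · exact ⟨u, v, huv, hseg, h⟩
    · refine ⟨v, u, padj_symm huv, by rwa [segment_symm], ?_⟩
      obtain ⟨m, hm0, hm1, hzm⟩ := (mem_seg_iff _ _ _).1 hseg
      rw [← hz] at hzm
      have hz2 : φ z = (1 - m) * φ u + m * φ v := by
        rw [hzm]; exact φl _ _ _
      push Not at h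
      by_contra hc
      push Not at hc
      rcases hm0.eq_or_lt with h0 | h0
      · rw [← h0] at hz2; linarith
      · nlinarith [mul_pos h0 (sub_pos.2 h), mul_nonneg (sub_nonneg.2 hm1) (sub_pos.2 hc).le]
  have φv : 0 < φ v := lt_of_lt_of_le φz hvφ
  obtain ⟨⟨hup, hux, hvp, hvx⟩, hzu, hzv, hsgn⟩ := hprop l0 hl0 u v huv hseg
  obtain ⟨m0, hm00, hm01, hzm⟩ := (mem_seg_iff _ _ _).1 hseg
  rw [← hz] at hzu hzv
  have hvS := padj_right huv
  have huS := padj_left huv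
  -- the sign
  obtain ⟨ε, hε, hεv⟩ : ∃ ε : ℝ, (ε = 1 ∨ ε = -1) ∧ 0 < ε * cr p x v := by
    rcases mul_neg_iff.1 hsgn with ⟨h1, h2⟩ | ⟨h1, h2⟩
    · exact ⟨-1, Or.inr rfl, by linarith⟩
    · exact ⟨1, Or.inl rfl, by linarith⟩
  have hεu : ε * cr p x u < 0 := by
    rcases mul_neg_iff.1 hsgn with ⟨h1, h2⟩ | ⟨h1, h2⟩ <;> rcases hε with rfl | rfl <;> linarith
  have φid' : ∀ a b c, φ a * (ε * cr p b c) - φ b * (ε * cr p a c) + φ c * (ε * cr p a b) = 0 := by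
    intro a b c
    linear_combination ε * φid a b c
  -- f3 at p is positive
  have hm0' : 0 < m0 := lt_of_le_of_ne hm00 (by
    rintro rfl; exact hzu (hzm.trans (lpt_zero _ _)))
  have hm1' : m0 < 1 := lt_of_le_of_ne hm01 (by
    rintro rfl; exact hzv (hzm.trans (lpt_one _ _)))
  have hz3 : cr u v z = 0 := cr_zero_of_same rfl hseg
  have hf3p : 0 < ε * cr u v p := by
    have e : cr p z v = (1 - m0) * cr p u v := by
      rw [hzm, cr_lpt2, cr_self3]; ring
    have e' : cr p z v = l0 * cr p x v := by
      rw [hz, cr_lpt2, cr_self1]; ring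
    have e2 : cr u v p = cr p u v := cr_rot _ _ _
    rw [e2]
    have : (1 - m0) * (ε * cr p u v) = l0 * (ε * cr p x v) := by
      linear_combination ε * e' - ε * e
    have h5 := mul_pos hl0.1 hεv
    by_contra hc
    push Not at hc
    nlinarith
  have hf3l : ∀ l, ε * cr u v (lpt p x l) = (1 - l / l0) * (ε * cr u v p) := by
    intro l
    have h0 : (1 - l0) * cr u v p + l0 * cr u v x = 0 := by rw [← cr_lpt]; exact hz3
    have hl0' := hl0.1.ne'
    have : cr u v x = - ((1 - l0) / l0) * cr u v p := by field_simp; linarith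
    rw [cr_lpt, this]
    field_simp
    ring
  -- candidates for y
  let Y := S.filter (fun s => 0 < ε * cr p x s ∧ 0 ≤ ε * cr p s v ∧ 0 ≤ ε * cr u v s ∧ 0 < φ s)
  have hvY : v ∈ Y := by
    simp only [Y, Finset.mem_filter]
    refine ⟨hvS, hεv, ?_, ?_, φv⟩
    · rw [cr_self3]; simp
    · rw [cr_self3]; simp
  obtain ⟨y, hyY, hymin⟩ := Y.exists_min_image (fun s => (ε * cr p x s) / φ s) ⟨v, hvY⟩
  have hYang : ∀ s ∈ Y, 0 ≤ ε * cr p y s := by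
    intro s hs
    have h1 := hymin s hs
    simp only [Y, Finset.mem_filter] at hs hyY
    rw [div_le_div_iff₀ hyY.2.2.2.2 hs.2.2.2.2] at h1
    have h2 := φid' x y s
    by_contra hc
    push Not at hc
    nlinarith
  simp only [Y, Finset.mem_filter] at hyY
  obtain ⟨hyS, hy1, hy2, hy3, hy4⟩ := hyY
  have hpy : p ≠ y := by rintro rfl; rw [φp] at hy4; exact lt_irrefl _ hy4
  have hny : ¬ padj T p y := fun h => absurd (hcon' y h) (not_le.2 hy4)
  obtain ⟨u', v', a, huvp, ha0, ha1, hwseg, hu'⟩ : ∃ u' v' : Pt, ∃ a : ℝ, padj T u' v' ∧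
      0 < a ∧ a < 1 ∧ lpt p y a ∈ segment ℝ u' v' ∧ ε * cr p y u' < 0 := by
    obtain ⟨u', v', a, b, huv', ha0, ha1, hb0, hb1, hab, h1, h2⟩ := max_cross hS hT hp hyS hpy hny
    have hs : lpt p y a ∈ segment ℝ u' v' := by rw [hab]; exact lpt_mem_seg _ _ hb0.le hb1.le
    rcases hε with rfl | rfl
    · exact ⟨v', u', a, padj_symm huv', ha0, ha1, by rwa [segment_symm], by linarith⟩
    · exact ⟨u', v', a, huv', ha0, ha1, hs, by linarith⟩
  set w := lpt p y a with hw
  have w1 : 0 < ε * cr p x w := by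
    have : ε * cr p x w = a * (ε * cr p x y) := by rw [hw, cr_lpt, cr_self2]; ring
    rw [this]; positivity
  have w3 : 0 < ε * cr u v w := by
    have : ε * cr u v w = (1 - a) * (ε * cr u v p) + a * (ε * cr u v y) := by
      rw [hw, cr_lpt]; ring
    rw [this]
    have := mul_pos (sub_pos.2 ha1) hf3p
    have := mul_nonneg ha0.le hy3
    linarith
  have w2 : cr p w y = 0 := by rw [hw, cr_lpt2, cr_self1, cr_self3]; ring
  have hu'2 : 0 < ε * cr p u' y := by rw [cr_swap]; linarith
  have hnotsame : s(u', v') ≠ s(u, v) := by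
    intro h
    have := cr_zero_of_same h hwseg
    rw [this] at w3
    simp at w3
  -- points in the sector between x and y
  have sector : ∀ e, 0 < ε * cr p x e → 0 < ε * cr p e y → 0 < φ e ∧ 0 < ε * cr p e v := by
    intro e h1 h2
    have k1 := φid' x e y
    have hφe : 0 < φ e := by
      by_contra hc
      push Not at hc
      nlinarith [mul_pos hφx h2, mul_pos hy4 h1]
    refine ⟨hφe, ?_⟩
    have k2 := φid' e y v
    have hyv : 0 ≤ ε * cr p y v := hy2
    by_contra hc
    push Not at hc
    nlinarith [mul_pos φv h2, mul_nonneg hφe.le hyv]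
  have hex : ε * cr p x u' ≤ 0 ∨ ε * cr u v u' ≤ 0 := by
    by_contra hc
    push Not at hc
    obtain ⟨k1, k2⟩ := sector u' hc.1 hu'2
    have : u' ∈ Y := by
      simp only [Y, Finset.mem_filter]
      exact ⟨padj_left huvp, hc.1, k2.le, hc.2.le, k1⟩
    have := hYang u' this
    linarith
  obtain ⟨s, hs0, hs1, hcase⟩ := first_exit w1 w3 hex
  set e := lpt w u' s with he
  have heseg : e ∈ segment ℝ u' v' := by
    apply (convex_segment u' v').segment_subset hwseg (left_mem_segment ℝ u' v')
    exact lpt_mem_seg w u' hs0.le hs1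
  have e1 : ε * cr p x e = (1 - s) * (ε * cr p x w) + s * (ε * cr p x u') := by
    rw [he, cr_lpt]; ring
  have e3 : ε * cr u v e = (1 - s) * (ε * cr u v w) + s * (ε * cr u v u') := by
    rw [he, cr_lpt]; ring
  have e2 : 0 < ε * cr p e y := by
    have : ε * cr p e y = s * (ε * cr p u' y) := by rw [he, cr_lpt2, w2]; ring
    rw [this]; positivity
  have hεne : ε ≠ 0 := by rcases hε with rfl | rfl <;> norm_num
  rw [← e1, ← e3] at hcase
  -- case A : exit through px
  have caseA : ε * cr p x e = 0 → 0 ≤ ε * cr u v e → False := by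
    intro c1 c2
    have c1' : cr p x e = 0 := (mul_eq_zero.1 c1).resolve_left hεne
    have hcy : cr p x y ≠ 0 := by intro h; rw [h] at hy1; simp at hy1
    have hel := frame_on_line hcy c1'
    set l := cr p e y / cr p x y with hl
    have hlpos : 0 < l := by
      have : l = (ε * cr p e y) / (ε * cr p x y) := by
        rw [hl, mul_div_mul_left _ _ hεne]
      rw [this]; positivity
    rw [hel, hf3l] at c2
    have hle : l ≤ l0 := by
      by_contra hc
      push Not at hc
      have : 1 < l / l0 := (one_lt_div hl0.1).2 hc
      nlinarith
    have hlΛ : l ∈ Λ := ⟨hlpos, lt_of_le_of_lt hle hl0.2.1, u', v', huvp, by rw [← hel]; exact heseg⟩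
    have hll : l = l0 := le_antisymm hle (hlmin l hlΛ)
    have hez : e = z := by rw [hel, hll]
    rw [hez] at heseg
    exact hnotsame (plane_same huv huvp hseg heseg hzu hzv).symm
  rcases hcase with ⟨c1, c2⟩ | ⟨c1, c2⟩
  · exact caseA c1 c2
  · rcases c2.eq_or_lt with c2 | c2
    · exact caseA c2.symm c1.symm.le
    · have c1' : cr u v e = 0 := (mul_eq_zero.1 c1).resolve_left hεne
      have hcp : cr u v p ≠ 0 := by intro h; rw [h] at hf3p; simp at hf3p
      have hel := frame_on_line hcp c1'
      set m := cr u e p / cr u v p with hm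
      obtain ⟨-, k2⟩ := sector e c2 e2
      have hm1 : m < 1 := by
        have e4 : ε * cr p e v = (1 - m) * (ε * cr u v p) := by
          rw [hel, cr_lpt2, cr_self3, cr_rot p u v]; ring
        rw [e4] at k2
        by_contra hc
        push Not at hc
        nlinarith
      have hm0 : 0 < m := by
        have e5 : ε * cr p x e = (1 - m) * (ε * cr p x u) + m * (ε * cr p x v) := by
          rw [hel, cr_lpt]; ring
        rw [e5] at c2
        by_contra hc
        push Not at hc
        nlinarith
      have hes : e ∈ segment ℝ u v := by rw [hel]; exact lpt_mem_seg _ _ hm0.le hm1.le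
      refine hnotsame (plane_same huv huvp hes heseg ?_ ?_).symm
      · intro h
        rw [hel] at h
        exact hm0.ne' (lpt_eq_left (padj_ne huv) h)
      · intro h
        rw [hel] at h
        exact hm1.ne (lpt_eq_right (padj_ne huv) h)

end wedge

/-- `A B C` is the (counterclockwise) hull triangle of `S`. -/
structure Hull (S : Finset Pt) (A B C : Pt) : Prop where
  hA : A ∈ S
  hB : B ∈ S
  hC : C ∈ S
  pos : 0 < cr A B C
  ab : ∀ s ∈ S, s ≠ A → s ≠ B → 0 < cr A B s
  bc : ∀ s ∈ S, s ≠ B → s ≠ C → 0 < cr B C s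
  ca : ∀ s ∈ S, s ≠ C → s ≠ A → 0 < cr C A s
  fr : ∀ p ∈ S, p ∈ frontier (convexHull ℝ (S : Set Pt)) ↔ (p = A ∨ p = B ∨ p = C)

lemma Hull.rot {S : Finset Pt} {A B C : Pt} (h : Hull S A B C) : Hull S B C A :=
  ⟨h.hB, h.hC, h.hA, by rw [cr_rot]; exact h.pos, h.bc, h.ca, h.ab, by
    intro p hp; rw [h.fr p hp]; tauto⟩

lemma convex_cr (A B : Pt) : Convex ℝ {z : Pt | 0 ≤ cr A B z} := by
  intro x hx y hy a b ha hb hab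
  simp only [Set.mem_ofPred_eq] at *
  have : cr A B (a • x + b • y) = a * cr A B x + b * cr A B y := by
    have hb' : b = 1 - a := by linarith
    subst hb'
    simp only [cr, Prod.fst_add, Prod.snd_add, Prod.smul_fst, Prod.smul_snd, smul_eq_mul]; ring
  rw [this]; positivity

lemma exists_hull {S : Finset Pt} (hS : GenPos S) (hh : hullVtxCount S = 3) :
    ∃ A B C, Hull S A B C := by
  obtain ⟨A, B, C, hAB, hAC, hBC, hH⟩ := Finset.card_eq_three.1 hh
  have hfr : ∀ p ∈ S, p ∈ frontier (convexHull ℝ (S : Set Pt)) ↔ (p = A ∨ p = B ∨ p = C) := by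
    intro p hp
    have : p ∈ S.filter (fun p => p ∈ frontier (convexHull ℝ (S : Set Pt))) ↔ p ∈ ({A, B, C} : Finset Pt) := by
      rw [hH]
    simpa [hp] using this
  have hin : ∀ p ∈ ({A, B, C} : Finset Pt), p ∈ S := by
    rw [← hH]; intro p hp; exact (Finset.mem_filter.1 hp).1
  have hA : A ∈ S := hin A (by simp)
  have hB : B ∈ S := hin B (by simp)
  have hC : C ∈ S := hin C (by simp)
  have hcomp : IsCompact (convexHull ℝ (S : Set Pt)) := S.finite_toSet.isCompact_convexHull ℝ
  have hext : (convexHull ℝ (S : Set Pt)).extremePoints ℝ ⊆ {A, B, C} := by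
    intro x hx
    have hxS : x ∈ S := extremePoints_convexHull_subset hx
    have : x ∈ frontier (convexHull ℝ (S : Set Pt)) := by
      rw [hcomp.isClosed.frontier_eq]
      exact ⟨hx.1, fun h => Set.disjoint_left.1 (disjoint_interior_extremePoints _) h hx⟩
    simpa using (hfr x hxS).1 this
  have hsub : convexHull ℝ (S : Set Pt) ⊆ convexHull ℝ ({A, B, C} : Set Pt) := by
    rw [← closure_convexHull_extremePoints hcomp (convex_convexHull ℝ _)]
    have hc : IsClosed (convexHull ℝ ({A, B, C} : Set Pt)) :=
      ((Set.toFinite _).isCompact_convexHull ℝ).isClosed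
    exact closure_minimal (convexHull_mono hext) hc
  have hSin : ∀ s ∈ S, s ∈ convexHull ℝ ({A, B, C} : Set Pt) := fun s hs =>
    hsub (subset_convexHull ℝ _ hs)
  have main : ∀ A B C : Pt, A ∈ S → B ∈ S → A ≠ B → 0 < cr A B C →
      (∀ s ∈ S, s ∈ convexHull ℝ ({A, B, C} : Set Pt)) →
      ∀ s ∈ S, s ≠ A → s ≠ B → 0 < cr A B s := by
    intro A B C hA hB hAB hpos hS' s hs h1 h2
    have h3 : convexHull ℝ ({A, B, C} : Set Pt) ⊆ {z : Pt | 0 ≤ cr A B z} := by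
      apply convexHull_min _ (convex_cr A B)
      intro z hz
      simp only [Set.mem_insert_iff, Set.mem_singleton_iff] at hz
      rcases hz with rfl | rfl | rfl
      · simp [cr_self2]
      · simp [cr_self3]
      · exact hpos.le
    have h4 : 0 ≤ cr A B s := h3 (hS' s hs)
    exact lt_of_le_of_ne h4 (gp_ne hS hA hB hs hAB (Ne.symm h1) (Ne.symm h2)).symm
  have fin : ∀ A B C : Pt, A ∈ S → B ∈ S → C ∈ S → A ≠ B → A ≠ C → B ≠ C → 0 < cr A B C →
      (∀ s ∈ S, s ∈ convexHull ℝ ({A, B, C} : Set Pt)) →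
      (∀ p ∈ S, p ∈ frontier (convexHull ℝ (S : Set Pt)) ↔ (p = A ∨ p = B ∨ p = C)) →
      Hull S A B C := by
    intro A B C hA hB hC hAB hAC hBC hpos hS' hfr
    refine ⟨hA, hB, hC, hpos, main A B C hA hB hAB hpos hS',
      main B C A hB hC hBC (by rw [cr_rot]; exact hpos) ?_,
      main C A B hC hA hAC.symm (by rw [cr_rot']; exact hpos) ?_, hfr⟩
    · have : ({B, C, A} : Set Pt) = {A, B, C} := by ext; simp; tauto
      rw [this]; exact hS'
    · have : ({C, A, B} : Set Pt) = {A, B, C} := by ext; simp; tauto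
      rw [this]; exact hS'
  rcases lt_or_gt_of_ne (gp_ne hS hA hB hC hAB hAC hBC) with h | h
  · refine ⟨A, C, B, fin A C B hA hC hB hAC hAB hBC.symm (by rw [cr_swap]; linarith) ?_ ?_⟩
    · have : ({A, C, B} : Set Pt) = {A, B, C} := by ext; simp; tauto
      rw [this]; exact hSin
    · intro p hp; rw [hfr p hp]; tauto
  · exact ⟨A, B, C, fin A B C hA hB hC hAB hAC hBC h hSin hfr⟩

section hull
variable {S : Finset Pt} {T : PlaneGraph S} {A B C : Pt}

lemma Hull.neAB (h : Hull S A B C) : A ≠ B := by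
  rintro rfl; have := h.pos; rw [cr_self1] at this; exact lt_irrefl _ this

lemma Hull.edgeAB (hS : GenPos S) (hT : IsTriangulation T) (h : Hull S A B C) : padj T A B := by
  by_contra hn
  obtain ⟨u, v, a, b, huv, -, -, -, -, -, h1, h2⟩ := max_cross hS hT h.hA h.hB h.neAB hn
  have hv := padj_right huv
  by_cases h3 : v = A
  · subst h3; rw [cr_self2] at h2; exact lt_irrefl _ h2
  by_cases h4 : v = B
  · subst h4; rw [cr_self3] at h2; exact lt_irrefl _ h2
  have := h.ab v hv h3 h4
  linarith

/-- Interior vertices see a hull vertex in each open half plane. -/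
lemma Hull.half (h : Hull S A B C) {p : Pt} (hp : p ∈ S) (hpA : p ≠ A) (hpB : p ≠ B) (hpC : p ≠ C)
    {α β : ℝ} (hαβ : α ≠ 0 ∨ β ≠ 0) : ∃ s ∈ S, 0 < α * (s.1 - p.1) + β * (s.2 - p.2) := by
  by_contra hcon
  push Not at hcon
  have h1 := h.ab p hp hpA hpB
  have h2 := h.bc p hp hpB hpC
  have h3 := h.ca p hp hpC hpA
  have e : cr B C p * (α * (A.1 - p.1) + β * (A.2 - p.2)) + cr C A p * (α * (B.1 - p.1) + β * (B.2 - p.2))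
     + cr A B p * (α * (C.1 - p.1) + β * (C.2 - p.2)) = 0 := by simp only [cr]; ring
  have fA := mul_nonneg h2.le (neg_nonneg.2 (hcon A h.hA))
  have fB := mul_nonneg h3.le (neg_nonneg.2 (hcon B h.hB))
  have fC := mul_nonneg h1.le (neg_nonneg.2 (hcon C h.hC))
  have gA : α * (A.1 - p.1) + β * (A.2 - p.2) = 0 := by
    have : cr B C p * (α * (A.1 - p.1) + β * (A.2 - p.2)) = 0 := by linarith
    exact (mul_eq_zero.1 this).resolve_left h2.ne'
  have gB : α * (B.1 - p.1) + β * (B.2 - p.2) = 0 := by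
    have : cr C A p * (α * (B.1 - p.1) + β * (B.2 - p.2)) = 0 := by linarith
    exact (mul_eq_zero.1 this).resolve_left h3.ne'
  have k1 : α * cr A B p = 0 := by
    have : α * cr A B p = (α * (A.1 - p.1) + β * (A.2 - p.2)) * (B.2 - p.2) - (α * (B.1 - p.1) + β * (B.2 - p.2)) * (A.2 - p.2) := by
      simp only [cr]; ring
    rw [this, gA, gB]; ring
  have k2 : β * cr A B p = 0 := by
    have : β * cr A B p = (A.1 - p.1) * (α * (B.1 - p.1) + β * (B.2 - p.2)) - (B.1 - p.1) * (α * (A.1 - p.1) + β * (A.2 - p.2)) := by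
      simp only [cr]; ring
    rw [this, gA, gB]; ring
  rcases hαβ with ha | ha
  · exact ha ((mul_eq_zero.1 k1).resolve_right h1.ne')
  · exact ha ((mul_eq_zero.1 k2).resolve_right h1.ne')

/-- `gap` phrased with orientations. -/
lemma gap_cr (hS : GenPos S) (hT : IsTriangulation T) {p d x : Pt} (hp : p ∈ S) (hx : x ∈ S)
    (hφ : 0 < cr p d x) : ∃ s, padj T p s ∧ 0 < cr p d s := by
  obtain ⟨s, hs, h⟩ := gap hS hT hp hx (-(d.2 - p.2)) (d.1 - p.1) (by simp only [cr] at hφ; linarith)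
  exact ⟨s, hs, by simp only [cr]; linarith⟩

/-- Being an interior vertex relative to the hull triangle. -/
def Inn (S : Finset Pt) (A B C p : Pt) : Prop := p ∈ S ∧ p ≠ A ∧ p ≠ B ∧ p ≠ C

lemma Hull.half_cr (h : Hull S A B C) {p d : Pt} (hp : Inn S A B C p) (hd : p ≠ d) :
    ∃ s ∈ S, 0 < cr p d s := by
  obtain ⟨s, hs, h⟩ := h.half hp.1 hp.2.1 hp.2.2.1 hp.2.2.2 (α := -(d.2 - p.2)) (β := d.1 - p.1) (by
    by_contra hc
    push Not at hc
    apply hd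
    apply Prod.ext <;> linarith [hc.1, hc.2])
  exact ⟨s, hs, by simp only [cr]; linarith⟩

lemma Hull.gap_cr (h : Hull S A B C) (hS : GenPos S) (hT : IsTriangulation T)
    {p d : Pt} (hp : Inn S A B C p) (hd : p ≠ d) : ∃ s, padj T p s ∧ 0 < cr p d s := by
  obtain ⟨x, hx, hx'⟩ := h.half_cr hp hd
  exact _root_.gap_cr hS hT hp.1 hx hx'

end hull

section faces
variable {S : Finset Pt} {T : PlaneGraph S}

/-- Counterclockwise empty triangle with sides in `T`. -/
structure Face (T : PlaneGraph S) (p q r : Pt) : Prop where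
  pq : padj T p q
  qr : padj T q r
  rp : padj T r p
  pos : 0 < cr p q r
  empty : ∀ s ∈ S, ¬ (0 < cr p q s ∧ 0 < cr q r s ∧ 0 < cr r p s)

lemma Face.rot {p q r : Pt} (h : Face T p q r) : Face T q r p :=
  ⟨h.qr, h.rp, h.pq, by rw [cr_rot]; exact h.pos, fun s hs ⟨a, b, c⟩ => h.empty s hs ⟨c, a, b⟩⟩

lemma cr_sum (p q r s : Pt) : cr p q s + cr q r s + cr r p s = cr p q r := by simp only [cr]; ring

/-- Angularly minimal neighbour in the half plane. -/
lemma face_of_left (hS : GenPos S) (hT : IsTriangulation T) {p q x : Pt} (hpq : padj T p q)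
    (hx : padj T p x) (hx' : 0 < cr p q x) :
    ∃ r, Face T p q r ∧ ∀ s, padj T p s → 0 < cr p q s → 0 ≤ cr p r s := by
  -- minimise the cotangent
  let Y := S.filter (fun s => padj T p s ∧ 0 < cr p q s)
  have hY : Y.Nonempty := ⟨x, by simp [Y, padj_right hx, hx, hx']⟩
  let g : Pt → ℝ := fun s => - ((q.1 - p.1) * (s.1 - p.1) + (q.2 - p.2) * (s.2 - p.2)) / cr p q s
  obtain ⟨r, hrY, hrmin⟩ := Y.exists_min_image g hY
  simp only [Y, Finset.mem_filter] at hrY hrmin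
  obtain ⟨hrS, hpr, hr0⟩ := hrY
  have hmin : ∀ s, padj T p s → 0 < cr p q s → 0 ≤ cr p r s := by
    intro s hs hs0
    have := hrmin s ⟨padj_right hs, hs, hs0⟩
    simp only [g] at this
    rw [div_le_div_iff₀ hr0 hs0] at this
    have e : (-((q.1 - p.1) * (s.1 - p.1) + (q.2 - p.2) * (s.2 - p.2))) * cr p q r -
      (-((q.1 - p.1) * (r.1 - p.1) + (q.2 - p.2) * (r.2 - p.2))) * cr p q s =
      ((q.1 - p.1)^2 + (q.2 - p.2)^2) * cr p r s := by simp only [cr]; ring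
    have hpos : 0 < (q.1 - p.1)^2 + (q.2 - p.2)^2 := by
      by_contra hc
      have h1 : q.1 - p.1 = 0 := by nlinarith [sq_nonneg (q.1 - p.1), sq_nonneg (q.2 - p.2)]
      have h2 : q.2 - p.2 = 0 := by nlinarith [sq_nonneg (q.1 - p.1), sq_nonneg (q.2 - p.2)]
      exact padj_ne hpq (by apply Prod.ext <;> linarith)
    by_contra hc
    push Not at hc
    have := mul_neg_of_pos_of_neg hpos hc
    linarith
  have hno : ∀ s, padj T p s → ¬ (0 < cr p q s ∧ 0 < cr p s r) := by
    intro s hs ⟨h1, h2⟩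
    have := hmin s hs h1
    rw [cr_swap] at h2
    linarith
  refine ⟨r, ⟨hpq, wedge_edge hS hT hpq hpr hr0 hno, padj_symm hpr, hr0, ?_⟩, hmin⟩
  intro s hs ⟨h1, h2, h3⟩
  have h4 := cr_sum p q r s
  refine wedge_empty hS hT hpq hpr hr0 hno s hs ⟨h1, ?_, ?_⟩
  · rw [cr_rot]; exact h3
  · have : cr p s r = cr r p s := cr_rot _ _ _
    linarith

lemma exists_face (hS : GenPos S) (hT : IsTriangulation T) {p q x : Pt} (hpq : padj T p q)
    (hx : x ∈ S) (hx' : 0 < cr p q x) : ∃ r, Face T p q r := by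
  obtain ⟨y, hy, hy'⟩ := gap_cr hS hT (padj_left hpq) hx hx'
  obtain ⟨r, h, -⟩ := face_of_left hS hT hpq hy hy'
  exact ⟨r, h⟩

/-- No neighbour in the wedge of a face. -/
lemma Face.no_nbr {p q r : Pt} (hS : GenPos S) (h : Face T p q r) :
    ∀ s, padj T p s → ¬ (0 < cr p q s ∧ 0 < cr p s r) := by
  intro s hs ⟨h1, h2⟩
  have h2' : 0 < cr r p s := by rwa [cr_rot] at h2
  have h3 : ¬ 0 < cr q r s := fun h3 => h.empty s (padj_right hs) ⟨h1, h3, h2'⟩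
  have hD := h.pos
  -- the segment ps crosses qr
  have hsum := cr_sum p q r s
  push Not at h3
  set W := cr p q s + cr r p s with hW
  have hW0 : 0 < W := by positivity
  have hWD : cr p q r ≤ W := by linarith
  -- crossing point
  set a := cr p q r / W with ha
  set b := cr p q s / W with hb
  have hcross : lpt p s a = lpt q r b := by
    have hW1 : W ≠ 0 := hW0.ne'
    have e1 : (s.1 - p.1) * cr p q r = cr r p s * (q.1 - p.1) + cr p q s * (r.1 - p.1) := by
      simp only [cr]; ring
    have e2 : (s.2 - p.2) * cr p q r = cr r p s * (q.2 - p.2) + cr p q s * (r.2 - p.2) := by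
      simp only [cr]; ring
    apply Prod.ext
    · simp only [lpt, ha, hb]; field_simp; rw [hW]; linear_combination e1
    · simp only [lpt, ha, hb]; field_simp; rw [hW]; linear_combination e2
  have ha0 : 0 ≤ a := by positivity
  have ha1 : a ≤ 1 := by rw [ha, div_le_one hW0]; exact hWD
  have hb0 : 0 ≤ b := by positivity
  have hb1 : b ≤ 1 := by rw [hb, div_le_one hW0]; linarith
  have hz1 : lpt p s a ∈ segment ℝ p s := lpt_mem_seg _ _ ha0 ha1
  have hz2 : lpt p s a ∈ segment ℝ q r := by rw [hcross]; exact lpt_mem_seg _ _ hb0 hb1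
  have hqr : q ≠ r := padj_ne h.qr
  have hne : s(p, s) ≠ s(q, r) := by
    intro heq
    have : p ∈ s(q, r) := by rw [← heq]; simp
    simp only [Sym2.mem_iff] at this
    rcases this with h5 | h5
    · exact padj_ne h.pq h5
    · exact padj_ne h.rp h5.symm
  obtain ⟨-, h6⟩ := T.noncrossing _ hs _ h.qr hne (lpt p s a) ⟨hz1, hz2⟩
  rw [hcross] at h6
  simp only [Sym2.mem_iff] at h6
  rcases h6 with h6 | h6
  · have := lpt_eq_left hqr h6
    rw [hb, div_eq_zero_iff] at this
    rcases this with h7 | h7 <;> linarith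
  · have := lpt_eq_right hqr h6
    rw [hb, div_eq_one_iff_eq hW0.ne'] at this
    linarith

lemma Face.clear {p q r : Pt} (hS : GenPos S) (h : Face T p q r) {u v z : Pt} (huv : padj T u v)
    (hz : z ∈ segment ℝ u v) : ¬ (0 < cr p q z ∧ 0 < cr q r z ∧ 0 < cr r p z) := by
  intro ⟨h1, h2, h3⟩
  have hsum := cr_sum p q r z
  have e : cr p z r = cr r p z := cr_rot _ _ _
  refine wedge_clear h.pq (padj_symm h.rp) h.pos (h.no_nbr hS) le_rfl ?_ huv hz h1 (by linarith) (by linarith)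
  intro s hs ⟨k1, k2, k3⟩
  have hsum := cr_sum p q r s
  have e : cr p s r = cr r p s := cr_rot _ _ _
  exact h.empty s hs ⟨k1, by linarith, by linarith⟩

lemma Face.unique {p q r r' : Pt} (hS : GenPos S) (h : Face T p q r) (h' : Face T p q r') : r = r' := by
  by_contra hne
  have h1 := h.no_nbr hS r' (padj_symm h'.rp)
  have h2 := h'.no_nbr hS r (padj_symm h.rp)
  have h3 := gp_ne hS (padj_left h.pq) (padj_left h.rp) (padj_left h'.rp) (padj_ne h.rp).symm
    (padj_ne h'.rp).symm hne
  rcases lt_or_gt_of_ne h3 with h4 | h4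
  · exact h1 ⟨h'.pos, by rw [cr_swap]; linarith⟩
  · exact h2 ⟨h.pos, h4⟩
end faces

/-- A linear functional on the plane. -/
def ell (α β : ℝ) (p : Pt) : ℝ := α * p.1 + β * p.2

lemma ell_neg (α β : ℝ) (p : Pt) : ell (-α) (-β) p = - ell α β p := by simp only [ell]; ring

lemma exists_ell (S : Finset Pt) : ∃ c : ℝ, ∀ p ∈ S, ∀ q ∈ S, ell 1 c p = ell 1 c q → p = q := by
  obtain ⟨c, hc⟩ := Infinite.exists_notMem_finset
    ((S ×ˢ S).image (fun z : Pt × Pt => -(z.1.1 - z.2.1) / (z.1.2 - z.2.2)))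
  refine ⟨c, fun p hp q hq h => ?_⟩
  simp only [ell] at h
  by_cases h2 : p.2 = q.2
  · apply Prod.ext
    · rw [h2] at h; linarith
    · exact h2
  · exfalso
    apply hc
    refine Finset.mem_image.2 ⟨(p, q), by simp [hp, hq], ?_⟩
    have : p.2 - q.2 ≠ 0 := sub_ne_zero.2 h2
    field_simp
    linarith

/-- Three-term relation with a functional. -/
lemma ell3 (α β : ℝ) (r a b c : Pt) :
    (ell α β a - ell α β r) * cr r b c - (ell α β b - ell α β r) * cr r a c
      + (ell α β c - ell α β r) * cr r a b = 0 := by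
  simp only [ell, cr]; ring

section asc
variable {S : Finset Pt} {T : PlaneGraph S}

/-- The face below `r` with respect to the functional. -/
def Asc (T : PlaneGraph S) (α β : ℝ) (r p q : Pt) : Prop :=
  Face T r p q ∧ ell α β p < ell α β r ∧ ell α β r < ell α β q

lemma Asc.unique (hS : GenPos S) {α β : ℝ} {r p q p' q' : Pt} (h : Asc T α β r p q)
    (h' : Asc T α β r p' q') : p = p' ∧ q = q' := by
  have key : ∀ p q p' q' : Pt, Asc T α β r p q → Asc T α β r p' q' → ¬ 0 < cr r p p' := by
    intro p q p' q' h h' hc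
    refine h.1.no_nbr hS p' h'.1.pq ⟨hc, ?_⟩
    have e := ell3 α β r p p' q
    have h1 := h.1.pos
    obtain ⟨-, h2, h3⟩ := h
    obtain ⟨-, h2', h3'⟩ := h'
    by_contra hn
    push Not at hn
    have a1 : 0 ≤ (ell α β p - ell α β r) * cr r p' q := mul_nonneg_of_nonpos_of_nonpos (by linarith) hn
    have a2 : (ell α β p' - ell α β r) * cr r p q < 0 := mul_neg_of_neg_of_pos (by linarith) h1
    have a3 : 0 < (ell α β q - ell α β r) * cr r p p' := mul_pos (by linarith) hc
    linarith
  have hpp : p = p' := by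
    by_contra hne
    rcases lt_or_gt_of_ne (gp_ne hS (padj_left h.1.pq) (padj_right h.1.pq) (padj_right h'.1.pq)
      (padj_ne h.1.pq) (padj_ne h'.1.pq) hne) with h4 | h4
    · exact key p' q' p q h' h (by rw [cr_swap]; linarith)
    · exact key p q p' q' h h' h4
  subst hpp
  exact ⟨rfl, h.1.unique hS h'.1⟩

/-- The extreme neighbour in a half-plane. -/
lemma ext_nbr (hS : GenPos S) (hT : IsTriangulation T) {α β : ℝ} {r s : Pt} (hr : r ∈ S) (hs : s ∈ S)
    (hl : ell α β r < ell α β s) :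
    ∃ q, padj T r q ∧ ell α β r < ell α β q ∧ ∀ x, padj T r x → ell α β r < ell α β x → 0 ≤ cr r q x := by
  obtain ⟨x, hx, hx'⟩ := gap hS hT hr hs α β (by simp only [ell] at hl; linarith)
  let Y := S.filter (fun s => padj T r s ∧ ell α β r < ell α β s)
  have hY : Y.Nonempty := ⟨x, by
    simp only [Y, Finset.mem_filter]; exact ⟨padj_right hx, hx, by simp only [ell]; linarith⟩⟩
  let g : Pt → ℝ := fun s => (-β * (s.1 - r.1) + α * (s.2 - r.2)) / (ell α β s - ell α β r)
  obtain ⟨q, hqY, hqmin⟩ := Y.exists_min_image g hY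
  simp only [Y, Finset.mem_filter] at hqY hqmin
  obtain ⟨hqS, hrq, hq0⟩ := hqY
  refine ⟨q, hrq, hq0, ?_⟩
  intro s hs hs0
  have := hqmin s ⟨padj_right hs, hs, hs0⟩
  simp only [g] at this
  rw [div_le_div_iff₀ (by linarith) (by linarith)] at this
  have e : (-β * (s.1 - r.1) + α * (s.2 - r.2)) * (ell α β q - ell α β r) -
      (-β * (q.1 - r.1) + α * (q.2 - r.2)) * (ell α β s - ell α β r) =
      (α^2 + β^2) * cr r q s := by simp only [cr, ell]; ring
  have hpos : 0 < α^2 + β^2 := by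
    by_contra hc
    have h1 : α = 0 := by nlinarith [sq_nonneg α, sq_nonneg β]
    have h2 : β = 0 := by nlinarith [sq_nonneg α, sq_nonneg β]
    subst h1 h2
    simp [ell] at hl
  by_contra hc
  push Not at hc
  have := mul_neg_of_pos_of_neg hpos hc
  linarith

/-- The mirrored version. -/
lemma ext_nbr' (hS : GenPos S) (hT : IsTriangulation T) {α β : ℝ} {r s : Pt} (hr : r ∈ S) (hs : s ∈ S)
    (hl : ell α β r < ell α β s) :
    ∃ q, padj T r q ∧ ell α β r < ell α β q ∧ ∀ x, padj T r x → ell α β r < ell α β x → 0 ≤ cr r x q := by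
  obtain ⟨x, hx, hx'⟩ := gap hS hT hr hs α β (by simp only [ell] at hl; linarith)
  let Y := S.filter (fun s => padj T r s ∧ ell α β r < ell α β s)
  have hY : Y.Nonempty := ⟨x, by
    simp only [Y, Finset.mem_filter]; exact ⟨padj_right hx, hx, by simp only [ell]; linarith⟩⟩
  let g : Pt → ℝ := fun s => (-β * (s.1 - r.1) + α * (s.2 - r.2)) / (ell α β s - ell α β r)
  obtain ⟨q, hqY, hqmin⟩ := Y.exists_max_image g hY
  simp only [Y, Finset.mem_filter] at hqY hqmin
  obtain ⟨hqS, hrq, hq0⟩ := hqY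
  refine ⟨q, hrq, hq0, ?_⟩
  intro s hs hs0
  have := hqmin s ⟨padj_right hs, hs, hs0⟩
  simp only [g] at this
  rw [div_le_div_iff₀ (by linarith) (by linarith)] at this
  have e : (-β * (q.1 - r.1) + α * (q.2 - r.2)) * (ell α β s - ell α β r) -
      (-β * (s.1 - r.1) + α * (s.2 - r.2)) * (ell α β q - ell α β r) =
      (α^2 + β^2) * cr r s q := by simp only [cr, ell]; ring
  have hpos : 0 < α^2 + β^2 := by
    by_contra hc
    have h1 : α = 0 := by nlinarith [sq_nonneg α, sq_nonneg β]
    have h2 : β = 0 := by nlinarith [sq_nonneg α, sq_nonneg β]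
    subst h1 h2
    simp [ell] at hl
  by_contra hc
  push Not at hc
  have := mul_neg_of_pos_of_neg hpos hc
  linarith

lemma Asc.exists (hS : GenPos S) (hT : IsTriangulation T) {α β : ℝ}
    (hinj : ∀ p ∈ S, ∀ q ∈ S, ell α β p = ell α β q → p = q) {r s s' : Pt} (hr : r ∈ S)
    (hs : s ∈ S) (hs' : s' ∈ S) (h1 : ell α β s < ell α β r) (h2 : ell α β r < ell α β s')
    (h3 : 0 < cr r s s') : ∃ p q, Asc T α β r p q := by
  obtain ⟨q, hrq, hq0, hqmin⟩ := ext_nbr hS hT hr hs' h2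
  obtain ⟨p, hrp, hp0, hpmin⟩ := ext_nbr' hS hT (α := -α) (β := -β) hr hs
    (by rw [ell_neg, ell_neg]; linarith)
  simp only [ell_neg, neg_lt_neg_iff] at hp0 hpmin
  have hpq : p ≠ q := by rintro rfl; linarith
  have side : ∀ x, padj T r x → ell α β x < ell α β r ∨ ell α β r < ell α β x := by
    intro x hx
    rcases lt_trichotomy (ell α β x) (ell α β r) with h | h | h
    · exact Or.inl h
    · exact absurd (hinj x (padj_right hx) r hr h).symm (padj_ne hx)
    · exact Or.inr h
  rcases lt_or_gt_of_ne (gp_ne hS hr (padj_right hrp) (padj_right hrq)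
      (padj_ne hrp) (padj_ne hrq) hpq) with h4 | h4
  · exfalso
    have hle : ∀ x, padj T r x → cr r p x ≤ 0 := by
      intro x hx
      rcases side x hx with hx' | hx'
      · have := hpmin x hx hx'
        rw [cr_swap]; linarith
      · have k1 := hqmin x hx hx'
        have e := ell3 α β r p q x
        by_contra hc
        push Not at hc
        have a1 : (ell α β p - ell α β r) * cr r q x ≤ 0 := mul_nonpos_of_nonpos_of_nonneg (by linarith) k1
        have a2 : 0 < (ell α β q - ell α β r) * cr r p x := mul_pos (by linarith) hc
        have a3 : (ell α β x - ell α β r) * cr r p q < 0 := mul_neg_of_pos_of_neg (by linarith) h4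
        linarith
    have hle' : ∀ x ∈ S, cr r p x ≤ 0 := by
      intro x hx
      by_contra hc
      push Not at hc
      obtain ⟨y, hy, hy'⟩ := gap_cr hS hT hr hx hc
      have := hle y hy
      linarith
    have e := ell3 α β r p s s'
    have a1 : (ell α β p - ell α β r) * cr r s s' < 0 := mul_neg_of_neg_of_pos (by linarith) h3
    have a2 : 0 ≤ (ell α β s - ell α β r) * cr r p s' := mul_nonneg_of_nonpos_of_nonpos (by linarith) (hle' s' hs')
    have a3 : (ell α β s' - ell α β r) * cr r p s ≤ 0 := mul_nonpos_of_nonneg_of_nonpos (by linarith) (hle' s hs)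
    linarith
  · have hno : ∀ x, padj T r x → ¬ (0 < cr r p x ∧ 0 < cr r x q) := by
      intro x hx ⟨k1, k2⟩
      rcases side x hx with hx' | hx'
      · have := hpmin x hx hx'
        rw [cr_swap] at this; linarith
      · have := hqmin x hx hx'
        rw [cr_swap] at this; linarith
    refine ⟨p, q, ⟨hrp, wedge_edge hS hT hrp hrq h4 hno, padj_symm hrq, h4, ?_⟩, hp0, hq0⟩
    intro s hs ⟨k1, k2, k3⟩
    have k4 := cr_sum r p q s
    refine wedge_empty hS hT hrp hrq h4 hno s hs ⟨k1, ?_, ?_⟩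
    · rw [cr_rot]; exact k3
    · have : cr r s q = cr q r s := cr_rot _ _ _
      linarith

variable {A B C : Pt}

lemma asc_interior (hS : GenPos S) (hT : IsTriangulation T) {α β : ℝ} (hH : Hull S A B C)
    (hinj : ∀ p ∈ S, ∀ q ∈ S, ell α β p = ell α β q → p = q) {r : Pt} (hr : Inn S A B C r) :
    ∃ p q, Asc T α β r p q := by
  obtain ⟨hrS, hrA, hrB, hrC⟩ := hr
  have h1 : 0 < cr r A B := by rw [cr_rot']; exact hH.ab r hrS hrA hrB
  have h2 : 0 < cr r B C := by rw [cr_rot']; exact hH.bc r hrS hrB hrC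
  have h3 : 0 < cr r C A := by rw [cr_rot']; exact hH.ca r hrS hrC hrA
  have e := ell3 α β r A B C
  have h3' : cr r A C = - cr r C A := cr_swap _ _ _
  rw [h3'] at e
  have side : ∀ x ∈ S, r ≠ x → ell α β x < ell α β r ∨ ell α β r < ell α β x := by
    intro x hx hne
    rcases lt_trichotomy (ell α β x) (ell α β r) with h | h | h
    · exact Or.inl h
    · exact absurd (hinj x hx r hrS h).symm hne
    · exact Or.inr h
  have ex := fun s s' hs hs' => Asc.exists hS hT hinj (r := r) (s := s) (s' := s') hrS hs hs'
  rcases side A hH.hA hrA with a | a <;> rcases side B hH.hB hrB with b | b <;>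
    rcases side C hH.hC hrC with c | c
  · exfalso
    have a1 := mul_neg_of_neg_of_pos (sub_neg.2 a) h2
    have a2 := mul_neg_of_neg_of_pos (sub_neg.2 b) h3
    have a3 := mul_neg_of_neg_of_pos (sub_neg.2 c) h1
    linarith
  · exact ex B C hH.hB hH.hC b c h2
  · exact ex A B hH.hA hH.hB a b h1
  · exact ex A B hH.hA hH.hB a b h1
  · exact ex C A hH.hC hH.hA c a h3
  · exact ex B C hH.hB hH.hC b c h2
  · exact ex C A hH.hC hH.hA c a h3
  · exfalso
    have a1 := mul_pos (sub_pos.2 a) h2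
    have a2 := mul_pos (sub_pos.2 b) h3
    have a3 := mul_pos (sub_pos.2 c) h1
    linarith

lemma asc_hull (hS : GenPos S) (hT : IsTriangulation T) {α β : ℝ} (hH : Hull S A B C)
    (hinj : ∀ p ∈ S, ∀ q ∈ S, ell α β p = ell α β q → p = q) :
    (∃ p q, Asc T α β A p q) ↔ (ell α β B < ell α β A ∧ ell α β A < ell α β C) := by
  constructor
  · rintro ⟨s, s', hf, h1, h2⟩
    have hs : s ∈ S := padj_right hf.pq
    have hs' : s' ∈ S := padj_right hf.qr
    have hsA : A ≠ s := padj_ne hf.pq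
    have hsA' : s' ≠ A := padj_ne hf.rp
    have hpos := hf.pos
    have ge1 : ∀ x ∈ S, x ≠ A → 0 ≤ cr A B x := by
      intro x hx hxA
      by_cases hxB : x = B
      · rw [hxB, cr_self3]
      · exact (hH.ab x hx hxA hxB).le
    have ge2 : ∀ x ∈ S, x ≠ A → 0 ≤ cr A x C := by
      intro x hx hxA
      by_cases hxC : x = C
      · rw [hxC, cr_self3]
      · rw [cr_rot]; exact (hH.ca x hx hxC hxA).le
    constructor
    · by_contra hc
      push Not at hc
      have e := ell3 α β A B s s'
      have hc' : ell α β A < ell α β B := lt_of_le_of_ne hc (fun h => hH.neAB (hinj _ hH.hA _ hH.hB h))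
      have a1 := mul_pos (sub_pos.2 hc') hpos
      have a2 := mul_nonpos_of_nonpos_of_nonneg (sub_neg.2 h1).le (ge1 s' hs' hsA')
      have a3 := mul_nonneg (sub_pos.2 h2).le (ge1 s hs hsA.symm)
      linarith
    · by_contra hc
      push Not at hc
      have e := ell3 α β A s s' C
      have hc' : ell α β C < ell α β A := lt_of_le_of_ne hc (fun h => hH.rot.rot.neAB (hinj _ hH.hC _ hH.hA h))
      have a1 := mul_neg_of_neg_of_pos (sub_neg.2 hc') hpos
      have a2 := mul_nonpos_of_nonpos_of_nonneg (sub_neg.2 h1).le (ge2 s' hs' hsA')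
      have a3 := mul_nonneg (sub_pos.2 h2).le (ge2 s hs hsA.symm)
      linarith
  · rintro ⟨h1, h2⟩
    exact Asc.exists hS hT hinj hH.hA hH.hB hH.hC h1 h2 hH.pos

end asc

section euler
variable {S : Finset Pt} {T : PlaneGraph S} {A B C : Pt}

lemma Hull.card_inn (hH : Hull S A B C) : (S.filter (fun p => p ≠ A ∧ p ≠ B ∧ p ≠ C)).card + 3 = S.card := by
  have h1 : ({A, B, C} : Finset Pt).card = 3 :=
    Finset.card_eq_three.2 ⟨A, B, C, hH.neAB, hH.rot.rot.neAB.symm, hH.rot.neAB, rfl⟩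
  have h2 : S.filter (fun p => p ≠ A ∧ p ≠ B ∧ p ≠ C) = S \ {A, B, C} := by
    ext p; simp [Finset.mem_sdiff]
  have h3 : ({A, B, C} : Finset Pt) ⊆ S := by
    intro p hp
    simp only [Finset.mem_insert, Finset.mem_singleton] at hp
    rcases hp with rfl | rfl | rfl
    exacts [hH.hA, hH.hB, hH.hC]
  have h4 := Finset.card_sdiff_add_card_eq_card h3
  rw [h2]; omega

lemma Hull.sum_split (hH : Hull S A B C) (f : Pt → ℕ) :
    ∑ p ∈ S, f p = ∑ p ∈ S.filter (fun p => p ≠ A ∧ p ≠ B ∧ p ≠ C), f p + (f A + f B + f C) := by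
  have h2 : S.filter (fun p => p ≠ A ∧ p ≠ B ∧ p ≠ C) = S \ {A, B, C} := by
    ext p; simp [Finset.mem_sdiff]
  have h3 : ({A, B, C} : Finset Pt) ⊆ S := by
    intro p hp
    simp only [Finset.mem_insert, Finset.mem_singleton] at hp
    rcases hp with rfl | rfl | rfl
    exacts [hH.hA, hH.hB, hH.hC]
  rw [h2, ← Finset.sum_sdiff h3]
  congr 1
  rw [Finset.sum_insert, Finset.sum_insert, Finset.sum_singleton]
  · ring
  · simp [hH.rot.neAB]
  · simp [hH.neAB, hH.rot.rot.neAB.symm]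

/-- Number of vertices with a face below. -/
def ascN (T : PlaneGraph S) (α β : ℝ) : ℕ := (S.filter (fun r => ∃ p q, Asc T α β r p q)).card

lemma asc_count (hS : GenPos S) (hT : IsTriangulation T) {α β : ℝ} (hH : Hull S A B C)
    (hinj : ∀ p ∈ S, ∀ q ∈ S, ell α β p = ell α β q → p = q) :
    ascN T α β + ascN T (-α) (-β) + 5 = 2 * S.card := by
  have hinj' : ∀ p ∈ S, ∀ q ∈ S, ell (-α) (-β) p = ell (-α) (-β) q → p = q := by
    intro p hp q hq h
    rw [ell_neg, ell_neg] at h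
    exact hinj p hp q hq (by linarith)
  unfold ascN
  rw [Finset.card_filter, Finset.card_filter, ← Finset.sum_add_distrib, hH.sum_split]
  have hI : ∑ p ∈ S.filter (fun p => p ≠ A ∧ p ≠ B ∧ p ≠ C),
      ((if ∃ p_1 q, Asc T α β p p_1 q then 1 else 0) + if ∃ p_1 q, Asc T (-α) (-β) p p_1 q then 1 else 0)
      = ∑ p ∈ S.filter (fun p => p ≠ A ∧ p ≠ B ∧ p ≠ C), 2 := by
    apply Finset.sum_congr rfl
    intro p hp
    rw [Finset.mem_filter] at hp
    rw [if_pos (asc_interior hS hT hH hinj hp), if_pos (asc_interior hS hT hH hinj' hp)]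
  rw [hI, Finset.sum_const, smul_eq_mul]
  have hc := hH.card_inn
  have hAB : ell α β A ≠ ell α β B := fun h => hH.neAB (hinj _ hH.hA _ hH.hB h)
  have hBC : ell α β B ≠ ell α β C := fun h => hH.rot.neAB (hinj _ hH.hB _ hH.hC h)
  have hCA : ell α β C ≠ ell α β A := fun h => hH.rot.rot.neAB (hinj _ hH.hC _ hH.hA h)
  simp only [asc_hull hS hT hH hinj, asc_hull hS hT hH hinj', asc_hull hS hT hH.rot hinj, asc_hull hS hT hH.rot hinj',
    asc_hull hS hT hH.rot.rot hinj, asc_hull hS hT hH.rot.rot hinj', ell_neg, neg_lt_neg_iff]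
  suffices h : ∀ a b c : ℝ, a ≠ b → b ≠ c → c ≠ a → 
      (((if b < a ∧ a < c then 1 else 0) + if a < b ∧ c < a then 1 else 0) +
      ((if c < b ∧ b < a then 1 else 0) + if b < c ∧ a < b then 1 else 0) +
      ((if a < c ∧ c < b then 1 else 0) + if c < a ∧ b < c then 1 else 0)) = 1 by
    rw [h _ _ _ hAB hBC hCA]; omega
  intro a b c h1 h2 h3
  rcases lt_or_gt_of_ne h1 with h1 | h1 <;> rcases lt_or_gt_of_ne h2 with h2 | h2 <;>
    rcases lt_or_gt_of_ne h3 with h3 | h3 <;> 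
    simp only [h1, h2, h3, h1.not_gt, h2.not_gt, h3.not_gt, and_true, and_false, if_true, if_false]
    <;> first | omega | (exfalso; linarith)

/-- All faces, as ordered triples. -/
def faces (T : PlaneGraph S) : Finset (Pt × Pt × Pt) :=
  (S ×ˢ S ×ˢ S).filter (fun f => Face T f.1 f.2.1 f.2.2)

lemma mem_faces {f : Pt × Pt × Pt} : f ∈ faces T ↔ Face T f.1 f.2.1 f.2.2 := by
  unfold faces
  simp only [Finset.mem_filter, Finset.mem_product, and_iff_right_iff_imp]
  exact fun h => ⟨padj_left h.pq, padj_left h.qr, padj_left h.rp⟩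

lemma asc_faces (hS : GenPos S) (α β : ℝ) :
    ((faces T).filter (fun f => ell α β f.2.1 < ell α β f.1 ∧ ell α β f.1 < ell α β f.2.2)).card = ascN T α β := by
  unfold ascN
  apply Finset.card_bij (fun f _ => f.1)
  · intro f hf
    rw [Finset.mem_filter, mem_faces] at hf
    rw [Finset.mem_filter]
    exact ⟨padj_left hf.1.pq, f.2.1, f.2.2, hf.1, hf.2⟩
  · intro f hf g hg h
    rw [Finset.mem_filter, mem_faces] at hf hg
    have h1 : Asc T α β f.1 f.2.1 f.2.2 := hf
    have h2 : Asc T α β f.1 g.2.1 g.2.2 := by rw [h]; exact hg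
    obtain ⟨k1, k2⟩ := h1.unique hS h2
    exact Prod.ext h (Prod.ext k1 k2)
  · intro r hr
    rw [Finset.mem_filter] at hr
    obtain ⟨-, p, q, h⟩ := hr
    exact ⟨(r, p, q), by rw [Finset.mem_filter, mem_faces]; exact h, rfl⟩

lemma sum_faces_rot (g : Pt × Pt × Pt → ℕ) :
    ∑ f ∈ faces T, g (f.2.1, f.2.2, f.1) = ∑ f ∈ faces T, g f := by
  apply Finset.sum_bij' (fun f _ => (f.2.1, f.2.2, f.1)) (fun f _ => (f.2.2, f.1, f.2.1))
  all_goals intro f hf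
  all_goals first
    | rfl
    | (rw [mem_faces] at *; exact hf.rot)
    | (rw [mem_faces] at *; exact hf.rot.rot)

lemma faces_card (hS : GenPos S) (hT : IsTriangulation T) (hH : Hull S A B C) :
    (faces T).card + 15 = 6 * S.card := by
  obtain ⟨c, hinj⟩ := exists_ell S
  have h1 := asc_count hS hT hH hinj
  rw [← asc_faces hS, ← asc_faces hS, Finset.card_filter, Finset.card_filter, ← Finset.sum_add_distrib] at h1
  simp only [ell_neg, neg_lt_neg_iff] at h1
  set g : Pt × Pt × Pt → ℕ := fun f =>
    (if ell 1 c f.2.1 < ell 1 c f.1 ∧ ell 1 c f.1 < ell 1 c f.2.2 then 1 else 0) +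
    (if ell 1 c f.1 < ell 1 c f.2.1 ∧ ell 1 c f.2.2 < ell 1 c f.1 then 1 else 0) with hg
  have h2 := sum_faces_rot (T := T) g
  have h3 := sum_faces_rot (T := T) (fun f => g (f.2.1, f.2.2, f.1))
  have h4 : ∑ f ∈ faces T, (g f + g (f.2.1, f.2.2, f.1) + g (f.2.2, f.1, f.2.1)) = ∑ f ∈ faces T, 1 := by
    apply Finset.sum_congr rfl
    intro f hf
    rw [mem_faces] at hf
    have h1 : ell 1 c f.1 ≠ ell 1 c f.2.1 := fun h => padj_ne hf.pq (hinj _ (padj_left hf.pq) _ (padj_left hf.qr) h)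
    have h2 : ell 1 c f.2.1 ≠ ell 1 c f.2.2 := fun h => padj_ne hf.qr (hinj _ (padj_left hf.qr) _ (padj_left hf.rp) h)
    have h3 : ell 1 c f.2.2 ≠ ell 1 c f.1 := fun h => padj_ne hf.rp (hinj _ (padj_left hf.rp) _ (padj_left hf.pq) h)
    simp only [hg]
    rcases lt_or_gt_of_ne h1 with h1 | h1 <;> rcases lt_or_gt_of_ne h2 with h2 | h2 <;>
      rcases lt_or_gt_of_ne h3 with h3 | h3 <;> 
      simp only [h1, h2, h3, h1.not_gt, h2.not_gt, h3.not_gt, and_true, and_false, if_true, if_false]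
      <;> first | omega | (exfalso; linarith)
  rw [Finset.sum_add_distrib, Finset.sum_add_distrib, Finset.sum_const, smul_eq_mul, mul_one] at h4
  have h5 : ∑ f ∈ faces T, g f + 5 = 2 * S.card := h1
  simp only at h3
  omega

/-- Ordered edges. -/
def darts (T : PlaneGraph S) : Finset (Pt × Pt) := (S ×ˢ S).filter (fun d => padj T d.1 d.2)

lemma mem_darts {d : Pt × Pt} : d ∈ darts T ↔ padj T d.1 d.2 := by
  unfold darts
  simp only [Finset.mem_filter, Finset.mem_product, and_iff_right_iff_imp]
  exact fun h => ⟨padj_left h, padj_right h⟩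

lemma darts_card : (darts T).card = 2 * T.edges.card := by
  rw [Finset.card_eq_sum_card_fiberwise (f := fun d : Pt × Pt => s(d.1, d.2)) (t := T.edges)]
  · rw [Finset.sum_const_nat (m := 2)]
    · ring
    · intro e he
      induction e with
      | _ a b =>
      have hab : a ≠ b := padj_ne (T := T) he
      have : (darts T).filter (fun d => s(d.1, d.2) = s(a, b)) = {(a, b), (b, a)} := by
        ext ⟨x, y⟩
        rw [Finset.mem_filter, mem_darts]
        simp only [Sym2.eq_iff, Finset.mem_insert, Finset.mem_singleton, Prod.mk.injEq]
        constructor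
        · exact fun h => h.2
        · rintro (⟨rfl, rfl⟩ | ⟨rfl, rfl⟩)
          · exact ⟨he, by tauto⟩
          · exact ⟨padj_symm he, by tauto⟩
      rw [this, Finset.card_pair]
      intro h
      exact hab (Prod.ext_iff.1 h).1
  · intro d hd
    exact mem_darts.1 hd

lemma no_left_iff (hH : Hull S A B C) {p q : Pt} (hpq : padj T p q) :
    (¬ ∃ x ∈ S, 0 < cr p q x) ↔ ((p, q) = (B, A) ∨ (p, q) = (C, B) ∨ (p, q) = (A, C)) := by
  constructor
  · intro hn
    have hp : p = A ∨ p = B ∨ p = C := by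
      by_contra hc
      push Not at hc
      exact hn (hH.half_cr ⟨padj_left hpq, hc⟩ (padj_ne hpq))
    have hq : q = A ∨ q = B ∨ q = C := by
      by_contra hc
      push Not at hc
      obtain ⟨s, hs, h⟩ := hH.half_cr (p := q) (d := lpt p q 2) ⟨padj_right hpq, hc⟩ (by
        intro h
        have := lpt_eq_right (padj_ne hpq) h.symm
        norm_num at this)
      refine hn ⟨s, hs, ?_⟩
      rw [cr_lpt2, cr_self1] at h
      rw [cr_swap' q p s]
      linarith
    have hne := padj_ne hpq
    have hpos := hH.pos
    rcases hp with rfl | rfl | rfl <;> rcases hq with rfl | rfl | rfl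
    · exact absurd rfl hne
    · exact absurd ⟨C, hH.hC, hpos⟩ hn
    · simp
    · simp
    · exact absurd rfl hne
    · exact absurd ⟨A, hH.hA, by rw [cr_rot]; exact hpos⟩ hn
    · exact absurd ⟨B, hH.hB, by rw [cr_rot']; exact hpos⟩ hn
    · simp
    · exact absurd rfl hne
  · have key : ∀ A B C : Pt, Hull S A B C → ¬ ∃ x ∈ S, 0 < cr B A x := by
      rintro A B C hH ⟨x, hx, h⟩
      by_cases h1 : x = A
      · rw [h1, cr_self3] at h; exact lt_irrefl _ h
      by_cases h2 : x = B
      · rw [h2, cr_self2] at h; exact lt_irrefl _ h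
      have := hH.ab x hx h1 h2
      rw [cr_swap'] at h
      linarith
    rintro (h | h | h) <;> obtain ⟨rfl, rfl⟩ := Prod.mk.injEq .. ▸ h
    · exact key _ _ _ hH
    · exact key _ _ _ hH.rot
    · exact key _ _ _ hH.rot.rot

lemma euler (hS : GenPos S) (hT : IsTriangulation T) (hH : Hull S A B C) :
    T.edges.card + 6 = 3 * S.card := by
  have h1 : (faces T).card = ((darts T).filter (fun d => ∃ x ∈ S, 0 < cr d.1 d.2 x)).card := by
    apply Finset.card_bij (fun f _ => (f.1, f.2.1))
    · intro f hf
      rw [mem_faces] at hf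
      rw [Finset.mem_filter, mem_darts]
      exact ⟨hf.pq, f.2.2, padj_left hf.rp, hf.pos⟩
    · intro f hf g hg h
      rw [mem_faces] at hf hg
      obtain ⟨k1, k2⟩ := Prod.ext_iff.1 h
      simp only at k1 k2
      have : Face T f.1 f.2.1 g.2.2 := by rw [k1, k2]; exact hg
      exact Prod.ext k1 (Prod.ext k2 (hf.unique hS this))
    · intro d hd
      rw [Finset.mem_filter, mem_darts] at hd
      obtain ⟨h1, x, hx, h2⟩ := hd
      obtain ⟨r, hr⟩ := exists_face hS hT h1 hx h2
      exact ⟨(d.1, d.2, r), by rw [mem_faces]; exact hr, rfl⟩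
  have h2 : ((darts T).filter (fun d => ¬ ∃ x ∈ S, 0 < cr d.1 d.2 x)) = {(B, A), (C, B), (A, C)} := by
    ext ⟨p, q⟩
    rw [Finset.mem_filter, mem_darts]
    simp only [Finset.mem_insert, Finset.mem_singleton]
    constructor
    · rintro ⟨h, h'⟩
      exact (no_left_iff hH h).1 h'
    · intro h
      have hadj : padj T p q := by
        rcases h with h | h | h <;> obtain ⟨rfl, rfl⟩ := Prod.mk.injEq .. ▸ h
        · exact padj_symm (hH.edgeAB hS hT)
        · exact padj_symm (hH.rot.edgeAB hS hT)
        · exact padj_symm (hH.rot.rot.edgeAB hS hT)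
      exact ⟨hadj, (no_left_iff hH hadj).2 h⟩
  have h3 : ({(B, A), (C, B), (A, C)} : Finset (Pt × Pt)).card = 3 := by
    rw [Finset.card_eq_three]
    refine ⟨_, _, _, ?_, ?_, ?_, rfl⟩
    · intro h; exact hH.rot.neAB (Prod.ext_iff.1 h).1
    · intro h; exact hH.neAB (Prod.ext_iff.1 h).1.symm
    · intro h; exact hH.rot.rot.neAB (Prod.ext_iff.1 h).1
  have h4 := Finset.card_filter_add_card_filter_not (s := darts T) (fun d => ∃ x ∈ S, 0 < cr d.1 d.2 x)
  rw [← h1, h2, h3, darts_card] at h4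
  have := faces_card hS hT hH
  omega

end euler

section flip
variable {S : Finset Pt} {T : PlaneGraph S} {A B C : Pt}

/-- Grassmann-Pluecker relation. -/
lemma pluecker (p a b c d : Pt) :
    cr p a b * cr p c d - cr p a c * cr p b d + cr p a d * cr p b c = 0 := by
  simp only [cr]; ring

lemma valid_triple (hS : GenPos S) (hT : IsTriangulation T) (hH : Hull S A B C) {p a : Pt}
    (hp : Inn S A B C p) (ha : padj T p a) :
    ∃ b c, padj T p b ∧ padj T p c ∧ 0 < cr p a b ∧ 0 < cr p b c ∧ 0 < cr p c a := by
  have el : ∀ x, ell (-(a.2 - p.2)) (a.1 - p.1) x - ell (-(a.2 - p.2)) (a.1 - p.1) p = cr p a x := by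
    intro x; simp only [ell, cr]; ring
  obtain ⟨s, hs, hs'⟩ := hH.half_cr hp (padj_ne ha)
  obtain ⟨b, hpb, hb0, hb⟩ := ext_nbr' hS hT (α := -(a.2 - p.2)) (β := a.1 - p.1) hp.1 hs
    (by have := el s; linarith)
  obtain ⟨s', hs2, hs2'⟩ := hH.half hp.1 hp.2.1 hp.2.2.1 hp.2.2.2
    (α := (a.2 - p.2)) (β := -(a.1 - p.1)) (by
      by_contra hc
      push Not at hc
      exact padj_ne ha (by apply Prod.ext <;> linarith [hc.1, hc.2]))
  have el' : ∀ x, ell (a.2 - p.2) (-(a.1 - p.1)) x - ell (a.2 - p.2) (-(a.1 - p.1)) p = - cr p a x := by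
    intro x; simp only [ell, cr]; ring
  obtain ⟨c, hpc, hc0, hc⟩ := ext_nbr hS hT (α := (a.2 - p.2)) (β := -(a.1 - p.1)) hp.1 hs2
    (by simp only [ell]; linarith)
  have hab : 0 < cr p a b := by have := el b; linarith
  have hac : cr p a c < 0 := by have := el' c; linarith
  refine ⟨b, c, hpb, hpc, hab, ?_, by rw [cr_swap]; linarith⟩
  obtain ⟨x, hx, hx0⟩ := hH.gap_cr hS hT hp (padj_ne hpb)
  have hxa : cr p a x < 0 := by
    by_contra hn
    push Not at hn
    rcases hn.eq_or_lt with h | h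
    · by_cases hxa : a = x
      · subst hxa
        rw [cr_swap] at hx0; linarith
      · exact gp_ne hS hp.1 (padj_right ha) (padj_right hx) (padj_ne ha) (padj_ne hx) hxa h.symm
    · have := hb x hx (by have := el x; linarith)
      rw [cr_swap] at this
      linarith
  have h1 := hc x hx (by have := el' x; linarith)
  have e := pluecker p a b c x
  by_contra hn
  push Not at hn
  have a1 := mul_nonneg hab.le h1
  have a2 := mul_neg_of_neg_of_pos hac hx0
  have a3 := mul_nonneg_of_nonpos_of_nonpos hxa.le hn
  linarith

/-- Edge sets whose faces are convex: hull edges are present, and every interior vertex has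
an edge into each open half plane. -/
structure Good (S : Finset Pt) (A B C : Pt) (E : Finset (Sym2 Pt)) : Prop where
  ab : s(A, B) ∈ E
  bc : s(B, C) ∈ E
  ca : s(C, A) ∈ E
  inn : ∀ p, Inn S A B C p → ∀ d, p ≠ d → ∃ s, s(p, s) ∈ E ∧ 0 < cr p d s

lemma Good.mono {E E' : Finset (Sym2 Pt)} (h : Good S A B C E) (hE : E ⊆ E') : Good S A B C E' :=
  ⟨hE h.ab, hE h.bc, hE h.ca, fun p hp d hd => by
    obtain ⟨s, h1, h2⟩ := h.inn p hp d hd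
    exact ⟨s, hE h1, h2⟩⟩

lemma triple_half {p a b c d : Pt} (hd : p ≠ d) (h1 : 0 < cr p a b) (h2 : 0 < cr p b c) (h3 : 0 < cr p c a) :
    0 < cr p d a ∨ 0 < cr p d b ∨ 0 < cr p d c := by
  by_contra hcon
  push Not at hcon
  obtain ⟨ka, kb, kc⟩ := hcon
  have e : cr p b c * cr p d a + cr p c a * cr p d b + cr p a b * cr p d c = 0 := by
    simp only [cr]; ring
  have fA := mul_nonneg h2.le (neg_nonneg.2 ka)
  have fB := mul_nonneg h3.le (neg_nonneg.2 kb)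
  have fC := mul_nonneg h1.le (neg_nonneg.2 kc)
  have gA : cr p d a = 0 := by
    have : cr p b c * cr p d a = 0 := by linarith
    exact (mul_eq_zero.1 this).resolve_left h2.ne'
  have gB : cr p d b = 0 := by
    have : cr p c a * cr p d b = 0 := by linarith
    exact (mul_eq_zero.1 this).resolve_left h3.ne'
  have k1 : (d.1 - p.1) * cr p a b = 0 := by
    have : (d.1 - p.1) * cr p a b = cr p d b * (a.1 - p.1) - cr p d a * (b.1 - p.1) := by simp only [cr]; ring
    rw [this, gA, gB]; ring
  have k2 : (d.2 - p.2) * cr p a b = 0 := by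
    have : (d.2 - p.2) * cr p a b = cr p d b * (a.2 - p.2) - cr p d a * (b.2 - p.2) := by simp only [cr]; ring
    rw [this, gA, gB]; ring
  have k1' := (mul_eq_zero.1 k1).resolve_right h1.ne'
  have k2' := (mul_eq_zero.1 k2).resolve_right h1.ne'
  exact hd (by apply Prod.ext <;> linarith)

lemma Hull.pos_fun (hH : Hull S A B C) : ∃ α β : ℝ, ∀ x ∈ S, x ≠ A → ell α β A < ell α β x := by
  refine ⟨-(B.2 - A.2) + (C.2 - A.2), (B.1 - A.1) - (C.1 - A.1), ?_⟩
  intro x hx hxA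
  have h : 0 < cr A B x + cr C A x := by
    by_cases hB : x = B
    · have := hH.ca x hx (by rw [hB]; exact hH.rot.neAB) hxA
      rw [hB] at this ⊢
      rw [cr_self3]; linarith
    · have h1 := hH.ab x hx hxA hB
      by_cases hC : x = C
      · rw [hC] at h1 ⊢; rw [cr_self2]; linarith
      · have := hH.ca x hx hC hxA
        linarith
  simp only [cr] at h
  simp only [ell]
  linarith

/-- Convexity at an endpoint of a free edge. -/
lemma flip_convex (hS : GenPos S) (hH : Hull S A B C) {E : Finset (Sym2 Pt)}
    (hE : Good S A B C E) (hET : E ⊆ T.edges) {a b c d : Pt} (hab : s(a, b) ∉ E)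
    (h1 : Face T a b c) (h2 : Face T b a d) : 0 < cr a d c := by
  have hbc := h1.pos
  have hdb : 0 < cr a d b := by have := h2.pos; rwa [← cr_rot] at this
  have hcd : c ≠ d := by
    rintro rfl
    rw [cr_swap] at hdb
    linarith
  have hull : ∀ A B C : Pt, Hull S A B C → a = A → 0 < cr a d c := by
    rintro A B C hH rfl
    obtain ⟨α, β, hpos⟩ := hH.pos_fun
    have e := ell3 α β a b d c
    have eb := hpos b (padj_right h1.pq) (padj_ne h1.pq).symm
    have ec := hpos c (padj_left h1.rp) (padj_ne h1.rp)
    have ed := hpos d (padj_left h2.rp) (padj_ne h2.qr).symm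
    have a1 := mul_pos (sub_pos.2 ec) hdb
    have a2 := mul_pos (sub_pos.2 ed) hbc
    have h' : cr a b d = - cr a d b := cr_swap _ _ _
    rw [h'] at e
    by_contra hn
    push Not at hn
    have a3 := mul_nonpos_of_nonneg_of_nonpos (sub_pos.2 eb).le hn
    linarith
  by_cases hA : a = A
  · exact hull A B C hH hA
  by_cases hB : a = B
  · exact hull B C A hH.rot hB
  by_cases hC : a = C
  · exact hull C A B hH.rot.rot hC
  rcases lt_or_gt_of_ne (gp_ne hS (padj_left h1.pq) (padj_left h2.rp) (padj_left h1.rp)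
      (padj_ne h2.qr) (padj_ne h1.rp).symm hcd.symm) with h4 | h4
  swap
  · exact h4
  exfalso
  obtain ⟨s, hs, hs'⟩ := hE.inn a ⟨padj_left h1.pq, hA, hB, hC⟩ d (padj_ne h2.qr)
  have hsT : padj T a s := hET hs
  have hsb : b ≠ s := by rintro rfl; exact hab hs
  have n1 := h1.no_nbr hS s hsT
  have n2 := h2.rot.no_nbr hS s hsT
  have hbs := gp_ne hS (padj_left h1.pq) (padj_right h1.pq) (padj_right hsT) (padj_ne h1.pq) (padj_ne hsT) hsb
  have hbs' : 0 < cr a b s := by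
    rcases lt_or_gt_of_ne hbs with h | h
    · exact absurd ⟨hs', by rw [cr_swap]; linarith⟩ n2
    · exact h
  have hcs : 0 ≤ cr a c s := by
    by_contra hn
    push Not at hn
    exact n1 ⟨hbs', by rw [cr_swap]; linarith⟩
  have e := pluecker a b c d s
  have hbd : cr a b d = - cr a d b := cr_swap _ _ _
  have hcd' : cr a c d = - cr a d c := cr_swap _ _ _
  rw [hbd, hcd'] at e
  have a1 := mul_pos hbc hs'
  have a2 := mul_nonneg hdb.le hcs
  have a3 := mul_pos hbs' (neg_pos.2 h4)
  linarith

lemma flip_on_ab {a b c d : Pt} (h1 : 0 < cr a b c)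
    (ha : 0 < cr a d c) (hb : 0 < cr b c d) {τ : ℝ} (hτ : 0 < τ) (hz : cr a b (lpt c d τ) = 0) :
    lpt c d τ ∈ segment ℝ a b ∧ lpt c d τ ≠ a ∧ lpt c d τ ≠ b := by
  set z := lpt c d τ with hzdef
  have e1 : cr a z c = τ * cr a d c := by rw [hzdef, cr_lpt2, cr_self3]; ring
  have e2 : cr b c z = τ * cr b c d := by rw [hzdef, cr_lpt, cr_self3]; ring
  have p1 : 0 < cr a z c := by rw [e1]; positivity
  have p2 : 0 < cr b c z := by rw [e2]; positivity
  have hs := cr_sum a b c z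
  have e3 : cr c a z = cr a z c := (cr_rot _ _ _).symm
  refine ⟨?_, ?_, ?_⟩
  · rw [frame_on_line h1.ne' hz]
    apply lpt_mem_seg
    · positivity
    · rw [div_le_one h1]; linarith
  · intro h; rw [h, cr_self1] at p1; exact lt_irrefl _ p1
  · intro h; rw [h, cr_self2] at p2; exact lt_irrefl _ p2

/-- The flip. -/
lemma flip_edge (hS : GenPos S) (hT : IsTriangulation T) (hH : Hull S A B C) {E : Finset (Sym2 Pt)}
    (hE : Good S A B C E) (hET : E ⊆ T.edges) {e : Sym2 Pt} (he : e ∈ T.edges) (heE : e ∉ E) :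
    ∃ (T' : PlaneGraph S) (e' : Sym2 Pt), T'.edges = insert e' (T.edges.erase e) ∧ e' ∉ E ∧
      ∀ G : PlaneGraph S, ¬ (e ∈ G.edges ∧ e' ∈ G.edges) := by
  induction e with
  | _ a b =>
  have hab : padj T a b := he
  have hba : padj T b a := padj_symm he
  have left : ∀ a b : Pt, padj T a b → s(a, b) ∉ E → ∃ c, Face T a b c := by
    intro a b hab hE'
    by_cases h : ∃ x ∈ S, 0 < cr a b x
    · obtain ⟨x, hx, hx'⟩ := h
      exact exists_face hS hT hab hx hx'
    · exfalso
      rcases (no_left_iff hH hab).1 h with h | h | h <;> obtain ⟨rfl, rfl⟩ := Prod.mk.injEq .. ▸ h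
      · exact hE' (by rw [Sym2.eq_swap]; exact hE.ab)
      · exact hE' (by rw [Sym2.eq_swap]; exact hE.bc)
      · exact hE' (by rw [Sym2.eq_swap]; exact hE.ca)
  have heE' : s(b, a) ∉ E := by rw [Sym2.eq_swap]; exact heE
  obtain ⟨c, h1⟩ := left a b hab heE
  obtain ⟨d, h2⟩ := left b a hba heE'
  have ka := flip_convex hS hH hE hET heE h1 h2
  have kb := flip_convex hS hH hE hET heE' h2 h1
  have hc0 := h1.pos
  have hd0 : cr a b d < 0 := by have := h2.pos; rw [cr_swap'] at this; linarith
  have hcd : c ≠ d := by rintro rfl; linarith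
  have hcS := padj_left h1.rp
  have hdS := padj_left h2.rp
  have cross : ∀ G : PlaneGraph S, ¬ (s(a, b) ∈ G.edges ∧ s(c, d) ∈ G.edges) := by
    rintro G ⟨g1, g2⟩
    have hτ : 0 < cr a b c / (cr a b c - cr a b d) := div_pos hc0 (by linarith)
    have hτ1 : cr a b c / (cr a b c - cr a b d) ≤ 1 := by rw [div_le_one (by linarith)]; linarith
    set τ := cr a b c / (cr a b c - cr a b d) with hτd
    obtain ⟨k1, k2, k3⟩ := flip_on_ab hc0 ka kb hτ (by
      rw [cr_lpt, hτd]
      have : cr a b c - cr a b d ≠ 0 := by linarith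
      field_simp; ring)
    have := plane_same (T := G) g1 g2 k1 (lpt_mem_seg _ _ hτ.le hτ1) k2 k3
    rw [Sym2.eq_iff] at this
    rcases this with ⟨h, -⟩ | ⟨h, -⟩
    · exact padj_ne h1.rp h.symm
    · exact padj_ne h2.qr h
  have hplane : ∀ u v, padj (subGraph T (T.edges.erase s(a, b)) (Finset.erase_subset _ _)) u v →
      s(u, v) ≠ s(c, d) → ∀ z, z ∈ segment ℝ u v → z ∈ segment ℝ c d → z ∈ s(u, v) ∧ z ∈ s(c, d) := by
    intro u v huv _ z hz1 hz2
    have huv' : s(u, v) ∈ T.edges.erase s(a, b) := huv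
    rw [Finset.mem_erase] at huv'
    obtain ⟨hne, huvT⟩ := huv'
    have huvT : padj T u v := huvT
    obtain ⟨τ, t0, t1, rfl⟩ := (mem_seg_iff _ _ _).1 hz2
    have endp : ∀ w ∈ S, w ∈ segment ℝ u v → w ∈ s(u, v) := by
      intro w hw hw'
      rw [Sym2.mem_iff]
      exact mem_seg_S hS (padj_left huvT) (padj_right huvT) hw (padj_ne huvT) hw'
    rcases t0.eq_or_lt with h | t0'
    · subst h
      rw [lpt_zero] at *
      exact ⟨endp c hcS hz1, by simp⟩
    rcases t1.eq_or_lt with h | t1'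
    · subst h
      rw [lpt_one] at *
      exact ⟨endp d hdS hz1, by simp⟩
    exfalso
    rcases lt_trichotomy (cr a b (lpt c d τ)) 0 with h | h | h
    · refine h2.clear hS huvT hz1 ⟨by rw [cr_swap']; linarith, ?_, ?_⟩
      · rw [cr_lpt, cr_self3]
        have := mul_pos (sub_pos.2 t1') ka
        linarith
      · rw [cr_lpt, cr_self2, cr_rot']
        have := mul_pos (sub_pos.2 t1') kb
        linarith
    · obtain ⟨k1, k2, k3⟩ := flip_on_ab hc0 ka kb t0' h
      exact hne (plane_same hab huvT k1 hz1 k2 k3).symm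
    · refine h1.clear hS huvT hz1 ⟨h, ?_, ?_⟩
      · rw [cr_lpt, cr_self3]
        have := mul_pos t0' kb
        linarith
      · rw [cr_lpt, cr_self2]
        have := mul_pos t0' ka
        have e' : cr c a d = cr a d c := (cr_rot _ _ _).symm
        rw [e']
        linarith
  refine ⟨insEdge _ c d hcS hdS hcd hplane, s(c, d), rfl, ?_, cross⟩
  intro hcdE
  exact cross T ⟨he, hET hcdE⟩
end flip

section support
variable {S : Finset Pt} {T : PlaneGraph S} {A B C : Pt}

instance finite_planeGraph (S : Finset Pt) : Finite (PlaneGraph S) := by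
  have hsub : ∀ G : PlaneGraph S, G.edges ∈ S.sym2.powerset := by
    intro G
    rw [Finset.mem_powerset]
    intro e he
    rw [Finset.mem_sym2_iff]
    exact fun p hp => G.endpoint_mem e he p hp
  apply Finite.of_injective (fun G : PlaneGraph S => (⟨G.edges, hsub G⟩ : {x // x ∈ S.sym2.powerset}))
  intro G H h
  exact pg_ext (Subtype.ext_iff.1 h)

lemma extend_tri (G : PlaneGraph S) : ∃ T : PlaneGraph S, IsTriangulation T ∧ G.edges ⊆ T.edges := by
  have : Nonempty {H : PlaneGraph S // G.edges ⊆ H.edges} := ⟨⟨G, subset_rfl⟩⟩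
  obtain ⟨⟨H, hH⟩, hmax⟩ := Finite.exists_max (fun H : {H : PlaneGraph S // G.edges ⊆ H.edges} => H.1.edges.card)
  refine ⟨H, ?_, hH⟩
  intro K hK
  have := hmax ⟨K, hH.trans hK⟩
  exact (Finset.eq_of_subset_of_card_le hK this).symm

lemma supp_mono {G H : PlaneGraph S} (h : G.edges ⊆ H.edges) : supp H ≤ supp G := by
  unfold supp
  apply Nat.card_le_card_of_injective
    (fun T : {T : PlaneGraph S // IsTriangulation T ∧ H.edges ⊆ T.edges} =>
      (⟨T.1, T.2.1, h.trans T.2.2⟩ : {T : PlaneGraph S // IsTriangulation T ∧ G.edges ⊆ T.edges}))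
  intro T T' h
  have h' := congrArg Subtype.val h
  exact Subtype.ext h'

lemma supp_add {G H K : PlaneGraph S} (h1 : G.edges ⊆ H.edges) (h2 : G.edges ⊆ K.edges)
    (hd : ∀ T : PlaneGraph S, ¬ (H.edges ⊆ T.edges ∧ K.edges ⊆ T.edges)) : supp H + supp K ≤ supp G := by
  unfold supp
  rw [← Nat.card_sum]
  apply Nat.card_le_card_of_injective
    (fun x : {T : PlaneGraph S // IsTriangulation T ∧ H.edges ⊆ T.edges} ⊕ {T : PlaneGraph S // IsTriangulation T ∧ K.edges ⊆ T.edges} =>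
      (Sum.elim (fun T => ⟨T.1, T.2.1, h1.trans T.2.2⟩) (fun T => ⟨T.1, T.2.1, h2.trans T.2.2⟩) x :
        {T : PlaneGraph S // IsTriangulation T ∧ G.edges ⊆ T.edges}))
  rintro (T | T) (T' | T') h
  · have := Subtype.ext_iff.1 h
    simp only [Sum.elim_inl] at this
    rw [Subtype.ext this]
  · have := Subtype.ext_iff.1 h
    simp only [Sum.elim_inl, Sum.elim_inr] at this
    exact absurd ⟨T.2.2, by rw [this]; exact T'.2.2⟩ (hd T.1)
  · have := Subtype.ext_iff.1 h
    simp only [Sum.elim_inl, Sum.elim_inr] at this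
    exact absurd ⟨T'.2.2, by rw [← this]; exact T.2.2⟩ (hd T'.1)
  · have := Subtype.ext_iff.1 h
    simp only [Sum.elim_inr] at this
    rw [Subtype.ext this]

lemma supp_pow (hS : GenPos S) (hH : Hull S A B C) (k : ℕ) : ∀ (G T : PlaneGraph S),
    Good S A B C G.edges → IsTriangulation T → G.edges ⊆ T.edges → k ≤ (T.edges \ G.edges).card →
    2 ^ k ≤ supp G := by
  induction k with
  | zero =>
    intro G T _ hT hGT _
    rw [pow_zero]
    have : Nonempty {T : PlaneGraph S // IsTriangulation T ∧ G.edges ⊆ T.edges} := ⟨⟨T, hT, hGT⟩⟩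
    exact Nat.card_pos
  | succ k ih =>
    intro G T hG hT hGT hk
    obtain ⟨e, he⟩ : (T.edges \ G.edges).Nonempty := by
      rw [← Finset.card_pos]; omega
    rw [Finset.mem_sdiff] at he
    obtain ⟨T', e', hT', he', hcross⟩ := flip_edge hS hT hH hG hGT he.1 he.2
    have hk' : k ≤ (T.edges \ insert e G.edges).card := by
      have : T.edges \ insert e G.edges = (T.edges \ G.edges).erase e := by
        ext x; simp only [Finset.mem_sdiff, Finset.mem_insert, Finset.mem_erase]; tauto
      rw [this, Finset.card_erase_of_mem (by rw [Finset.mem_sdiff]; exact he)]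
      omega
    have i1 : insert e G.edges ⊆ T.edges := Finset.insert_subset he.1 hGT
    have i2 : insert e' G.edges ⊆ T'.edges := by
      rw [hT']
      apply Finset.insert_subset_insert
      intro x hx
      rw [Finset.mem_erase]
      exact ⟨fun h => he.2 (h ▸ hx), hGT hx⟩
    obtain ⟨T'', ht'', hs''⟩ := extend_tri T'
    have m1 := ih (subGraph T _ i1) T (hG.mono (Finset.subset_insert _ _)) hT i1 hk'
    have m2 := ih (subGraph T' _ i2) T'' (hG.mono (Finset.subset_insert _ _)) ht'' (i2.trans hs'') (by
      refine hk'.trans (Finset.card_le_card ?_)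
      intro x hx
      rw [Finset.mem_sdiff, Finset.mem_insert, not_or] at hx
      have hxe' : x ≠ e' := by
        rintro rfl
        exact hcross T ⟨he.1, hx.1⟩
      change x ∈ T''.edges \ insert e' G.edges
      rw [Finset.mem_sdiff, Finset.mem_insert, not_or]
      refine ⟨hs'' ?_, hxe', hx.2.2⟩
      rw [hT', Finset.mem_insert, Finset.mem_erase]
      exact Or.inr ⟨hx.2.1, hx.1⟩)
    have := supp_add (G := G) (H := subGraph T _ i1) (K := subGraph T' _ i2)
      (Finset.subset_insert _ _) (Finset.subset_insert _ _) (by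
        rintro T ⟨h1, h2⟩
        exact hcross T ⟨h1 (Finset.mem_insert_self _ _), h2 (Finset.mem_insert_self _ _)⟩)
    rw [pow_succ]
    omega

lemma supp_cycle (hS : GenPos S) (hT : IsTriangulation T) (hH : Hull S A B C) {F : Finset (Sym2 Pt)}
    (hF : F ⊆ T.edges) (hG : Good S A B C (T.edges \ F)) (K : PlaneGraph S) (hK : K.edges ⊆ T.edges) :
    2 ^ (F \ K.edges).card ≤ supp K := by
  have i1 : T.edges \ (F \ K.edges) ⊆ T.edges := Finset.sdiff_subset
  have h1 := supp_pow hS hH (F \ K.edges).card (subGraph T _ i1) T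
    (hG.mono (Finset.sdiff_subset_sdiff subset_rfl Finset.sdiff_subset)) hT i1 (by
      change _ ≤ (T.edges \ (T.edges \ (F \ K.edges))).card
      rw [Finset.sdiff_sdiff_eq_self (Finset.sdiff_subset.trans hF)])
  refine h1.trans (supp_mono ?_)
  intro x hx
  change x ∈ T.edges \ (F \ K.edges)
  rw [Finset.mem_sdiff, Finset.mem_sdiff]
  exact ⟨hK hx, fun h => h.2 hx⟩

end support

section choosef
variable {S : Finset Pt} {T : PlaneGraph S} {A B C : Pt}

lemma exists_F (hS : GenPos S) (hT : IsTriangulation T) (hH : Hull S A B C) {n : ℕ} (hn : S.card = 2 * n)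
    {M : Finset (Sym2 Pt)} (hM : M ⊆ T.edges) (hMc : M.card ≤ n) (hcov : ∀ p ∈ S, ∃ e ∈ M, p ∈ e) :
    ∃ F ⊆ T.edges, F.card = n - 3 ∧ Disjoint F M ∧ Good S A B C (T.edges \ F) ∧
      ∀ p, Inn S A B C p → degree T p = 3 → ∀ e ∈ F, p ∉ e := by
  have hch : ∀ p, ∃ a b c, Inn S A B C p → (s(p, a) ∈ M ∧ padj T p b ∧ padj T p c ∧
      0 < cr p a b ∧ 0 < cr p b c ∧ 0 < cr p c a) := by
    intro p
    by_cases hp : Inn S A B C p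
    · obtain ⟨e, he, hpe⟩ := hcov p hp.1
      obtain ⟨a, rfl⟩ := Sym2.mem_iff_exists.1 hpe
      obtain ⟨b, c, h⟩ := valid_triple hS hT hH hp (hM he)
      exact ⟨a, b, c, fun _ => ⟨he, h⟩⟩
    · exact ⟨p, p, p, fun h => absurd h hp⟩
  choose a b c habc using hch
  set I := S.filter (fun p => p ≠ A ∧ p ≠ B ∧ p ≠ C) with hI
  have hInn : ∀ p, Inn S A B C p ↔ p ∈ I := by
    intro p; rw [hI, Finset.mem_filter]; rfl
  set D : Finset (Sym2 Pt) := {s(A, B), s(B, C), s(C, A)} ∪ M ∪ I.image (fun p => s(p, b p)) ∪ I.image (fun p => s(p, c p)) with hD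
  have hDT : D ⊆ T.edges := by
    intro e he
    simp only [hD, Finset.mem_union, Finset.mem_insert, Finset.mem_singleton, Finset.mem_image] at he
    rcases he with (((rfl | rfl | rfl) | he) | ⟨p, hp, rfl⟩) | ⟨p, hp, rfl⟩
    · exact hH.edgeAB hS hT
    · exact hH.rot.edgeAB hS hT
    · exact hH.rot.rot.edgeAB hS hT
    · exact hM he
    · exact (habc p ((hInn p).2 hp)).2.1
    · exact (habc p ((hInn p).2 hp)).2.2.1
  have hDc : D.card ≤ 3 + n + I.card + I.card := by
    refine (Finset.card_union_le _ _).trans (add_le_add ?_ Finset.card_image_le)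
    refine (Finset.card_union_le _ _).trans (add_le_add ?_ Finset.card_image_le)
    refine (Finset.card_union_le _ _).trans (add_le_add ?_ hMc)
    exact Finset.card_le_three
  have hIc := hH.card_inn
  have heul := euler hS hT hH
  have hcard : n - 3 ≤ (T.edges \ D).card := by
    rw [Finset.card_sdiff_of_subset hDT]
    rw [← hI] at hIc
    omega
  obtain ⟨F, hF, hFc⟩ := Finset.exists_subset_card_eq hcard
  have hFD : ∀ e ∈ F, e ∉ D := fun e he => (Finset.mem_sdiff.1 (hF he)).2
  have hDF : D ⊆ T.edges \ F := by
    intro e he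
    rw [Finset.mem_sdiff]
    exact ⟨hDT he, fun h => hFD e h he⟩
  have memM : ∀ e ∈ M, e ∈ D := by intro e he; simp [hD, he]
  have memb : ∀ p, Inn S A B C p → s(p, b p) ∈ D := by
    intro p hp
    simp only [hD, Finset.mem_union]
    exact Or.inl (Or.inr (Finset.mem_image_of_mem (fun p => s(p, b p)) ((hInn p).1 hp)))
  have memc : ∀ p, Inn S A B C p → s(p, c p) ∈ D := by
    intro p hp
    simp only [hD, Finset.mem_union]
    exact Or.inr (Finset.mem_image_of_mem (fun p => s(p, c p)) ((hInn p).1 hp))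
  have hgood : Good S A B C D := by
    refine ⟨by simp [hD], by simp [hD], by simp [hD], ?_⟩
    intro p hp d hd
    obtain ⟨h1, h2, h3, h4, h5, h6⟩ := habc p hp
    rcases triple_half hd h4 h5 h6 with h | h | h
    · exact ⟨a p, memM _ h1, h⟩
    · exact ⟨b p, memb p hp, h⟩
    · exact ⟨c p, memc p hp, h⟩
  refine ⟨F, hF.trans Finset.sdiff_subset, hFc, ?_, hgood.mono hDF, ?_⟩
  · rw [Finset.disjoint_left]
    exact fun e he he' => hFD e he (memM e he')
  · intro p hp hdeg e he hpe
    obtain ⟨h1, h2, h3, h4, h5, h6⟩ := habc p hp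
    have hsub : ({s(p, a p), s(p, b p), s(p, c p)} : Finset (Sym2 Pt)) ⊆ T.edges.filter (fun e => p ∈ e) := by
      intro x hx
      simp only [Finset.mem_insert, Finset.mem_singleton] at hx
      rw [Finset.mem_filter]
      rcases hx with rfl | rfl | rfl
      · exact ⟨hM h1, by simp⟩
      · exact ⟨h2, by simp⟩
      · exact ⟨h3, by simp⟩
    have hcard3 : ({s(p, a p), s(p, b p), s(p, c p)} : Finset (Sym2 Pt)).card = 3 := by
      rw [Finset.card_eq_three]
      refine ⟨_, _, _, ?_, ?_, ?_, rfl⟩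
      · intro h; rw [Sym2.congr_right] at h; rw [h, cr_self3] at h4; exact lt_irrefl _ h4
      · intro h; rw [Sym2.congr_right] at h; rw [h, cr_self3] at h6; exact lt_irrefl _ h6
      · intro h; rw [Sym2.congr_right] at h; rw [h, cr_self3] at h5; exact lt_irrefl _ h5
    have heq := Finset.eq_of_subset_of_card_le hsub (by rw [hcard3]; exact hdeg.le)
    have : e ∈ T.edges.filter (fun e => p ∈ e) := by
      rw [Finset.mem_filter]; exact ⟨(Finset.mem_sdiff.1 (hF he)).1, hpe⟩
    rw [← heq] at this
    simp only [Finset.mem_insert, Finset.mem_singleton] at this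
    apply hFD e he
    rcases this with rfl | rfl | rfl
    · exact memM _ h1
    · exact memb p hp
    · exact memc p hp

end choosef

lemma skew_nf {ι : Type} [Fintype ι] (k : ℕ) : ∀ (A : ι → ι → ℝ) (I : Finset ι), I.card ≤ 2 * k →
    (∀ i j, A i j = - A j i) → (∀ i j, i ∉ I → A i j = 0) →
    ∃ u v : Fin k → ι → ℝ, ∀ i j, A i j = ∑ m, (u m i * v m j - v m i * u m j) := by
  induction k with
  | zero =>
    intro A I hI hs h0
    refine ⟨fun _ _ => 0, fun _ _ => 0, fun i j => ?_⟩
    have : I = ∅ := Finset.card_eq_zero.1 (by omega)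
    subst this
    simp [h0 i j]
  | succ k ih =>
    intro A I hI hs h0
    by_cases hA : ∀ i j, A i j = 0
    · exact ⟨fun _ _ => 0, fun _ _ => 0, fun i j => by simp [hA i j]⟩
    push Not at hA
    obtain ⟨p, q, ha⟩ := hA
    have hd : ∀ i, A i i = 0 := fun i => by have := hs i i; linarith
    have hpq : p ≠ q := by rintro rfl; exact ha (hd p)
    have hp : p ∈ I := by by_contra h; exact ha (h0 p q h)
    have hq : q ∈ I := by
      by_contra h
      have := h0 q p h
      have := hs p q
      apply ha; linarith
    obtain ⟨u, v, huv⟩ := ih (fun i j => A i j - (A i q * A p j - A i p * A q j) / A p q)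
      ((I.erase p).erase q) (by
        rw [Finset.card_erase_of_mem (Finset.mem_erase.2 ⟨hpq.symm, hq⟩), Finset.card_erase_of_mem hp]
        omega) (by
        intro i j
        rw [hs j q, hs p i, hs j p, hs q i, hs j i]
        ring) (by
        intro i j hi
        by_cases h1 : i = p
        · subst h1; rw [hd i]; field_simp; ring
        by_cases h2 : i = q
        · subst h2; rw [hd i, hs i p]; field_simp; ring
        have hi' : i ∉ I := by
          intro h; apply hi; simp [h1, h2, h]
        rw [h0 i j hi', h0 i q hi', h0 i p hi']; simp)
    refine ⟨Fin.cons (fun i => A i q / A p q) u, Fin.cons (fun j => A p j) v, fun i j => ?_⟩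
    rw [Fin.sum_univ_succ]
    simp only [Fin.cons_zero, Fin.cons_succ]
    rw [← huv i j, hs p i, hs j q]
    ring

/-- Hadamard inequality. -/
lemma hadamard_fin (n : ℕ) (A : Matrix (Fin n) (Fin n) ℝ) :
    |A.det| ≤ ∏ i, Real.sqrt (∑ j, A i j ^ 2) := by
  rcases n with _ | n
  · simp
  have : Fact (Module.finrank ℝ (EuclideanSpace ℝ (Fin (n+1))) = n + 1) := ⟨by simp⟩
  let b : OrthonormalBasis (Fin (n+1)) ℝ (EuclideanSpace ℝ (Fin (n+1))) := EuclideanSpace.basisFun _ ℝ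
  let o := b.toBasis.orientation
  let v : Fin (n+1) → EuclideanSpace ℝ (Fin (n+1)) := fun i => WithLp.toLp 2 (A i)
  have h1 := o.abs_volumeForm_apply_le v
  have h2 := o.volumeForm_robust' b v
  rw [h2] at h1
  rw [Module.Basis.det_apply] at h1
  have h3 : b.toBasis.toMatrix v = A.transpose := by
    ext i j
    simp [Module.Basis.toMatrix_apply, b, v]
  rw [h3, Matrix.det_transpose] at h1
  refine h1.trans (le_of_eq ?_)
  refine Finset.prod_congr rfl fun i _ => ?_
  rw [EuclideanSpace.norm_eq]
  simp [v]

lemma hadamard {ι : Type} [Fintype ι] [DecidableEq ι] (A : Matrix ι ι ℝ) :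
    |A.det| ≤ ∏ i, Real.sqrt (∑ j, A i j ^ 2) := by
  let e := Fintype.equivFin ι
  have := hadamard_fin _ (Matrix.reindex e e A)
  rw [Matrix.det_reindex_self] at this
  refine this.trans (le_of_eq ?_)
  rw [← Equiv.prod_comp e]
  refine Finset.prod_congr rfl fun i _ => ?_
  rw [← Equiv.sum_comp e]
  simp


/-- sign attached to the second coordinate -/
def sg2 (e : Fin 2) : ℝ := if e = 0 then 1 else -1

lemma sg2_abs (e : Fin 2) : |sg2 e| = 1 := by unfold sg2; split <;> simp

/-- the Pfaffian-like signed sum -/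
def pfs (n : ℕ) (A : Fin n × Fin 2 → Fin n × Fin 2 → ℝ) : ℝ :=
  ∑ σ : Equiv.Perm (Fin n × Fin 2), ((Equiv.Perm.sign σ : ℤ) : ℝ) * ∏ i, A (σ (i, 0)) (σ (i, 1))

lemma fin2_flip (e : Fin 2) : e.rev ≠ e := by fin_cases e <;> simp

def tauf {n : ℕ} (f : Fin n → Fin n × Fin 2) (x : Fin n × Fin 2) : Fin n × Fin 2 :=
  ((f x.1).1, if x.2 = 0 then (f x.1).2 else (f x.1).2.rev)

lemma tauf_inj {n : ℕ} (f : Fin n → Fin n × Fin 2) (h : Function.Injective (fun i => (f i).1)) :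
    Function.Injective (tauf f) := by
  rintro ⟨i, a⟩ ⟨j, b⟩ hab
  simp only [tauf, Prod.mk.injEq] at hab
  obtain ⟨h1, h2⟩ := hab
  have hij : i = j := h h1
  subst hij
  have hf := fin2_flip (f i).2
  congr 1
  generalize (f i).2 = c at *
  clear h h1
  revert a b c
  decide

lemma det_tauf_le {n : ℕ} (B : Matrix (Fin n × Fin 2) (Fin n × Fin 2) ℝ)
    (f : Fin n → Fin n × Fin 2) :
    |(B.submatrix id (tauf f)).det| =
      if Function.Injective (fun i => (f i).1) then |B.det| else 0 := by
  split_ifs with h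
  · have hb : Function.Bijective (tauf f) := Finite.injective_iff_bijective.1 (tauf_inj f h)
    have := Matrix.det_permute' (Equiv.ofBijective _ hb) B
    rw [Equiv.coe_ofBijective] at this
    rw [this, abs_mul]
    rcases Int.units_eq_one_or (Equiv.Perm.sign (Equiv.ofBijective _ hb)) with h | h <;> rw [h] <;> simp
  · rw [abs_eq_zero]
    unfold Function.Injective at h
    push Not at h
    obtain ⟨i, j, hij, hne⟩ := h
    by_cases h2 : (f i).2 = (f j).2
    · apply Matrix.det_zero_of_column_eq (i := (i, 0)) (j := (j, 0)) (by simp [hne])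
      intro k
      simp [tauf, hij, h2]
    · apply Matrix.det_zero_of_column_eq (i := (i, 0)) (j := (j, 1)) (by simp)
      intro k
      have : (f i).2 = (f j).2.rev := by
        revert h2
        generalize (f i).2 = a
        generalize (f j).2 = b
        fin_cases a <;> fin_cases b <;> simp
      simp [tauf, hij, this]

lemma count_inj (n : ℕ) : (Finset.univ.filter (fun f : Fin n → Fin n × Fin 2 =>
    Function.Injective (fun i => (f i).1))).card = 2 ^ n * n.factorial := by
  have h1 : (Finset.univ.filter (fun f : Fin n → Fin n × Fin 2 =>
    Function.Injective (fun i => (f i).1))).card =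
    ((Finset.univ.filter (fun g : Fin n → Fin n => Function.Injective g)) ×ˢ
      (Finset.univ : Finset (Fin n → Fin 2))).card := by
    apply Finset.card_equiv (Equiv.arrowProdEquivProdArrow (Fin n) (fun _ => Fin n) (fun _ => Fin 2))
    intro f
    simp [Equiv.arrowProdEquivProdArrow]
  rw [h1, Finset.card_product]
  have h2 : (Finset.univ.filter (fun g : Fin n → Fin n => Function.Injective g)).card = n.factorial := by
    rw [← Fintype.card_subtype, Fintype.card_congr (Equiv.subtypeInjectiveEquivEmbedding _ _),
      Fintype.card_embedding_eq]
    simp [Nat.descFactorial_self]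
  rw [h2]
  simp [mul_comm]

lemma pfs_bound_det (n : ℕ) (A : Fin n × Fin 2 → Fin n × Fin 2 → ℝ)
    (B : Matrix (Fin n × Fin 2) (Fin n × Fin 2) ℝ)
    (hB : ∀ a b, A a b = ∑ x : Fin n × Fin 2, sg2 x.2 * (B a x * B b (x.1, x.2.rev))) :
    |pfs n A| ≤ 2 ^ n * n.factorial * |B.det| := by
  have h1 : pfs n A = ∑ f : Fin n → Fin n × Fin 2, (∏ i, sg2 (f i).2) *
      (B.submatrix id (tauf f)).det := by
    unfold pfs
    simp only [hB]
    simp only [Fintype.prod_sum, Finset.mul_sum]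
    rw [Finset.sum_comm]
    refine Finset.sum_congr rfl fun f _ => ?_
    rw [Matrix.det_apply', Finset.mul_sum]
    refine Finset.sum_congr rfl fun σ _ => ?_
    rw [Finset.prod_mul_distrib, Fintype.prod_prod_type]
    simp only [Fin.prod_univ_two, Matrix.submatrix_apply, id, tauf, if_true]
    simp
    ring
  rw [h1]
  refine (Finset.abs_sum_le_sum_abs _ _).trans ?_
  simp only [abs_mul, Finset.abs_prod, sg2_abs, Finset.prod_const_one, one_mul, det_tauf_le]
  rw [← Finset.sum_filter, Finset.sum_const, count_inj]
  simp

lemma pfs_bound (n : ℕ) (A : Fin n × Fin 2 → Fin n × Fin 2 → ℝ) (hs : ∀ a b, A a b = - A b a) :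
    |pfs n A| ≤ 2 ^ n * n.factorial * ∏ a, (∑ b, A a b ^ 2) ^ (1 / 4 : ℝ) := by
  obtain ⟨u, v, huv⟩ := skew_nf n A Finset.univ (by simp [mul_comm]) hs (by simp)
  let B : Matrix (Fin n × Fin 2) (Fin n × Fin 2) ℝ := fun a x => if x.2 = 0 then u x.1 a else v x.1 a
  have hB : ∀ a b, A a b = ∑ x : Fin n × Fin 2, sg2 x.2 * (B a x * B b (x.1, x.2.rev)) := by
    intro a b
    rw [huv, Fintype.sum_prod_type]
    refine Finset.sum_congr rfl fun m _ => ?_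
    simp [Fin.sum_univ_two, B, sg2]
    ring
  refine (pfs_bound_det n A B hB).trans ?_
  refine mul_le_mul_of_nonneg_left ?_ (by positivity)
  let e : Equiv.Perm (Fin n × Fin 2) := Equiv.prodCongr (Equiv.refl _) Fin.revPerm
  have hA : (Matrix.of A) = B * (Matrix.of fun i j => sg2 j.2 * (B.submatrix id e) i j).transpose := by
    ext a b
    rw [Matrix.of_apply, hB, Matrix.mul_apply]
    refine Finset.sum_congr rfl fun x _ => ?_
    have he : e x = (x.1, x.2.rev) := rfl
    simp only [Matrix.transpose_apply, Matrix.of_apply, Matrix.submatrix_apply, id, he]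
    ring
  have hdet : |(Matrix.of A).det| = |B.det| ^ 2 := by
    rw [hA, Matrix.det_mul, Matrix.det_transpose, Matrix.det_mul_row, Matrix.det_permute', abs_mul,
      abs_mul, abs_mul, Finset.abs_prod]
    simp only [sg2_abs, Finset.prod_const_one]
    rcases Int.units_eq_one_or (Equiv.Perm.sign e) with h | h <;> rw [h] <;> simp [sq]
  have hh := hadamard (Matrix.of A)
  rw [hdet] at hh
  have h4 : (∏ a, (∑ b, A a b ^ 2) ^ (1 / 4 : ℝ)) ^ 2 = ∏ a, Real.sqrt (∑ b, A a b ^ 2) := by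
    rw [← Finset.prod_pow]
    refine Finset.prod_congr rfl fun a _ => ?_
    have h0 : 0 ≤ ∑ b, A a b ^ 2 := Finset.sum_nonneg fun _ _ => sq_nonneg _
    rw [Real.sqrt_eq_rpow, ← Real.rpow_natCast, ← Real.rpow_mul h0]
    norm_num
  refine le_of_sq_le_sq ?_ ?_
  · rw [h4]; exact hh
  · exact Finset.prod_nonneg fun a _ => Real.rpow_nonneg (Finset.sum_nonneg fun _ _ => sq_nonneg _) _

section kast
variable {α β : ℝ}

lemma ell_lpt (x y : Pt) (s : ℝ) :
    ell α β (lpt x y s) = (1 - s) * ell α β x + s * ell α β y := by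
  simp only [ell, lpt]; ring

lemma on_seg {a b z : Pt} (h : ell α β a < ell α β b) (hz : cr a b z = 0)
    (h1 : ell α β a ≤ ell α β z) (h2 : ell α β z ≤ ell α β b) : z ∈ segment ℝ a b := by
  have hpos : 0 < ell α β b - ell α β a := by linarith
  rw [mem_seg_iff]
  refine ⟨(ell α β z - ell α β a) / (ell α β b - ell α β a), div_nonneg (by linarith) hpos.le,
    (div_le_one hpos).2 (by linarith), ?_⟩
  have e1 : (z.1 - a.1) * (ell α β b - ell α β a) = (b.1 - a.1) * (ell α β z - ell α β a) := by
    simp only [ell, cr] at hz ⊢; linear_combination (-β) * hz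
  have e2 : (z.2 - a.2) * (ell α β b - ell α β a) = (b.2 - a.2) * (ell α β z - ell α β a) := by
    simp only [ell, cr] at hz ⊢; linear_combination α * hz
  apply Prod.ext
  · simp only [lpt]; field_simp; linarith
  · simp only [lpt]; field_simp; linarith

lemma same_side {a b c d x y : Pt} (h : ell α β a < ell α β b)
    (hdis : ∀ z, z ∈ segment ℝ a b → z ∉ segment ℝ c d)
    (hx : x ∈ segment ℝ c d) (hy : y ∈ segment ℝ c d)
    (hx1 : ell α β a ≤ ell α β x) (hx2 : ell α β x ≤ ell α β b)
    (hy1 : ell α β a ≤ ell α β y) (hy2 : ell α β y ≤ ell α β b) : 0 < cr a b x * cr a b y := by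
  by_contra hn
  push Not at hn
  obtain ⟨s, h0, h1, hs⟩ : ∃ s : ℝ, 0 ≤ s ∧ s ≤ 1 ∧ (1 - s) * cr a b x + s * cr a b y = 0 := by
    generalize cr a b x = f at *
    generalize cr a b y = g at *
    by_cases hfg : f = g
    · subst hfg
      exact ⟨0, le_refl _, zero_le_one, by nlinarith⟩
    have hne : f - g ≠ 0 := sub_ne_zero.2 hfg
    have hsq : 0 < (f - g) ^ 2 := by positivity
    refine ⟨f * (f - g) / (f - g) ^ 2, div_nonneg (by nlinarith) hsq.le,
      (div_le_one hsq).2 (by nlinarith), ?_⟩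
    field_simp
    ring
  have hz : lpt x y s ∈ segment ℝ c d :=
    (convex_segment c d).segment_subset hx hy (lpt_mem_seg x y h0 h1)
  refine hdis _ (on_seg h ?_ ?_ ?_) hz
  · rw [cr_lpt]; exact hs
  · rw [ell_lpt]; nlinarith
  · rw [ell_lpt]; nlinarith

variable (α β) in
def ordL (p q : Pt) : ℝ := if ell α β p < ell α β q then 1 else -1

variable (α β) in
def bel (p q k : Pt) : ℝ :=
  if (ell α β p < ell α β k ∧ ell α β k < ell α β q ∧ cr p q k < 0) ∨
     (ell α β q < ell α β k ∧ ell α β k < ell α β p ∧ 0 < cr p q k) then -1 else 1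

lemma bel_symm (p q k : Pt) : bel α β p q k = bel α β q p k := by
  unfold bel
  rw [cr_swap' p q k]
  congr 1
  apply propext
  constructor
  · rintro (⟨h1, h2, h3⟩ | ⟨h1, h2, h3⟩)
    · right; exact ⟨h1, h2, by linarith⟩
    · left; exact ⟨h1, h2, by linarith⟩
  · rintro (⟨h1, h2, h3⟩ | ⟨h1, h2, h3⟩)
    · right; exact ⟨h1, h2, by linarith⟩
    · left; exact ⟨h1, h2, by linarith⟩

lemma ord_lt {p q : Pt} (h : ell α β p < ell α β q) : ordL α β p q = 1 := if_pos h
lemma ord_gt {p q : Pt} (h : ell α β q < ell α β p) : ordL α β p q = -1 := if_neg h.not_gt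
lemma ord_skew {p q : Pt} (h : ell α β p ≠ ell α β q) : ordL α β p q = - ordL α β q p := by
  rcases lt_or_gt_of_ne h with h | h
  · rw [ord_lt h, ord_gt h]; simp
  · rw [ord_lt h, ord_gt h]

lemma bel_out {p q k : Pt} (h : ell α β p < ell α β q)
    (h' : ell α β k ≤ ell α β p ∨ ell α β q ≤ ell α β k) : bel α β p q k = 1 := by
  unfold bel
  rw [if_neg]
  rintro (⟨h1, h2, h3⟩ | ⟨h1, h2, h3⟩) <;> rcases h' with h' | h' <;> linarith

lemma bel_in {p q k : Pt} (h : ell α β p < ell α β k) (h' : ell α β k < ell α β q) :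
    bel α β p q k = if cr p q k < 0 then -1 else 1 := by
  unfold bel
  congr 1
  apply propext
  constructor
  · rintro (⟨h1, h2, h3⟩ | ⟨h1, h2, h3⟩)
    · exact h3
    · linarith
  · intro h3; left; exact ⟨h, h', h3⟩

variable (α β) in
def quad (a b c d : Pt) : ℝ :=
  ordL α β a c * ordL α β a d * ordL α β b c * ordL α β b d *
    (bel α β a b c * bel α β a b d * bel α β c d a * bel α β c d b)

lemma quad_base {a b c d : Pt} (hab : ell α β a < ell α β b) (hcd : ell α β c < ell α β d)
    (hac : ell α β a < ell α β c) (hbc : ell α β b ≠ ell α β c) (hbd : ell α β b ≠ ell α β d)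
    (hdis : ∀ z, z ∈ segment ℝ a b → z ∉ segment ℝ c d) : quad α β a b c d = 1 := by
  unfold quad
  rcases lt_or_gt_of_ne hbc with h1 | h1
  · rw [ord_lt hac, ord_lt (hac.trans hcd), ord_lt h1, ord_lt (h1.trans hcd),
      bel_out hab (Or.inr h1.le), bel_out hab (Or.inr (h1.trans hcd).le),
      bel_out hcd (Or.inl hac.le), bel_out hcd (Or.inl h1.le)]
    norm_num
  rcases lt_or_gt_of_ne hbd with h2 | h2
  · rw [ord_lt hac, ord_lt (hac.trans hcd), ord_gt h1, ord_lt h2,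
      bel_in hac h1, bel_out hab (Or.inr h2.le),
      bel_out hcd (Or.inl hac.le), bel_in h1 h2]
    have hpos : 0 < ell α β d - ell α β c := by linarith
    set s := (ell α β b - ell α β c) / (ell α β d - ell α β c) with hs
    have hs' : s * (ell α β d - ell α β c) = ell α β b - ell α β c := by
      rw [hs]; field_simp
    have hl : ell α β (lpt c d s) = ell α β b := by rw [ell_lpt]; linarith
    have key := same_side hab hdis (left_mem_segment ℝ c d)
      (lpt_mem_seg c d (s := s) (div_nonneg (by linarith) hpos.le) ((div_le_one hpos).2 (by linarith)))
      hac.le h1.le (by rw [hl]; exact hab.le) hl.le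
    have e : (ell α β d - ell α β c) * cr a b (lpt c d s) = -((ell α β b - ell α β a) * cr c d b) := by
      rw [cr_lpt]
      have : (ell α β d - ell α β b) * cr a b c + (ell α β b - ell α β c) * cr a b d =
          -((ell α β b - ell α β a) * cr c d b) := by
        simp only [ell, cr]; ring
      rw [← this]
      linear_combination (cr a b d - cr a b c) * hs'
    have hneg : cr a b c * cr c d b < 0 := by
      have h3 : 0 < ell α β b - ell α β a := by linarith
      have h4 : 0 < (ell α β d - ell α β c) * (cr a b c * cr a b (lpt c d s)) := mul_pos hpos key
      have h5 : (ell α β d - ell α β c) * (cr a b c * cr a b (lpt c d s)) =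
        - ((ell α β b - ell α β a) * (cr a b c * cr c d b)) := by linear_combination cr a b c * e
      rw [h5] at h4
      by_contra hcon
      push Not at hcon
      have := mul_nonneg h3.le hcon
      linarith
    rcases mul_neg_iff.1 hneg with ⟨h3, h4⟩ | ⟨h3, h4⟩
    · rw [if_neg h3.not_gt, if_pos h4]; norm_num
    · rw [if_pos h3, if_neg h4.not_gt]; norm_num
  · rw [ord_lt hac, ord_lt (hac.trans hcd), ord_gt h1, ord_gt h2,
      bel_in hac h1, bel_in (hac.trans hcd) h2,
      bel_out hcd (Or.inl hac.le), bel_out hcd (Or.inr h2.le)]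
    have key := same_side hab hdis (left_mem_segment ℝ c d) (right_mem_segment ℝ c d)
      hac.le h1.le (hac.trans hcd).le h2.le
    rcases mul_pos_iff.1 key with ⟨h3, h4⟩ | ⟨h3, h4⟩
    · rw [if_neg h3.not_gt, if_neg h4.not_gt]; norm_num
    · rw [if_pos h3, if_pos h4]; norm_num

lemma quad_swap1 (a b c d : Pt) : quad α β a b c d = quad α β b a c d := by
  unfold quad
  rw [bel_symm a b c, bel_symm a b d]; ring

lemma quad_swap2 (a b c d : Pt) : quad α β a b c d = quad α β a b d c := by
  unfold quad
  rw [bel_symm c d a, bel_symm c d b]; ring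

lemma quad_swap3 {a b c d : Pt} (hac : ell α β a ≠ ell α β c) (had : ell α β a ≠ ell α β d)
    (hbc : ell α β b ≠ ell α β c) (hbd : ell α β b ≠ ell α β d) :
    quad α β a b c d = quad α β c d a b := by
  unfold quad
  rw [ord_skew hac, ord_skew had, ord_skew hbc, ord_skew hbd]; ring

lemma quad_one {a b c d : Pt} (hab : ell α β a ≠ ell α β b) (hcd : ell α β c ≠ ell α β d)
    (hac : ell α β a ≠ ell α β c) (had : ell α β a ≠ ell α β d)
    (hbc : ell α β b ≠ ell α β c) (hbd : ell α β b ≠ ell α β d)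
    (hdis : ∀ z, z ∈ segment ℝ a b → z ∉ segment ℝ c d) : quad α β a b c d = 1 := by
  wlog h1 : ell α β a < ell α β b generalizing a b
  · rw [quad_swap1]
    exact this hab.symm hbc hbd hac had (by rwa [segment_symm]) (lt_of_le_of_ne (not_lt.1 h1) hab.symm)
  wlog h2 : ell α β c < ell α β d generalizing c d
  · rw [quad_swap2]
    exact this hcd.symm had hac hbd hbc (by rwa [segment_symm ℝ d c])
      (lt_of_le_of_ne (not_lt.1 h2) hcd.symm)
  rcases lt_or_gt_of_ne hac with h3 | h3
  · exact quad_base h1 h2 h3 hbc hbd hdis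
  · rw [quad_swap3 hac had hbc hbd]
    exact quad_base h2 h1 h3 had.symm hbd.symm (fun z hz hz' => hdis z hz' hz)

end kast

lemma fpf_lt {n : ℕ} (i j : Fin n) (a b : Fin 2) :
    (finProdFinEquiv (i, a) < finProdFinEquiv (j, b)) ↔ (i < j ∨ (i = j ∧ a < b)) := by
  have ha := a.2
  have hb := b.2
  simp only [finProdFinEquiv, Equiv.coe_fn_mk, Fin.lt_def, Fin.ext_iff]
  omega

lemma sign_ord {n : ℕ} {α β : ℝ} (x : Fin n × Fin 2 → Pt)
    (hx : ∀ u v, finProdFinEquiv u < finProdFinEquiv v ↔ ell α β (x u) < ell α β (x v))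
    (σ : Equiv.Perm (Fin n × Fin 2)) :
    ((Equiv.Perm.sign σ : ℤ) : ℝ) = ∏ i : Fin n, ∏ j : Fin n, ∏ a : Fin 2, ∏ b : Fin 2,
      (if finProdFinEquiv (i, a) < finProdFinEquiv (j, b) then
        ordL α β (x (σ (i, a))) (x (σ (j, b))) else 1) := by
  rw [← Equiv.Perm.sign_permCongr finProdFinEquiv σ, Equiv.Perm.sign_eq_prod_prod_Ioi]
  push_cast
  have h1 : ∀ u : Fin (n * 2), (∏ v ∈ Finset.Ioi u,
      (((if (finProdFinEquiv.permCongr σ) u < (finProdFinEquiv.permCongr σ) v then 1 else -1 : ℤˣ) : ℤ) : ℝ))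
      = ∏ v, (if u < v then ordL α β (x (σ (finProdFinEquiv.symm u))) (x (σ (finProdFinEquiv.symm v))) else 1) := by
    intro u
    rw [← Finset.prod_filter]
    have : Finset.univ.filter (fun v => u < v) = Finset.Ioi u := by ext; simp
    rw [this]
    refine Finset.prod_congr rfl fun v _ => ?_
    unfold ordL
    have h' : (finProdFinEquiv.permCongr σ) u < (finProdFinEquiv.permCongr σ) v ↔
      ell α β (x (σ (finProdFinEquiv.symm u))) < ell α β (x (σ (finProdFinEquiv.symm v))) := hx _ _
    by_cases h : (finProdFinEquiv.permCongr σ) u < (finProdFinEquiv.permCongr σ) v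
    · rw [if_pos h, if_pos (h'.1 h)]; simp
    · rw [if_neg h, if_neg (fun h2 => h (h'.2 h2))]; simp
  rw [Finset.prod_congr rfl fun u _ => h1 u]
  rw [← Equiv.prod_comp finProdFinEquiv, Fintype.prod_prod_type]
  refine Finset.prod_congr rfl fun i _ => ?_
  rw [Finset.prod_comm (s := (Finset.univ : Finset (Fin n)))]
  refine Finset.prod_congr rfl fun a _ => ?_
  rw [← Equiv.prod_comp finProdFinEquiv, Fintype.prod_prod_type]
  simp

def kap {n : ℕ} (α β : ℝ) (x : Fin n × Fin 2 → Pt) (p q : Pt) : ℝ :=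
  ordL α β p q * ∏ k, bel α β p q (x k)

lemma kap_skew {n : ℕ} {α β : ℝ} {x : Fin n × Fin 2 → Pt} {p q : Pt} (h : ell α β p ≠ ell α β q) :
    kap α β x p q = - kap α β x q p := by
  unfold kap
  rw [ord_skew h]
  simp only [bel_symm p q]
  ring

lemma kap_sq {n : ℕ} {α β : ℝ} {x : Fin n × Fin 2 → Pt} {p q : Pt} : kap α β x p q ^ 2 = 1 := by
  have h1 : ∀ k, bel α β p q k ^ 2 = 1 := fun k => by unfold bel; split_ifs <;> norm_num
  have h2 : ordL α β p q ^ 2 = 1 := by unfold ordL; split_ifs <;> norm_num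
  unfold kap
  rw [mul_pow, h2, ← Finset.prod_pow, Finset.prod_eq_one fun k _ => h1 _, one_mul]

lemma sign_kap {n : ℕ} {α β : ℝ} (x : Fin n × Fin 2 → Pt)
    (hx : ∀ u v, finProdFinEquiv u < finProdFinEquiv v ↔ ell α β (x u) < ell α β (x v))
    (σ : Equiv.Perm (Fin n × Fin 2))
    (hdis : ∀ i j, i ≠ j → ∀ z, z ∈ segment ℝ (x (σ (i, 0))) (x (σ (i, 1))) →
      z ∉ segment ℝ (x (σ (j, 0))) (x (σ (j, 1)))) :
    ((Equiv.Perm.sign σ : ℤ) : ℝ) * ∏ i, kap α β x (x (σ (i, 0))) (x (σ (i, 1))) = 1 := by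
  have hinj : ∀ u v, u ≠ v → ell α β (x (σ u)) ≠ ell α β (x (σ v)) := by
    intro u v huv h
    have h1 := hx (σ u) (σ v)
    have h2 := hx (σ v) (σ u)
    rw [h] at h1 h2
    simp only [lt_irrefl, iff_false, not_lt] at h1 h2
    exact huv (σ.injective (finProdFinEquiv.injective (le_antisymm h2 h1)))
  set y : Fin n × Fin 2 → Pt := fun u => x (σ u) with hy
  have hk : ∀ i, kap α β x (y (i, 0)) (y (i, 1)) =
      ∏ j, ((bel α β (y (i, 0)) (y (i, 1)) (y (j, 0)) * bel α β (y (i, 0)) (y (i, 1)) (y (j, 1))) *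
        (if i = j then ordL α β (y (i, 0)) (y (i, 1)) else 1)) := by
    intro i
    unfold kap
    rw [Finset.prod_mul_distrib, Finset.prod_ite_eq, if_pos (Finset.mem_univ _),
      ← Equiv.prod_comp σ, Fintype.prod_prod_type]
    simp only [Fin.prod_univ_two]
    rw [mul_comm]
  rw [sign_ord x hx σ, Finset.prod_congr rfl fun i _ => hk i, ← Finset.prod_mul_distrib]
  simp only [← Finset.prod_mul_distrib]
  set G : Fin n → Fin n → ℝ := fun i j => (∏ a : Fin 2, ∏ b : Fin 2,
      (if finProdFinEquiv (i, a) < finProdFinEquiv (j, b) then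
        ordL α β (x (σ (i, a))) (x (σ (j, b))) else 1)) *
      ((bel α β (y (i, 0)) (y (i, 1)) (y (j, 0)) * bel α β (y (i, 0)) (y (i, 1)) (y (j, 1))) *
        (if i = j then ordL α β (y (i, 0)) (y (i, 1)) else 1)) with hG
  change ∏ i, ∏ j, G i j = 1
  have hdiag : ∀ i, G i i = 1 := by
    intro i
    simp only [hG, fpf_lt, Fin.prod_univ_two]
    have hne := hinj (i, 0) (i, 1) (by simp)
    have b1 : bel α β (y (i, 0)) (y (i, 1)) (y (i, 0)) = 1 := by
      simp only [hy]
      rcases lt_or_gt_of_ne hne with h | h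
      · exact bel_out h (Or.inl le_rfl)
      · rw [bel_symm]; exact bel_out h (Or.inr le_rfl)
    have b2 : bel α β (y (i, 0)) (y (i, 1)) (y (i, 1)) = 1 := by
      simp only [hy]
      rcases lt_or_gt_of_ne hne with h | h
      · exact bel_out h (Or.inr le_rfl)
      · rw [bel_symm]; exact bel_out h (Or.inl le_rfl)
    rw [b1, b2]
    have h2 : ordL α β (y (i, 0)) (y (i, 1)) * ordL α β (y (i, 0)) (y (i, 1)) = 1 := by
      unfold ordL; split_ifs <;> norm_num
    simpa using h2
  have hpair : ∀ i j, i < j → G j i * G i j = 1 := by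
    intro i j hij
    have hq : quad α β (y (i, 0)) (y (i, 1)) (y (j, 0)) (y (j, 1)) = 1 := by
      apply quad_one
      · exact hinj _ _ (by simp)
      · exact hinj _ _ (by simp)
      · exact hinj _ _ (by simp [hij.ne])
      · exact hinj _ _ (by simp)
      · exact hinj _ _ (by simp)
      · exact hinj _ _ (by simp [hij.ne])
      · exact hdis i j hij.ne
    simp only [hG, fpf_lt, Fin.prod_univ_two]
    simp only [hij, hij.ne, hij.ne', hij.not_gt, true_or, false_or, false_and, if_true, if_false]
    refine Eq.trans ?_ hq
    unfold quad
    simp only [hy]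
    ring
  have h1 : ∀ i, ∏ j, G i j = ∏ j ∈ ({i}ᶜ : Finset (Fin n)), G i j := by
    intro i
    rw [← Finset.prod_compl_mul_prod ({i} : Finset (Fin n)), Finset.prod_singleton, hdiag, mul_one]
  rw [Finset.prod_congr rfl fun i _ => h1 i,
    ← Finset.prod_prod_Ioi_mul_eq_prod_prod_off_diag (fun i j => G j i)]
  refine Finset.prod_eq_one fun i _ => Finset.prod_eq_one fun j hj => ?_
  have := hpair i j (by simpa using hj)
  rw [mul_comm]; exact this

def mat {S : Finset Pt} {n : ℕ} (y : Fin n × Fin 2 ≃ {p : Pt // p ∈ S}) : Finset (Sym2 Pt) :=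
  Finset.univ.image (fun i : Fin n => s((y (i, 0) : Pt), (y (i, 1) : Pt)))

lemma mat_inj {S : Finset Pt} {n : ℕ} (y : Fin n × Fin 2 ≃ {p : Pt // p ∈ S}) {i j : Fin n} {z : Pt}
    (h1 : z ∈ s((y (i, 0) : Pt), (y (i, 1) : Pt))) (h2 : z ∈ s((y (j, 0) : Pt), (y (j, 1) : Pt))) :
    i = j := by
  rw [Sym2.mem_iff] at h1 h2
  rcases h1 with h1 | h1 <;> rcases h2 with h2 | h2 <;>
  · rw [h1] at h2
    have := y.injective (Subtype.ext h2)
    simpa using this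

lemma mat_injective {S : Finset Pt} {n : ℕ} (y : Fin n × Fin 2 ≃ {p : Pt // p ∈ S}) :
    Function.Injective (fun i : Fin n => s((y (i, 0) : Pt), (y (i, 1) : Pt))) := by
  intro i j h
  simp only at h
  refine mat_inj y (z := y (i, 0)) (by simp) ?_
  rw [← h]; simp

lemma mat_card {S : Finset Pt} {n : ℕ} (y : Fin n × Fin 2 ≃ {p : Pt // p ∈ S}) :
    (mat y).card = n := by
  unfold mat
  rw [Finset.card_image_of_injective _ (mat_injective y)]; simp

lemma mat_cover {S : Finset Pt} {n : ℕ} (y : Fin n × Fin 2 ≃ {p : Pt // p ∈ S}) (p : Pt) (hp : p ∈ S) :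
    ∃ e ∈ mat y, p ∈ e := by
  obtain ⟨⟨i, a⟩, h⟩ := y.surjective ⟨p, hp⟩
  refine ⟨_, Finset.mem_image_of_mem _ (Finset.mem_univ i), ?_⟩
  have : p = (y (i, a) : Pt) := by rw [h]
  rw [this]
  fin_cases a <;> simp

lemma mat_unique {S : Finset Pt} {n : ℕ} (y : Fin n × Fin 2 ≃ {p : Pt // p ∈ S}) {p : Pt} {e e' : Sym2 Pt}
    (he : e ∈ mat y) (he' : e' ∈ mat y) (hp : p ∈ e) (hp' : p ∈ e') : e = e' := by
  simp only [mat, Finset.mem_image, Finset.mem_univ, true_and] at he he'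
  obtain ⟨i, rfl⟩ := he
  obtain ⟨j, rfl⟩ := he'
  rw [mat_inj y hp hp']

def shear {n : ℕ} (z : Equiv.Perm (Fin n) × (Fin n → Equiv.Perm (Fin 2))) : Equiv.Perm (Fin n × Fin 2) :=
  Equiv.prodShear z.1 z.2

lemma shear_inj {n : ℕ} : Function.Injective (shear (n := n)) := by
  rintro ⟨π, ε⟩ ⟨π', ε'⟩ h
  have h1 : ∀ i a, (π i, ε i a) = (π' i, ε' i a) := fun i a => congrArg (fun e => e (i, a)) h
  have h2 : π = π' := Equiv.ext fun i => (Prod.mk.inj (h1 i 0)).1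
  have h3 : ε = ε' := funext fun i => Equiv.ext fun a => (Prod.mk.inj (h1 i a)).2
  rw [h2, h3]

lemma perm2 (e : Equiv.Perm (Fin 2)) : (e 0 = 0 ∧ e 1 = 1) ∨ (e 0 = 1 ∧ e 1 = 0) := by
  revert e; decide

lemma mat_shear {S : Finset Pt} {n : ℕ} (y : Fin n × Fin 2 ≃ {p : Pt // p ∈ S})
    (z : Equiv.Perm (Fin n) × (Fin n → Equiv.Perm (Fin 2))) : mat ((shear z).trans y) = mat y := by
  obtain ⟨π, ε⟩ := z
  have h : ∀ i, s((((shear (π, ε)).trans y) (i, 0) : Pt), (((shear (π, ε)).trans y) (i, 1) : Pt)) =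
      s((y (π i, 0) : Pt), (y (π i, 1) : Pt)) := by
    intro i
    have h0 : ∀ a, ((shear (π, ε)).trans y) (i, a) = y (π i, ε i a) := fun a => rfl
    rw [h0, h0]
    rcases perm2 (ε i) with ⟨h1, h2⟩ | ⟨h1, h2⟩
    · rw [h1, h2]
    · rw [h1, h2, Sym2.eq_swap]
  ext e
  simp only [mat, Finset.mem_image, Finset.mem_univ, true_and, h]
  constructor
  · rintro ⟨i, rfl⟩; exact ⟨π i, rfl⟩
  · rintro ⟨i, rfl⟩; exact ⟨π.symm i, by simp⟩

lemma fiber_card {S : Finset Pt} {n : ℕ} (x y : Fin n × Fin 2 ≃ {p : Pt // p ∈ S}) :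
    2 ^ n * n.factorial ≤ (Finset.univ.filter
      (fun σ : Equiv.Perm (Fin n × Fin 2) => mat (σ.trans x) = mat y)).card := by
  have h1 : (Finset.univ : Finset (Equiv.Perm (Fin n) × (Fin n → Equiv.Perm (Fin 2)))).card =
      2 ^ n * n.factorial := by
    rw [Finset.card_univ, Fintype.card_prod, Fintype.card_perm, Fintype.card_fun, Fintype.card_perm]
    simp [mul_comm]
  rw [← h1]
  apply Finset.card_le_card_of_injOn (fun z => (shear z).trans (y.trans x.symm))
  · intro z _
    simp only [Finset.coe_filter, Finset.mem_univ, true_and, Set.mem_ofPred_eq]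
    rw [← mat_shear y z]
    congr 1
    refine Equiv.ext fun u => ?_
    simp
  · intro z _ z' _ h
    apply shear_inj
    ext1 u
    have := congrArg (fun e => e u) h
    simpa using this

lemma exists_enum {S : Finset Pt} {n : ℕ} (hn : S.card = 2 * n) :
    ∃ (c : ℝ) (x : Fin n × Fin 2 ≃ {p : Pt // p ∈ S}),
      ∀ u v, finProdFinEquiv u < finProdFinEquiv v ↔ ell 1 c (x u : Pt) < ell 1 c (x v : Pt) := by
  obtain ⟨c, hc⟩ := exists_ell S
  have hcard : (S.image (ell 1 c)).card = n * 2 := by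
    rw [Finset.card_image_of_injOn (fun p hp q hq h => hc p hp q hq h), hn, mul_comm]
  let e := (S.image (ell 1 c)).orderIsoOfFin hcard
  have hbij : Function.Bijective (fun p : {p : Pt // p ∈ S} =>
      (⟨ell 1 c p, Finset.mem_image_of_mem _ p.2⟩ : {r : ℝ // r ∈ S.image (ell 1 c)})) := by
    constructor
    · intro p q h
      exact Subtype.ext (hc p p.2 q q.2 (congrArg Subtype.val h))
    · rintro ⟨r, hr⟩
      obtain ⟨p, hp, rfl⟩ := Finset.mem_image.1 hr
      exact ⟨⟨p, hp⟩, rfl⟩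
  let q := Equiv.ofBijective _ hbij
  refine ⟨c, finProdFinEquiv.trans (e.toEquiv.trans q.symm), fun u v => ?_⟩
  have h : ∀ u, ell 1 c ((finProdFinEquiv.trans (e.toEquiv.trans q.symm)) u : Pt) = (e (finProdFinEquiv u)).1 := by
    intro u
    have : q (q.symm (e (finProdFinEquiv u))) = e (finProdFinEquiv u) := q.apply_symm_apply _
    exact congrArg Subtype.val this
  rw [h, h]
  exact (e.lt_iff_lt).symm

def PMs {S : Finset Pt} (T : PlaneGraph S) (n : ℕ) : Finset (Finset (Sym2 Pt)) :=
  T.edges.powerset.filter (fun M => ∃ y : Fin n × Fin 2 ≃ {p : Pt // p ∈ S}, M = mat y)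

lemma row_sum {S : Finset Pt} (T : PlaneGraph S) {n : ℕ} (x : Fin n × Fin 2 ≃ {p : Pt // p ∈ S})
    (g : Sym2 Pt → ℝ) (p : Pt) :
    ∑ b, (if s(p, (x b : Pt)) ∈ T.edges then g s(p, (x b : Pt)) else 0) =
      ∑ e ∈ T.edges.filter (fun e => p ∈ e), g e := by
  rw [← Finset.sum_filter]
  refine Finset.sum_bij (fun b _ => s(p, (x b : Pt))) ?_ ?_ ?_ ?_
  · intro b hb
    simp only [Finset.mem_filter, Finset.mem_univ, true_and] at hb ⊢
    exact ⟨hb, by simp⟩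
  · intro b _ b' _ h
    rw [Sym2.congr_right] at h
    exact x.injective (Subtype.ext h)
  · intro e he
    simp only [Finset.mem_filter] at he
    obtain ⟨he, hp⟩ := he
    obtain ⟨q, rfl⟩ := hp
    have hq : q ∈ S := T.endpoint_mem _ he q (by simp)
    refine ⟨x.symm ⟨q, hq⟩, ?_, ?_⟩ <;> simp [he]
  · intro b _; rfl

lemma KH {S : Finset Pt} (T : PlaneGraph S) {n : ℕ} (hn : S.card = 2 * n)
    (w : Sym2 Pt → ℝ) (hw : ∀ e, 0 ≤ w e) :
    ∑ M ∈ PMs T n, ∏ e ∈ M, w e ≤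
      ∏ p ∈ S, (∑ e ∈ T.edges.filter (fun e => p ∈ e), w e ^ 2) ^ (1 / 4 : ℝ) := by
  obtain ⟨c, x, hx⟩ := exists_enum hn
  let X : Fin n × Fin 2 → Pt := fun u => x u
  have hinj : ∀ u v, u ≠ v → ell 1 c (x u : Pt) ≠ ell 1 c (x v : Pt) := by
    intro u v huv h
    have h1 := hx u v
    have h2 := hx v u
    rw [h] at h1 h2
    simp only [lt_irrefl, iff_false, not_lt] at h1 h2
    exact huv (finProdFinEquiv.injective (le_antisymm h2 h1))
  let K : Fin n × Fin 2 → Fin n × Fin 2 → ℝ := fun a b =>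
    if s((x a : Pt), (x b : Pt)) ∈ T.edges then kap 1 c X (x a) (x b) * w s((x a : Pt), (x b : Pt)) else 0
  have hskew : ∀ a b, K a b = - K b a := by
    intro a b
    by_cases hab : a = b
    · subst hab
      have : s((x a : Pt), (x a : Pt)) ∉ T.edges := fun h => T.not_isDiag _ h (by simp)
      simp [K, this]
    · simp only [K]
      rw [Sym2.eq_swap, kap_skew (hinj a b hab)]
      split_ifs <;> simp
  have hb := pfs_bound n K hskew
  have hrow : ∏ a, (∑ b, K a b ^ 2) ^ (1 / 4 : ℝ) =
      ∏ p ∈ S, (∑ e ∈ T.edges.filter (fun e => p ∈ e), w e ^ 2) ^ (1 / 4 : ℝ) := by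
    rw [← Finset.prod_attach S, ← Finset.univ_eq_attach, ← Equiv.prod_comp x]
    refine Finset.prod_congr rfl fun a _ => ?_
    congr 1
    rw [← row_sum T x (fun e => w e ^ 2) (x a)]
    refine Finset.sum_congr rfl fun b _ => ?_
    simp only [K]
    split_ifs
    · rw [mul_pow, kap_sq, one_mul]
    · simp
  rw [hrow] at hb
  let g : Finset (Sym2 Pt) → ℝ := fun M => if M ⊆ T.edges then ∏ e ∈ M, w e else 0
  have hg : ∀ M, 0 ≤ g M := by
    intro M
    simp only [g]
    split_ifs
    · exact Finset.prod_nonneg fun e _ => hw e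
    · exact le_rfl
  have hp : pfs n K = ∑ σ : Equiv.Perm (Fin n × Fin 2), g (mat (σ.trans x)) := by
    unfold pfs
    refine Finset.sum_congr rfl fun σ _ => ?_
    simp only [g]
    split_ifs with hM
    · have hmem : ∀ i, s((x (σ (i, 0)) : Pt), (x (σ (i, 1)) : Pt)) ∈ T.edges := fun i =>
        hM (Finset.mem_image_of_mem _ (Finset.mem_univ i))
      have h1 : ∏ i, K (σ (i, 0)) (σ (i, 1)) = (∏ i, kap 1 c X (X (σ (i, 0))) (X (σ (i, 1)))) *
          ∏ i, w s((x (σ (i, 0)) : Pt), (x (σ (i, 1)) : Pt)) := by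
        rw [← Finset.prod_mul_distrib]
        refine Finset.prod_congr rfl fun i _ => ?_
        simp only [K]
        rw [if_pos (hmem i)]
      have h2 := sign_kap (α := 1) (β := c) X hx σ (by
        intro i j hij z hz hz'
        have hne : s((x (σ (i, 0)) : Pt), (x (σ (i, 1)) : Pt)) ≠ s((x (σ (j, 0)) : Pt), (x (σ (j, 1)) : Pt)) :=
          fun h => hij (mat_injective (σ.trans x) h)
        have := T.noncrossing _ (hmem i) _ (hmem j) hne z ⟨hz, hz'⟩
        exact hij (mat_inj (σ.trans x) this.1 this.2))
      rw [h1, ← mul_assoc, h2, one_mul]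
      unfold mat
      rw [Finset.prod_image (fun i _ j _ h => mat_injective (σ.trans x) h)]
      rfl
    · obtain ⟨e, he, heT⟩ := Finset.not_subset.1 hM
      simp only [mat, Finset.mem_image, Finset.mem_univ, true_and] at he
      obtain ⟨i, rfl⟩ := he
      rw [Finset.prod_eq_zero (Finset.mem_univ i), mul_zero]
      simp only [K]
      exact if_neg heT
  have hlow : (2 ^ n * n.factorial : ℝ) * ∑ M ∈ PMs T n, ∏ e ∈ M, w e ≤ pfs n K := by
    rw [hp, Finset.mul_sum]
    calc ∑ M ∈ PMs T n, (2 ^ n * n.factorial : ℝ) * ∏ e ∈ M, w e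
        ≤ ∑ M ∈ PMs T n, ∑ σ ∈ Finset.univ.filter
            (fun σ : Equiv.Perm (Fin n × Fin 2) => mat (σ.trans x) = M), g (mat (σ.trans x)) := by
          refine Finset.sum_le_sum fun M hM => ?_
          simp only [PMs, Finset.mem_filter, Finset.mem_powerset] at hM
          obtain ⟨hMT, y, rfl⟩ := hM
          have : ∑ σ ∈ Finset.univ.filter
            (fun σ : Equiv.Perm (Fin n × Fin 2) => mat (σ.trans x) = mat y), g (mat (σ.trans x)) =
            ∑ σ ∈ Finset.univ.filter
            (fun σ : Equiv.Perm (Fin n × Fin 2) => mat (σ.trans x) = mat y), ∏ e ∈ mat y, w e := by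
            refine Finset.sum_congr rfl fun σ hσ => ?_
            rw [(Finset.mem_filter.1 hσ).2]
            simp only [g]
            rw [if_pos hMT]
          rw [this, Finset.sum_const, nsmul_eq_mul]
          refine mul_le_mul_of_nonneg_right ?_ (Finset.prod_nonneg fun e _ => hw e)
          exact_mod_cast fiber_card x y
      _ ≤ _ := by
          rw [← Finset.sum_biUnion]
          · exact Finset.sum_le_sum_of_subset_of_nonneg (Finset.subset_univ _) fun _ _ _ => hg _
          · intro M _ M' _ hne
            simp only [Function.onFun]
            rw [Finset.disjoint_left]
            intro σ h1 h2
            exact hne ((Finset.mem_filter.1 h1).2.symm.trans (Finset.mem_filter.1 h2).2)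
  have hpos : (0 : ℝ) < 2 ^ n * n.factorial := by positivity
  have := hlow.trans ((le_abs_self _).trans hb)
  exact le_of_mul_le_mul_left this hpos

lemma finRotate_val {N : ℕ} (k : Fin N) : ((finRotate N k : Fin N) : ℕ) = if (k : ℕ) + 1 = N then 0 else (k : ℕ) + 1 := by
  rcases N with _ | m
  · exact k.elim0
  rw [coe_finRotate]
  simp [Fin.ext_iff]

lemma cyc_decomp {S : Finset Pt} {T C : PlaneGraph S} {n : ℕ} (hn : S.card = 2 * n)
    (hC : IsSpanningCycle C) (hCT : C.edges ⊆ T.edges) :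
    ∃ M1 ∈ PMs T n, ∃ M2 ∈ PMs T n, C.edges = M1 ∪ M2 ∧ Disjoint M1 M2 := by
  obtain ⟨h3, f, hf⟩ := hC
  have hN : n * 2 = S.card := by omega
  let k : Fin n × Fin 2 ≃ Fin S.card := finProdFinEquiv.trans (finCongr hN)
  have kv : ∀ i a, (k (i, a) : ℕ) = a + 2 * i := fun i a => rfl
  have k0 : ∀ i, ((k (i, 0) : Fin S.card) : ℕ) = 2 * i := fun i => by rw [kv]; simp
  have k1 : ∀ i, ((k (i, 1) : Fin S.card) : ℕ) = 1 + 2 * i := fun i => by rw [kv]; simp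
  have hrot : ∀ i, finRotate S.card (k (i, 0)) = k (i, 1) := by
    intro i
    apply Fin.ext
    rw [finRotate_val, k0, k1, if_neg (by omega)]
    omega
  let y1 : Fin n × Fin 2 ≃ {p : Pt // p ∈ S} := k.trans f
  let y2 : Fin n × Fin 2 ≃ {p : Pt // p ∈ S} := k.trans ((finRotate S.card).trans f)
  have hU : C.edges = mat y1 ∪ mat y2 := by
    ext e
    rw [hf]
    simp only [mat, Finset.mem_union, Finset.mem_image, Finset.mem_univ, true_and]
    constructor
    · rintro ⟨j, rfl⟩
      obtain ⟨⟨i, a⟩, rfl⟩ := k.surjective j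
      fin_cases a
      · left; refine ⟨i, ?_⟩
        simp only [y1, Equiv.trans_apply, Fin.zero_eta, hrot]
      · right; refine ⟨i, ?_⟩
        simp only [y2, Equiv.trans_apply, Fin.mk_one, hrot]
    · rintro (⟨i, rfl⟩ | ⟨i, rfl⟩)
      · refine ⟨k (i, 0), ?_⟩
        simp only [y1, Equiv.trans_apply, hrot]
      · refine ⟨k (i, 1), ?_⟩
        simp only [y2, Equiv.trans_apply, hrot]
  have hD : Disjoint (mat y1) (mat y2) := by
    rw [Finset.disjoint_left]
    intro e h1 h2
    simp only [mat, Finset.mem_image, Finset.mem_univ, true_and] at h1 h2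
    obtain ⟨i, rfl⟩ := h1
    obtain ⟨j, hj⟩ := h2
    simp only [y1, y2, Equiv.trans_apply, hrot] at hj
    rw [Sym2.eq_iff] at hj
    rcases hj with ⟨h1, h2⟩ | ⟨h1, h2⟩
    · have := congrArg Fin.val (f.injective (Subtype.ext h1))
      rw [k0, k1] at this; omega
    · have e1 := congrArg Fin.val (f.injective (Subtype.ext h1))
      have e2 := congrArg Fin.val (f.injective (Subtype.ext h2))
      rw [k1, k1] at e1
      rw [finRotate_val, k1, k0] at e2
      split_ifs at e2 <;> omega
  refine ⟨mat y1, ?_, mat y2, ?_, hU, hD⟩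
  · exact Finset.mem_filter.2 ⟨Finset.mem_powerset.2
      (fun e he => hCT (by rw [hU]; exact Finset.mem_union_left _ he)), y1, rfl⟩
  · exact Finset.mem_filter.2 ⟨Finset.mem_powerset.2
      (fun e he => hCT (by rw [hU]; exact Finset.mem_union_right _ he)), y2, rfl⟩

def wt (M F : Finset (Sym2 Pt)) (e : Sym2 Pt) : ℝ := if e ∈ M then 0 else if e ∈ F then 2 else 1

lemma wt_nonneg (M F : Finset (Sym2 Pt)) (e : Sym2 Pt) : 0 ≤ wt M F e := by
  unfold wt; split_ifs <;> norm_num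

lemma wt_prod {M F M2 : Finset (Sym2 Pt)} (h : Disjoint M M2) :
    ∏ e ∈ M2, wt M F e = 2 ^ (F ∩ M2).card := by
  have : ∀ e ∈ M2, wt M F e = if e ∈ F then 2 else 1 := by
    intro e he
    unfold wt
    rw [if_neg (fun h' => Finset.disjoint_left.1 h h' he)]
  rw [Finset.prod_congr rfl this, Finset.prod_ite, Finset.prod_const, Finset.prod_const_one, mul_one,
    Finset.inter_comm, Finset.filter_mem_eq_inter]

lemma one_div_supp {S : Finset Pt} (hS : GenPos S) {T : PlaneGraph S} (hT : IsTriangulation T)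
    {A B D : Pt} (hH : Hull S A B D) {n : ℕ} (hn3 : 3 ≤ n)
    {C : PlaneGraph S} (hCT : C.edges ⊆ T.edges) {M1 M2 F : Finset (Sym2 Pt)}
    (hU : C.edges = M1 ∪ M2) (hD : Disjoint M1 M2) (hF : F ⊆ T.edges) (hFc : F.card = n - 3)
    (hFM : Disjoint F M1) (hG : Good S A B D (T.edges \ F)) :
    (1 : ℝ) / (supp C : ℝ) ≤ 8 / 2 ^ n * ∏ e ∈ M2, wt M1 F e := by
  have h1 := supp_cycle hS hT hH hF hG C hCT
  have h2 : F \ C.edges = F \ M2 := by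
    ext e
    simp only [hU, Finset.mem_sdiff, Finset.mem_union]
    constructor
    · rintro ⟨h1, h2⟩; exact ⟨h1, fun h => h2 (Or.inr h)⟩
    · rintro ⟨h1, h2⟩
      refine ⟨h1, ?_⟩
      rintro (h | h)
      · exact Finset.disjoint_left.1 hFM h1 h
      · exact h2 h
  have h3 := Finset.card_sdiff_add_card_inter F M2
  rw [h2] at h1
  rw [wt_prod hD]
  have h4 : (2 : ℝ) ^ (F \ M2).card ≤ supp C := by exact_mod_cast h1
  have h5 : (0 : ℝ) < 2 ^ (F \ M2).card := by positivity
  calc (1 : ℝ) / supp C ≤ 1 / 2 ^ (F \ M2).card := one_div_le_one_div_of_le h5 h4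
    _ = 8 / 2 ^ n * 2 ^ (F ∩ M2).card := by
      have : (2 : ℝ) ^ n = 8 * (2 ^ (F \ M2).card * 2 ^ (F ∩ M2).card) := by
        have e : n = 3 + ((F \ M2).card + (F ∩ M2).card) := by omega
        conv_lhs => rw [e]
        rw [pow_add, pow_add]; norm_num
      rw [this]
      field_simp

lemma sum_le {S : Finset Pt} (hS : GenPos S) {T : PlaneGraph S} (hT : IsTriangulation T)
    {A B D : Pt} (hH : Hull S A B D) {n : ℕ} (hn3 : 3 ≤ n) (hn : S.card = 2 * n) (R : ℝ)
    (hR : ∀ M1 ∈ PMs T n, ∀ F, F ⊆ T.edges → F.card = n - 3 → Disjoint F M1 →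
      (∀ p, Inn S A B D p → degree T p = 3 → ∀ e ∈ F, p ∉ e) →
      ∑ M2 ∈ PMs T n, ∏ e ∈ M2, wt M1 F e ≤ R) :
    (∑ᶠ C : {C : PlaneGraph S // IsSpanningCycle C ∧ C.edges ⊆ T.edges},
        (1 : ℝ) / (supp C.1 : ℝ)) ≤ 8 / 2 ^ n * ((PMs T n).card * R) := by
  have hex : ∀ M1, ∃ F, M1 ∈ PMs T n → (F ⊆ T.edges ∧ F.card = n - 3 ∧ Disjoint F M1 ∧
      Good S A B D (T.edges \ F) ∧ ∀ p, Inn S A B D p → degree T p = 3 → ∀ e ∈ F, p ∉ e) := by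
    intro M1
    by_cases hM : M1 ∈ PMs T n
    · have hM' := hM
      simp only [PMs, Finset.mem_filter, Finset.mem_powerset] at hM'
      obtain ⟨hMT, y, rfl⟩ := hM'
      obtain ⟨F, h1, h2, h3, h4, h5⟩ := exists_F hS hT hH hn hMT (mat_card y).le (mat_cover y)
      exact ⟨F, fun _ => ⟨h1, h2, h3, h4, h5⟩⟩
    · exact ⟨∅, fun h => absurd h hM⟩
  choose F hF using hex
  have hdec : ∀ C : {C : PlaneGraph S // IsSpanningCycle C ∧ C.edges ⊆ T.edges},
      ∃ z : Finset (Sym2 Pt) × Finset (Sym2 Pt), z ∈ PMs T n ×ˢ PMs T n ∧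
        C.1.edges = z.1 ∪ z.2 ∧ Disjoint z.1 z.2 := by
    rintro ⟨C, h1, h2⟩
    obtain ⟨M1, hM1, M2, hM2, h3, h4⟩ := cyc_decomp hn h1 h2
    exact ⟨(M1, M2), Finset.mem_product.2 ⟨hM1, hM2⟩, h3, h4⟩
  choose d hd using hdec
  have hdinj : Function.Injective d := by
    intro C C' h
    apply Subtype.ext
    apply pg_ext
    rw [(hd C).2.1, (hd C').2.1, h]
  have := Fintype.ofFinite {C : PlaneGraph S // IsSpanningCycle C ∧ C.edges ⊆ T.edges}
  rw [finsum_eq_sum_of_fintype]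
  let h : Finset (Sym2 Pt) × Finset (Sym2 Pt) → ℝ := fun z => 8 / 2 ^ n * ∏ e ∈ z.2, wt z.1 (F z.1) e
  have hh : ∀ z, 0 ≤ h z := fun z =>
    mul_nonneg (by positivity) (Finset.prod_nonneg fun e _ => wt_nonneg _ _ _)
  calc ∑ C : {C : PlaneGraph S // IsSpanningCycle C ∧ C.edges ⊆ T.edges}, (1 : ℝ) / (supp C.1 : ℝ)
      ≤ ∑ C, h (d C) := by
        refine Finset.sum_le_sum fun C _ => ?_
        obtain ⟨h1, h2, h3⟩ := hd C
        obtain ⟨g1, g2, g3, g4, g5⟩ := hF (d C).1 (Finset.mem_product.1 h1).1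
        exact one_div_supp hS hT hH hn3 C.2.2 h2 h3 g1 g2 g3 g4
    _ = ∑ z ∈ Finset.univ.image d, h z := by
        rw [Finset.sum_image (fun _ _ _ _ hab => hdinj hab)]
    _ ≤ ∑ z ∈ PMs T n ×ˢ PMs T n, h z := by
        refine Finset.sum_le_sum_of_subset_of_nonneg ?_ fun _ _ _ => hh _
        intro z hz
        obtain ⟨C, _, rfl⟩ := Finset.mem_image.1 hz
        exact (hd C).1
    _ = ∑ M1 ∈ PMs T n, 8 / 2 ^ n * ∑ M2 ∈ PMs T n, ∏ e ∈ M2, wt M1 (F M1) e := by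
        rw [Finset.sum_product]
        refine Finset.sum_congr rfl fun M1 _ => ?_
        rw [Finset.mul_sum]
    _ ≤ ∑ M1 ∈ PMs T n, 8 / 2 ^ n * R := by
        refine Finset.sum_le_sum fun M1 hM1 => mul_le_mul_of_nonneg_left ?_ (by positivity)
        obtain ⟨g1, g2, g3, g4, g5⟩ := hF M1 hM1
        exact hR M1 hM1 _ g1 g2 g3 g5
    _ = _ := by
        rw [Finset.sum_const, nsmul_eq_mul]; ring

lemma handshake {S : Finset Pt} (T : PlaneGraph S) (g : Sym2 Pt → ℝ) :
    ∑ p ∈ S, ∑ e ∈ T.edges.filter (fun e => p ∈ e), g e = 2 * ∑ e ∈ T.edges, g e := by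
  simp only [Finset.sum_filter]
  rw [Finset.sum_comm, Finset.mul_sum]
  refine Finset.sum_congr rfl fun e he => ?_
  rw [← Finset.sum_filter, Finset.sum_const, nsmul_eq_mul]
  congr 1
  induction e using Sym2.ind with
  | _ a b =>
    have hab : a ≠ b := padj_ne he
    have : S.filter (fun p => p ∈ s(a, b)) = {a, b} := by
      ext p
      simp only [Finset.mem_filter, Sym2.mem_iff, Finset.mem_insert, Finset.mem_singleton]
      constructor
      · exact fun h => h.2
      · intro h
        refine ⟨?_, h⟩
        rcases h with rfl | rfl
        · exact padj_left he
        · exact padj_right he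
    rw [this, Finset.card_pair hab]; norm_num

lemma amgm4 {U : Finset Pt} (hU : U.Nonempty) (r : Pt → ℝ) (hr : ∀ p ∈ U, 0 ≤ r p) :
    ∏ p ∈ U, r p ^ (1 / 4 : ℝ) ≤ ((∑ p ∈ U, r p) / U.card) ^ ((U.card : ℝ) / 4) := by
  have hu : (0 : ℝ) < U.card := by exact_mod_cast hU.card_pos
  have hsum : ∑ p ∈ U, (1 / 4 : ℝ) = U.card / 4 := by
    rw [Finset.sum_const, nsmul_eq_mul]; ring
  have h := Real.geom_mean_le_arith_mean U (fun _ => (1 / 4 : ℝ)) r (fun _ _ => by norm_num)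
    (by rw [hsum]; positivity) hr
  rw [hsum, ← Finset.mul_sum] at h
  have e : 1 / 4 * (∑ p ∈ U, r p) / ((U.card : ℝ) / 4) = (∑ p ∈ U, r p) / U.card := by
    field_simp
  rw [e] at h
  have hP : 0 ≤ ∏ p ∈ U, r p ^ (1 / 4 : ℝ) :=
    Finset.prod_nonneg fun p hp => Real.rpow_nonneg (hr p hp) _
  have h2 := Real.rpow_le_rpow (Real.rpow_nonneg hP _) h (z := (U.card : ℝ) / 4) (by positivity)
  rwa [← Real.rpow_mul hP, inv_mul_cancel₀ (by positivity), Real.rpow_one] at h2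

lemma amgm_split {S V : Finset Pt} (hV : V ⊆ S) (hne : V.card < S.card) (r : Pt → ℝ)
    (hr : ∀ p ∈ S, 0 ≤ r p) (v R : ℝ) (hv : 0 ≤ v) (hVr : ∀ p ∈ V, r p = v) (hR : ∑ p ∈ S, r p = R) :
    ∏ p ∈ S, r p ^ (1 / 4 : ℝ) ≤ v ^ ((V.card : ℝ) / 4) *
      ((R - V.card * v) / (S.card - V.card)) ^ (((S.card : ℝ) - V.card) / 4) := by
  rw [← Finset.prod_sdiff hV, mul_comm]
  have hc : (((S \ V).card : ℕ) : ℝ) = S.card - V.card := by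
    rw [Finset.card_sdiff_of_subset hV, Nat.cast_sub hne.le]
  have hU : (S \ V).Nonempty := by
    rw [← Finset.card_pos, Finset.card_sdiff_of_subset hV]; omega
  have h1 : ∏ p ∈ V, r p ^ (1 / 4 : ℝ) = v ^ ((V.card : ℝ) / 4) := by
    rw [Finset.prod_congr rfl fun p hp => by rw [hVr p hp], Finset.prod_const, ← Real.rpow_natCast,
      ← Real.rpow_mul hv]
    congr 1; ring
  have h2 : ∑ p ∈ S \ V, r p = R - V.card * v := by
    rw [← hR, ← Finset.sum_sdiff hV, Finset.sum_congr rfl hVr, Finset.sum_const, nsmul_eq_mul]; ring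
  have h3 := amgm4 hU r (fun p hp => hr p (Finset.mem_sdiff.1 hp).1)
  rw [h2, hc] at h3
  rw [h1]
  exact mul_le_mul_of_nonneg_left h3 (Real.rpow_nonneg hv _)

lemma numer {N t : ℝ} (hN : 6 ≤ N) (ht0 : 0 ≤ t) (ht1 : t < 1) :
    8 / (2 : ℝ) ^ (N / 2) * ((3 ^ (t * N / 4) * ((2 * (3 * N - 6) - t * N * 3) / (N - t * N)) ^ ((N - t * N) / 4)) *
      (2 ^ (t * N / 4) * (((8 * N - 30) - t * N * 2) / (N - t * N)) ^ ((N - t * N) / 4))) <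
      8 * ((3 / (2 : ℝ) ^ t) *
        (((2 - t) * (2 - t / 2)) / (1 - t) ^ 2) ^ (1 - t)) ^ (N / 4) := by
  have h1t : 0 < 1 - t := by linarith
  have hNpos : 0 < N := by linarith
  have hu : 0 < N - t * N := by nlinarith
  have ha : 0 < (N - t * N) / 4 := by linarith
  set a := (N - t * N) / 4 with ha'
  have hX : 0 < (2 * (3 * N - 6) - t * N * 3) / (N - t * N) := div_pos (by nlinarith) hu
  have hY : 0 < ((8 * N - 30) - t * N * 2) / (N - t * N) := div_pos (by nlinarith) hu
  have hX' : (2 * (3 * N - 6) - t * N * 3) / (N - t * N) < 3 * (2 - t) / (1 - t) := by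
    rw [div_lt_div_iff₀ hu h1t]; nlinarith
  have hY' : ((8 * N - 30) - t * N * 2) / (N - t * N) < 4 * (2 - t / 2) / (1 - t) := by
    rw [div_lt_div_iff₀ hu h1t]; nlinarith
  have e1 := Real.rpow_lt_rpow hX.le hX' ha
  have e2 := Real.rpow_lt_rpow hY.le hY' ha
  have p1 := Real.rpow_pos_of_pos hX a
  have p2 := Real.rpow_pos_of_pos hY a
  have h2t : 0 < 2 - t := by linarith
  have h2t' : 0 < 2 - t / 2 := by linarith
  have key : 8 / (2 : ℝ) ^ (N / 2) * ((3 ^ (t * N / 4) * (3 * (2 - t) / (1 - t)) ^ a) *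
      (2 ^ (t * N / 4) * (4 * (2 - t / 2) / (1 - t)) ^ a)) =
      8 * ((3 / (2 : ℝ) ^ t) *
        (((2 - t) * (2 - t / 2)) / (1 - t) ^ 2) ^ (1 - t)) ^ (N / 4) := by
    have q1 : (3 * (2 - t) / (1 - t)) ^ a * (4 * (2 - t / 2) / (1 - t)) ^ a =
        3 ^ a * (4 ^ a * (((2 - t) * (2 - t / 2)) / (1 - t) ^ 2) ^ a) := by
      rw [← Real.mul_rpow (by positivity) (by positivity),
        ← Real.mul_rpow (by norm_num) (by positivity), ← Real.mul_rpow (by norm_num) (by positivity)]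
      congr 1
      field_simp
    have q2 : ((3 / (2 : ℝ) ^ t) *
        (((2 - t) * (2 - t / 2)) / (1 - t) ^ 2) ^ (1 - t)) ^ (N / 4) =
        3 ^ (N / 4) / 2 ^ (t * N / 4) * (((2 - t) * (2 - t / 2)) / (1 - t) ^ 2) ^ a := by
      rw [Real.mul_rpow (by positivity) (by positivity), Real.div_rpow (by norm_num) (by positivity),
        ← Real.rpow_mul (by norm_num), ← Real.rpow_mul (by positivity)]
      congr 2
      · congr 1; ring
      · rw [ha']; ring
    have q3 : (3 : ℝ) ^ (N / 4) = 3 ^ (t * N / 4) * 3 ^ a := by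
      rw [← Real.rpow_add (by norm_num)]; congr 1; rw [ha']; ring
    have q4 : (2 : ℝ) ^ (t * N / 4) * 4 ^ a * 2 ^ (t * N / 4) = 2 ^ (N / 2) := by
      rw [show (4 : ℝ) = 2 ^ (2 : ℝ) by norm_num, ← Real.rpow_mul (by norm_num),
        ← Real.rpow_add (by norm_num), ← Real.rpow_add (by norm_num)]
      congr 1; rw [ha']; ring
    rw [q2, q3, ← q4]
    calc _ = 8 / (2 ^ (t * N / 4) * 4 ^ a * 2 ^ (t * N / 4)) * (3 ^ (t * N / 4) * 2 ^ (t * N / 4) *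
        ((3 * (2 - t) / (1 - t)) ^ a * (4 * (2 - t / 2) / (1 - t)) ^ a)) := by ring
      _ = _ := by
        rw [q1]
        have : (2 : ℝ) ^ (t * N / 4) ≠ 0 := by positivity
        have : (4 : ℝ) ^ a ≠ 0 := by positivity
        field_simp
  rw [← key]
  apply mul_lt_mul_of_pos_left _ (by positivity)
  have c1 : (0 : ℝ) < 3 ^ (t * N / 4) := by positivity
  have c2 : (0 : ℝ) < 2 ^ (t * N / 4) := by positivity
  exact mul_lt_mul'' (mul_lt_mul_of_pos_left e1 c1) (mul_lt_mul_of_pos_left e2 c2)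
    (by positivity) (by positivity)

lemma final_bound (S : Finset Pt) (hS : GenPos S) (hN : 6 ≤ S.card)
    (heven : Even S.card) (hhull : hullVtxCount S = 3)
    (T : PlaneGraph S) (hT : IsTriangulation T)
    (t : ℝ) (ht0 : 0 ≤ t) (ht1 : t < 1)
    (hv3 : (v3 T : ℝ) = t * (S.card : ℝ)) :
    (∑ᶠ C : {C : PlaneGraph S // IsSpanningCycle C ∧ C.edges ⊆ T.edges},
        (1 : ℝ) / (supp C.1 : ℝ)) <
      8 * ((3 / (2 : ℝ) ^ t) *
        (((2 - t) * (2 - t / 2)) / (1 - t) ^ 2) ^ (1 - t)) ^ ((S.card : ℝ) / 4) := by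
  obtain ⟨n, hn'⟩ := heven
  have hn : S.card = 2 * n := by omega
  have hn3 : 3 ≤ n := by omega
  obtain ⟨A, B, D, hH⟩ := exists_hull hS hhull
  have hE := euler hS hT hH
  have hE' : (T.edges.card : ℝ) = 3 * S.card - 6 := by
    have : ((T.edges.card + 6 : ℕ) : ℝ) = ((3 * S.card : ℕ) : ℝ) := by rw [hE]
    push_cast at this; linarith
  have hnR : (S.card : ℝ) = 2 * n := by rw [hn]; push_cast; ring
  have hN6 : (6 : ℝ) ≤ S.card := by exact_mod_cast hN
  let V := S.filter (fun p => p ∉ frontier (convexHull ℝ (S : Set Pt)) ∧ degree T p = 3)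
  have hVS : V ⊆ S := Finset.filter_subset _ _
  have hVc : (V.card : ℝ) = t * S.card := hv3
  have hVlt : V.card < S.card := by
    have : (V.card : ℝ) < S.card := by rw [hVc]; nlinarith
    exact_mod_cast this
  have hVinn : ∀ p ∈ V, Inn S A B D p ∧ degree T p = 3 := by
    intro p hp
    obtain ⟨hpS, hf, hd⟩ := Finset.mem_filter.1 hp
    rw [hH.fr p hpS] at hf
    push Not at hf
    exact ⟨⟨hpS, hf.1, hf.2.1, hf.2.2⟩, hd⟩
  have h1 : ((PMs T n).card : ℝ) ≤ 3 ^ (t * S.card / 4) *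
      ((2 * (3 * S.card - 6) - t * S.card * 3) / (S.card - t * S.card)) ^ (((S.card : ℝ) - t * S.card) / 4) := by
    have hk := KH T hn (fun _ => 1) (fun _ => zero_le_one)
    simp only [Finset.prod_const_one, Finset.sum_const, nsmul_eq_mul, mul_one, one_pow] at hk
    refine hk.trans ?_
    have := amgm_split hVS hVlt (fun p => ((T.edges.filter (fun e => p ∈ e)).card : ℝ))
      (fun _ _ => Nat.cast_nonneg _) 3 (2 * (3 * S.card - 6)) (by norm_num) (by
        intro p hp
        have := (hVinn p hp).2
        unfold degree at this
        rw [this]; norm_num) (by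
        have := handshake T (fun _ => 1)
        simp only [Finset.sum_const, nsmul_eq_mul, mul_one] at this
        rw [this, hE'])
    rw [hVc] at this
    exact this
  have h2 := sum_le hS hT hH hn3 hn (2 ^ (t * S.card / 4) *
      (((8 * S.card - 30) - t * S.card * 2) / (S.card - t * S.card)) ^ (((S.card : ℝ) - t * S.card) / 4)) (by
    intro M1 hM1 F hFT hFc hFM hFV
    simp only [PMs, Finset.mem_filter, Finset.mem_powerset] at hM1
    obtain ⟨hMT, y, rfl⟩ := hM1
    refine (KH T hn _ (wt_nonneg (mat y) F)).trans ?_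
    have := amgm_split hVS hVlt (fun p => ∑ e ∈ T.edges.filter (fun e => p ∈ e), wt (mat y) F e ^ 2)
      (fun _ _ => Finset.sum_nonneg fun _ _ => sq_nonneg _) 2 (8 * S.card - 30) (by norm_num) (by
        intro p hp
        obtain ⟨hin, hd⟩ := hVinn p hp
        obtain ⟨e0, he0, hpe0⟩ := mat_cover y p hin.1
        unfold degree at hd
        have hmem : e0 ∈ T.edges.filter (fun e => p ∈ e) := Finset.mem_filter.2 ⟨hMT he0, hpe0⟩
        rw [← Finset.add_sum_erase _ _ hmem]
        have hz : wt (mat y) F e0 = 0 := if_pos he0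
        have ho : ∀ e ∈ (T.edges.filter (fun e => p ∈ e)).erase e0, wt (mat y) F e ^ 2 = 1 := by
          intro e he
          obtain ⟨hne, he⟩ := Finset.mem_erase.1 he
          obtain ⟨heT, hpe⟩ := Finset.mem_filter.1 he
          have g1 : e ∉ mat y := fun h => hne (mat_unique y h he0 hpe hpe0)
          have g2 : e ∉ F := fun h => hFV p hin hd e h hpe
          unfold wt
          rw [if_neg g1, if_neg g2]; norm_num
        rw [hz, Finset.sum_congr rfl ho, Finset.sum_const, Finset.card_erase_of_mem hmem, hd]
        norm_num) (by
        rw [handshake T (fun e => wt (mat y) F e ^ 2)]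
        have hw : ∀ e ∈ T.edges, wt (mat y) F e ^ 2 =
            1 - (if e ∈ mat y then 1 else 0) + (if e ∈ F then 3 else 0) := by
          intro e _
          unfold wt
          by_cases g1 : e ∈ mat y
          · have g2 : e ∉ F := fun h => Finset.disjoint_left.1 hFM h g1
            simp [g1, g2]
          · by_cases g2 : e ∈ F <;> simp [g1, g2]
            norm_num
        rw [Finset.sum_congr rfl hw, Finset.sum_add_distrib, Finset.sum_sub_distrib,
          ← Finset.sum_filter, ← Finset.sum_filter, Finset.filter_mem_eq_inter, Finset.filter_mem_eq_inter,
          Finset.inter_eq_right.2 hMT, Finset.inter_eq_right.2 hFT]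
        simp only [Finset.sum_const, nsmul_eq_mul, mul_one]
        rw [mat_card y, hFc, hE', Nat.cast_sub hn3, hnR]
        push_cast
        ring)
    rw [hVc] at this
    exact this)
  have hRnn : 0 ≤ (2 : ℝ) ^ (t * S.card / 4) *
      (((8 * S.card - 30) - t * S.card * 2) / (S.card - t * S.card)) ^ (((S.card : ℝ) - t * S.card) / 4) := by
    refine mul_nonneg (by positivity) (Real.rpow_nonneg (div_nonneg ?_ ?_) _) <;> nlinarith
  refine lt_of_le_of_lt h2 (lt_of_le_of_lt ?_ (numer hN6 ht0 ht1))
  have h2n : (2 : ℝ) ^ ((S.card : ℝ) / 2) = 2 ^ n := by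
    rw [hnR, ← Real.rpow_natCast]; congr 1; ring
  rw [h2n]
  refine mul_le_mul_of_nonneg_left ?_ (by positivity)
  exact mul_le_mul_of_nonneg_right h1 hRnn

/-- the `v₃(T)`-sensitive bound on `∑_{C ∈ SC(T)} 1/supp(C)`. -/
theorem statement8 (S : Finset Pt) (hS : GenPos S) (hN : 6 ≤ S.card)
    (heven : Even S.card) (hhull : hullVtxCount S = 3)
    (T : PlaneGraph S) (hT : IsTriangulation T)
    (t : ℝ) (ht0 : 0 ≤ t) (ht1 : t < 1)
    (hv3 : (v3 T : ℝ) = t * (S.card : ℝ)) :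
    (∑ᶠ C : {C : PlaneGraph S // IsSpanningCycle C ∧ C.edges ⊆ T.edges},
        (1 : ℝ) / (supp C.1 : ℝ)) <
      8 * ((3 / (2 : ℝ) ^ t) *
        (((2 - t) * (2 - t / 2)) / (1 - t) ^ 2) ^ (1 - t)) ^ ((S.card : ℝ) / 4) := by
  exact final_bound S hS hN heven hhull T hT t ht0 ht1 hv3

end
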